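/- Uniformly for x ≥ 2y ≥ 4, with u = log x / log y, one has S(x,y)/Φ(x,y) = (ξ(u)/ω(u)) · (1 + O(1/log x + e^{−√(log y)})). In particular, for every fixed u ≥ 2, the average of τ(n) over x^{1/u}-rough integers n ≤ x is asymptotic to ξ(u)/ω(u) as x → ∞. -/

import Mathlib

open Real MeasureTheory Filter


/-- `S x y = ∑_{n ≤ x, P⁻(n) > y} τ(n)`, where `n = 1` is included since `P⁻(1) = ∞`. -/
noncomputable def S (x y : ℝ) : ℝ :=
  ∑ n ∈ (Finset.Icc 1 ⌊x⌋₊).filter (fun n => n = 1 ∨ y < (n.minFac : ℝ)),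
    (n.divisors.card : ℝ)

/-- `Φ x y = #{n ≤ x : P⁻(n) > y}`, where `n = 1` is included since `P⁻(1) = ∞`. -/
noncomputable def Phi (x y : ℝ) : ℝ :=
  (((Finset.Icc 1 ⌊x⌋₊).filter (fun n => n = 1 ∨ y < (n.minFac : ℝ))).card : ℝ)


namespace PF

/-- forward difference -/
def D (a : ℕ → ℝ) (n : ℕ) : ℝ := a (n + 1) - a n

noncomputable def ee (x : ℝ) : ℂ := Complex.exp (x * Complex.I)

lemma norm_ee (x : ℝ) : ‖ee x‖ = 1 := Complex.norm_exp_ofReal_mul_I x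
lemma ee_add (x y : ℝ) : ee (x + y) = ee x * ee y := by
  simp [ee, add_mul, Complex.exp_add]
lemma ee_conj (x : ℝ) : (starRingEnd ℂ) (ee x) = ee (-x) := by
  simp [ee, ← Complex.exp_conj]

lemma D_shift (a : ℕ → ℝ) (h j n : ℕ) :
    (D^[j] (fun n => a (n + h) - a n)) n = (D^[j] a) (n + h) - (D^[j] a) n := by
  induction j generalizing n with
  | zero => simp
  | succ j ih =>
    rw [Function.iterate_succ_apply', Function.iterate_succ_apply']
    simp only [D, ih]
    rw [show n + 1 + h = n + h + 1 by ring]; ring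

lemma D_shift_sum (a : ℕ → ℝ) (h j n : ℕ) :
    (D^[j] (fun n => a (n + h) - a n)) n = ∑ i ∈ Finset.range h, (D^[j+1] a) (n + i) := by
  rw [D_shift, Function.iterate_succ_apply']
  have := Finset.sum_range_sub (fun i => (D^[j] a) (n + i)) h
  simp only [add_zero] at this
  rw [← this]; rfl

/-- the class of sequences -/
def Cl (j : ℕ) (lam B : ℝ) (M : ℕ) (a : ℕ → ℝ) : Prop :=
  ∀ n < M, lam ≤ (D^[j] a) n ∧ (D^[j] a) n ≤ B * lam ∧ (D^[j+1] a) n ≤ 0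

lemma Cl_shift {j : ℕ} {lam B : ℝ} {M : ℕ} {a : ℕ → ℝ} (h : ℕ) (ha : Cl (j+1) lam B M a) :
    Cl j (h * lam) B (M - h) (fun n => a (n + h) - a n) := by
  intro n hn
  rw [D_shift_sum, D_shift_sum]
  have key : ∀ i ∈ Finset.range h, n + i < M := fun i hi => by
    have := Finset.mem_range.1 hi; omega
  refine ⟨?_, ?_, Finset.sum_nonpos fun i hi => (ha _ (key i hi)).2.2⟩
  · have := Finset.card_nsmul_le_sum (Finset.range h) (fun i => (D^[j+1] a) (n + i)) lam
      fun i hi => (ha _ (key i hi)).1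
    simpa using this
  · have := Finset.sum_le_card_nsmul (Finset.range h) (fun i => (D^[j+1] a) (n + i)) (B * lam)
      fun i hi => (ha _ (key i hi)).2.1
    simp only [Finset.card_range, nsmul_eq_mul] at this
    linarith

/-- Abel bound -/
lemma abel_aux (z : ℕ → ℂ) (g : ℕ → ℝ) (M : ℕ) (hz : ∀ n, ‖z n‖ = 1) (hg0 : 0 ≤ g 0)
    (hg : ∀ n < M, g n ≤ g (n + 1)) :
    ‖∑ n ∈ Finset.range (M + 1), (z (n + 1) - z n) * g n - z (M + 1) * g M‖ ≤ g M := by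
  induction M with
  | zero => simp [sub_mul, hz, abs_of_nonneg hg0]
  | succ M ih =>
    rw [Finset.sum_range_succ]
    have h1 := ih fun n hn => hg n (by omega)
    have h2 := hg M (by omega)
    have : ∑ n ∈ Finset.range (M + 1), (z (n + 1) - z n) * g n +
        (z (M + 1 + 1) - z (M + 1)) * g (M + 1) - z (M + 1 + 1) * g (M + 1)
        = (∑ n ∈ Finset.range (M + 1), (z (n + 1) - z n) * g n - z (M + 1) * g M)
          - z (M + 1) * ((g (M + 1) - g M : ℝ) : ℂ) := by push_cast; ring
    rw [this]
    refine (norm_sub_le _ _).trans ?_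
    rw [norm_mul, hz, one_mul, Complex.norm_real, norm_of_nonneg (by linarith)]
    linarith

lemma KL_id (x : ℝ) (h0 : 0 < x) (hpi : x ≤ π) :
    (ee x - 1) * (-(1/2) - Complex.I * ((cos (x/2) / (2 * sin (x/2)) : ℝ) : ℂ)) = 1 := by
  have hs : 0 < sin (x/2) := sin_pos_of_pos_of_lt_pi (by linarith) (by linarith [pi_pos])
  have e1 : ee x = (cos x : ℝ) + (sin x : ℝ) * Complex.I := by
    simp [ee, Complex.exp_mul_I]
  have c2 : cos x = 1 - 2 * sin (x/2)^2 := by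
    rw [show x = 2 * (x/2) by ring, cos_two_mul, show 2 * (x/2)/2 = x/2 by ring]
    nlinarith [sin_sq_add_cos_sq (x/2)]
  have s2 : sin x = 2 * sin (x/2) * cos (x/2) := by
    rw [show x = 2 * (x/2) by ring, sin_two_mul, show 2 * (x/2)/2 = x/2 by ring]
  have hcs := sin_sq_add_cos_sq (x/2)
  rw [e1, c2, s2]
  generalize sin (x/2) = s at *
  generalize cos (x/2) = c at *
  have hs0 : (s : ℂ) ≠ 0 := by exact_mod_cast hs.ne'
  have hcs' : (s : ℂ)^2 + (c : ℂ)^2 = 1 := by exact_mod_cast hcs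
  push_cast
  field_simp
  linear_combination (2 * (s : ℂ)) * hcs' - 2 * s * (c : ℂ)^2 * Complex.I_sq

lemma g_anti {x y : ℝ} (hx : 0 < x) (hxy : x ≤ y) (hy : y ≤ π) :
    cos (y/2) / (2 * sin (y/2)) ≤ cos (x/2) / (2 * sin (x/2)) := by
  have hs : 0 < sin (x/2) := sin_pos_of_pos_of_lt_pi (by linarith) (by linarith [pi_pos])
  have hs' : 0 < sin (y/2) := sin_pos_of_pos_of_lt_pi (by linarith) (by linarith [pi_pos])
  rw [div_le_div_iff₀ (by positivity) (by positivity)]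
  have : 0 ≤ sin (y/2 - x/2) := sin_nonneg_of_nonneg_of_le_pi (by linarith) (by linarith [pi_pos])
  rw [sin_sub] at this
  linarith

lemma g_le {x : ℝ} (hx : 0 < x) (hy : x ≤ π) : cos (x/2) / (2 * sin (x/2)) ≤ π / (2 * x) := by
  have h := mul_le_sin (x := x/2) (by linarith) (by linarith)
  have hp := pi_pos
  have h1 : 2 / π * (x/2) = x / π := by ring
  rw [h1] at h
  have hs : 0 < x / π := by positivity
  rw [div_le_div_iff₀ (by linarith) (by positivity)]
  have h2 : x ≤ π * sin (x/2) := by rw [div_le_iff₀ hp] at h; linarith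
  nlinarith [cos_le_one (x/2)]

lemma KL {lam B : ℝ} {M : ℕ} {a : ℕ → ℝ} (hl : 0 < lam) (hB : B * lam ≤ π)
    (ha : Cl 1 lam B M a) : ‖∑ n ∈ Finset.range M, ee (a n)‖ ≤ 7 / lam := by
  rcases M with _ | M
  · simp; positivity
  have hd : ∀ n < M + 1, lam ≤ D a n ∧ D a n ≤ π := fun n hn =>
    ⟨(ha n hn).1, (ha n hn).2.1.trans hB⟩
  have hanti : ∀ n < M, D a (n+1) ≤ D a n := fun n hn => by
    have := (ha n (by omega)).2.2
    simp only [Function.iterate_succ, Function.iterate_zero, Function.comp, id] at this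
    simp only [D] at this ⊢; linarith
  set g : ℕ → ℝ := fun n => cos (D a n / 2) / (2 * sin (D a n / 2)) with hg
  have hterm : ∀ n ∈ Finset.range (M+1), ee (a n) =
      -(1/2) * (ee (a (n+1)) - ee (a n)) - Complex.I * ((ee (a (n+1)) - ee (a n)) * g n) := by
    intro n hn
    have h1 := hd n (Finset.mem_range.1 hn)
    have := KL_id (D a n) (by linarith) h1.2
    have h2 : ee (a (n+1)) = ee (a n) * ee (D a n) := by rw [← ee_add]; simp [D]
    rw [h2]
    linear_combination -ee (a n) * this
  rw [Finset.sum_congr rfl hterm, Finset.sum_sub_distrib, ← Finset.mul_sum, ← Finset.mul_sum,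
    Finset.sum_range_sub (fun n => ee (a n))]
  have hg0 : 0 ≤ g 0 := by
    have h1 := hd 0 (by omega)
    refine div_nonneg (cos_nonneg_of_mem_Icc ⟨by linarith [pi_pos], by linarith⟩)
      (mul_nonneg zero_le_two (sin_nonneg_of_nonneg_of_le_pi (by linarith) (by linarith [pi_pos])))
  have hab := abel_aux (fun n => ee (a n)) g M (fun n => norm_ee _) hg0 (fun n hn => by
    exact g_anti (by linarith [(hd (n+1) (by omega)).1]) (hanti n hn) (hd n (by omega)).2)
  have hgM : g M ≤ π / (2 * lam) := by
    have h1 := hd M (by omega)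
    refine (g_le (by linarith) h1.2).trans ?_
    have := pi_pos
    gcongr; exact h1.1
  have hlam : 1 ≤ π / lam := by rw [le_div_iff₀ hl]; linarith [hd 0 (by omega)]
  have n1 : ‖-(1/2) * (ee (a (M+1)) - ee (a 0))‖ ≤ 1 := by
    rw [norm_mul]
    have := norm_sub_le (ee (a (M+1))) (ee (a 0))
    rw [norm_ee, norm_ee] at this
    have h2 : ‖(-(1/2) : ℂ)‖ = 1/2 := by simp
    rw [h2]; linarith
  have n2 : ‖∑ n ∈ Finset.range (M+1), (ee (a (n+1)) - ee (a n)) * g n‖ ≤ 2 * g M := by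
    have h3 := norm_sub_norm_le (∑ n ∈ Finset.range (M+1), (ee (a (n+1)) - ee (a n)) * g n)
      (ee (a (M+1)) * g M)
    rw [norm_mul, norm_ee, one_mul, Complex.norm_real] at h3
    have : 0 ≤ g M := (norm_nonneg _).trans hab
    rw [norm_of_nonneg this] at h3
    linarith
  refine (norm_sub_le _ _).trans ?_
  rw [norm_mul Complex.I, Complex.norm_I, one_mul]
  have : π / (2 * lam) = π / lam / 2 := by field_simp
  have hpi : π / lam ≤ 3.5 / lam := by gcongr; linarith [pi_lt_d2]
  have h7 : 7 / lam = 2 * (3.5 / lam) := by ring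
  linarith

end PF

namespace PF
noncomputable def wz (z : ℕ → ℂ) (M m r : ℕ) : ℂ := if r ≤ m ∧ m - r < M then z (m - r) else 0

lemma wz_sum (z : ℕ → ℂ) (M H r : ℕ) (hr : r < H) :
    ∑ m ∈ Finset.range (M + H), wz z M m r = ∑ n ∈ Finset.range M, z n := by
  unfold wz
  rw [← Finset.sum_filter]
  refine Finset.sum_nbij' (fun m => m - r) (fun n => n + r) ?_ ?_ ?_ ?_ ?_
  all_goals intro m hm; simp at hm ⊢
  all_goals omega

lemma wz_corr (z : ℕ → ℂ) (M H r s : ℕ) (hs : s < H) (hrs : r ≤ s) :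
    ∑ m ∈ Finset.range (M + H), wz z M m r * (starRingEnd ℂ) (wz z M m s)
     = ∑ n ∈ Finset.range (M - (s - r)), z (n + (s - r)) * (starRingEnd ℂ) (z n) := by
  have : ∀ m, wz z M m r * (starRingEnd ℂ) (wz z M m s) =
      if (s ≤ m ∧ m - r < M) then z (m - r) * (starRingEnd ℂ) (z (m - s)) else 0 := by
    intro m; unfold wz
    by_cases h : s ≤ m ∧ m - r < M
    · rw [if_pos h, if_pos (by omega), if_pos (by omega)]
    · rw [if_neg h]
      by_cases h1 : r ≤ m ∧ m - r < M
      · rw [if_neg (show ¬ (s ≤ m ∧ m - s < M) by omega)]; simp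
      · rw [if_neg h1]; simp
  simp_rw [this]
  rw [← Finset.sum_filter]
  refine Finset.sum_nbij' (fun m => m - s) (fun n => n + s) ?_ ?_ ?_ ?_ ?_
  all_goals intro m hm; simp at hm ⊢
  · omega
  · omega
  · omega
  · rw [show m - s + (s - r) = m - r by omega]; simp

lemma vdC (z : ℕ → ℂ) (M H : ℕ) (hH : 1 ≤ H) (Aa : ℕ → ℝ)
    (hA : ∀ h < H, ‖∑ n ∈ Finset.range (M - h), z (n + h) * (starRingEnd ℂ) (z n)‖ ≤ Aa h) :
    ‖∑ n ∈ Finset.range M, z n‖ ^ 2 ≤ (M + H : ℝ) / H * (2 * ∑ h ∈ Finset.range H, Aa h) := by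
  have hA0 : ∀ h < H, 0 ≤ Aa h := fun h hh => (norm_nonneg _).trans (hA h hh)
  have h1 : (H : ℂ) * ∑ n ∈ Finset.range M, z n =
      ∑ m ∈ Finset.range (M + H), ∑ r ∈ Finset.range H, wz z M m r := by
    rw [Finset.sum_comm, Finset.sum_congr rfl (fun r hr => wz_sum z M H r (Finset.mem_range.1 hr))]
    simp
  have h2 : (H : ℝ) ^ 2 * ‖∑ n ∈ Finset.range M, z n‖ ^ 2 ≤
      (M + H) * ∑ m ∈ Finset.range (M + H), ‖∑ r ∈ Finset.range H, wz z M m r‖ ^ 2 := by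
    have : (H : ℝ) * ‖∑ n ∈ Finset.range M, z n‖ ≤
        ∑ m ∈ Finset.range (M + H), ‖∑ r ∈ Finset.range H, wz z M m r‖ := by
      have h3 := norm_sum_le (Finset.range (M + H)) (fun m => ∑ r ∈ Finset.range H, wz z M m r)
      rw [← h1, norm_mul, Complex.norm_natCast] at h3
      exact h3
    have h4 := sq_sum_le_card_mul_sum_sq (s := Finset.range (M + H))
      (f := fun m => ‖∑ r ∈ Finset.range H, wz z M m r‖)
    rw [Finset.card_range] at h4
    push_cast at h4
    refine le_trans ?_ h4
    rw [← mul_pow]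
    exact pow_le_pow_left₀ (by positivity) this 2
  have h5 : ∑ m ∈ Finset.range (M + H), ‖∑ r ∈ Finset.range H, wz z M m r‖ ^ 2 ≤
      H * (2 * ∑ h ∈ Finset.range H, Aa h) := by
    have e1 : ((∑ m ∈ Finset.range (M + H), ‖∑ r ∈ Finset.range H, wz z M m r‖ ^ 2 : ℝ) : ℂ)
        = ∑ r ∈ Finset.range H, ∑ s ∈ Finset.range H,
          ∑ m ∈ Finset.range (M + H), wz z M m r * (starRingEnd ℂ) (wz z M m s) := by
      push_cast
      rw [Finset.sum_congr rfl (fun r _ => Finset.sum_comm), Finset.sum_comm]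
      refine Finset.sum_congr rfl fun m _ => ?_
      rw [← Complex.mul_conj', map_sum, Finset.sum_mul_sum]
    have e2 : ∀ r ∈ Finset.range H, ∀ s ∈ Finset.range H,
        ‖∑ m ∈ Finset.range (M + H), wz z M m r * (starRingEnd ℂ) (wz z M m s)‖ ≤
          Aa (s - r + (r - s)) := by
      intro r hr s hs
      rw [Finset.mem_range] at hr hs
      rcases le_total r s with h | h
      · rw [wz_corr z M H r s hs h, Nat.sub_eq_zero_of_le h, add_zero]
        exact hA _ (by omega)
      · have := wz_corr z M H s r hr h
        rw [← Complex.norm_conj, map_sum]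
        simp only [map_mul, Complex.conj_conj]
        simp_rw [mul_comm ((starRingEnd ℂ) (wz z M _ r))]
        rw [this, Nat.sub_eq_zero_of_le h, zero_add]
        exact hA _ (by omega)
    have e3 : ∀ r ∈ Finset.range H, ∑ s ∈ Finset.range H, Aa (s - r + (r - s)) ≤
        2 * ∑ h ∈ Finset.range H, Aa h := by
      intro r hr
      rw [Finset.mem_range] at hr
      have : Finset.range H = Finset.range r ∪ Finset.Ico r H := by
        ext x; simp; omega
      have hd : Disjoint (Finset.range r) (Finset.Ico r H) := by
        rw [Finset.disjoint_left]; intro x; simp; omega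
      have i1 : ∑ s ∈ Finset.range r, Aa (s - r + (r - s)) ≤ ∑ h ∈ Finset.range H, Aa h := by
        rw [← Finset.sum_image (f := Aa) (g := fun s => s - r + (r - s))]
        · refine Finset.sum_le_sum_of_subset_of_nonneg ?_ ?_
          · intro x; simp; intro y; omega
          · intro i hi _; exact hA0 i (Finset.mem_range.1 hi)
        · intro x hx y hy; simp at hx hy ⊢; omega
      have i2 : ∑ s ∈ Finset.Ico r H, Aa (s - r + (r - s)) ≤ ∑ h ∈ Finset.range H, Aa h := by
        rw [← Finset.sum_image (f := Aa) (g := fun s => s - r + (r - s))]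
        · refine Finset.sum_le_sum_of_subset_of_nonneg ?_ ?_
          · intro x; simp; intro y; omega
          · intro i hi _; exact hA0 i (Finset.mem_range.1 hi)
        · intro x hx y hy; simp at hx hy ⊢; omega
      rw [two_mul]
      conv_lhs => rw [this]
      rw [Finset.sum_union hd]
      exact add_le_add i1 i2
    have e4 : (∑ m ∈ Finset.range (M + H), ‖∑ r ∈ Finset.range H, wz z M m r‖ ^ 2 : ℝ) =
      ‖((∑ m ∈ Finset.range (M + H), ‖∑ r ∈ Finset.range H, wz z M m r‖ ^ 2 : ℝ) : ℂ)‖ := by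
      rw [Complex.norm_real, norm_of_nonneg (by positivity)]
    rw [e4, e1]
    refine (norm_sum_le _ _).trans ?_
    have : ∀ r ∈ Finset.range H, ‖∑ s ∈ Finset.range H,
          ∑ m ∈ Finset.range (M + H), wz z M m r * (starRingEnd ℂ) (wz z M m s)‖ ≤
          2 * ∑ h ∈ Finset.range H, Aa h := fun r hr =>
      (norm_sum_le _ _).trans ((Finset.sum_le_sum (e2 r hr)).trans (e3 r hr))
    refine (Finset.sum_le_card_nsmul _ _ _ this).trans ?_
    simp
  have hHp : (0 : ℝ) < H := by exact_mod_cast hH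
  have h6 := h2.trans (mul_le_mul_of_nonneg_left h5 (by positivity))
  rw [div_mul_eq_mul_div, le_div_iff₀ hHp]
  have : (H : ℝ) * (‖∑ n ∈ Finset.range M, z n‖ ^ 2 * H) ≤
      H * ((M + H) * (2 * ∑ h ∈ Finset.range H, Aa h)) := by nlinarith
  exact le_of_mul_le_mul_left this hHp

end PF

namespace PF
lemma vdC' {a : ℕ → ℝ} {M N : ℕ} (hN : 1 ≤ N) (hM : M ≤ N) {X : ℝ} (hX : 1 ≤ X) (hXN : X ≤ N)
    (Aa : ℕ → ℝ) (hA : ∀ h : ℕ, 1 ≤ h → (h : ℝ) < X →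
      ‖∑ n ∈ Finset.range (M - h), ee (a (n + h) - a n)‖ ≤ Aa h) :
    ‖∑ n ∈ Finset.range M, ee (a n)‖ ^ 2 ≤
      6 * N / X * (N + ∑ h ∈ Finset.Ico 1 ⌈X⌉₊, Aa h) := by
  have hH : 1 ≤ ⌈X⌉₊ := Nat.one_le_ceil_iff.2 (by linarith)
  have hNr : (1 : ℝ) ≤ N := by exact_mod_cast hN
  have hMr : (M : ℝ) ≤ N := by exact_mod_cast hM
  have hz : ∀ h n, ee (a (n + h)) * (starRingEnd ℂ) (ee (a n)) = ee (a (n + h) - a n) := by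
    intro h n; rw [ee_conj, ← ee_add]; rfl
  have := vdC (fun n => ee (a n)) M ⌈X⌉₊ hH (fun h => if h = 0 then (N : ℝ) else Aa h) (by
    intro h hh
    simp_rw [hz]
    by_cases h0 : h = 0
    · subst h0
      simp [ee, hMr]
    · rw [if_neg h0]
      exact hA h (by omega) (Nat.lt_ceil.1 hh))
  refine this.trans ?_
  have e : ∑ h ∈ Finset.range ⌈X⌉₊, (if h = 0 then (N : ℝ) else Aa h) =
      N + ∑ h ∈ Finset.Ico 1 ⌈X⌉₊, Aa h := by
    rw [Finset.range_eq_Ico, Finset.sum_eq_sum_Ico_succ_bot (by omega)]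
    simp only [if_true]
    congr 1
    refine Finset.sum_congr rfl fun h hh => ?_
    rw [if_neg]; simp at hh; omega
  rw [e]
  have hs : 0 ≤ ∑ h ∈ Finset.Ico 1 ⌈X⌉₊, Aa h := Finset.sum_nonneg fun h hh => by
    rw [Finset.mem_Ico] at hh
    exact (norm_nonneg _).trans (hA h hh.1 (Nat.lt_ceil.1 hh.2))
  have hc : X ≤ (⌈X⌉₊ : ℝ) := Nat.le_ceil X
  have hc2 : (⌈X⌉₊ : ℝ) < X + 1 := Nat.ceil_lt_add_one (by linarith)
  have : ((M : ℝ) + ⌈X⌉₊) / ⌈X⌉₊ ≤ 3 * N / X := by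
    apply div_le_div₀ <;> linarith
  calc _ ≤ 3 * N / X * (2 * (N + ∑ h ∈ Finset.Ico 1 ⌈X⌉₊, Aa h)) := by gcongr
    _ = _ := by ring

/-- the soft power-saving statement -/
def PS (j : ℕ) (B ep : ℝ) : Prop :=
  ∃ δ : ℝ, 0 < δ ∧ ∃ C : ℝ, 0 ≤ C ∧ ∀ N M : ℕ, 1 ≤ N → M ≤ N → ∀ lam : ℝ, (N : ℝ) ^ (-2 + ep) ≤ lam →
    lam ≤ (N : ℝ) ^ (-ep) → ∀ a : ℕ → ℝ, Cl j lam B M a →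
    ‖∑ n ∈ Finset.range M, ee (a n)‖ ≤ C * (N : ℝ) ^ (1 - δ)

lemma PS_succ {j : ℕ} {B ep : ℝ} (he : 0 < ep) (he1 : ep ≤ 1) (h : PS j B (ep / 2)) :
    PS (j + 1) B ep := by
  obtain ⟨δ, hδ, C, hC, h⟩ := h
  refine ⟨min (ep / 2) δ / 2, by positivity, 6 + 12 * C, by positivity, ?_⟩
  intro N M hN hM lam hl1 hl2 a ha
  have hNr : (1 : ℝ) ≤ N := by exact_mod_cast hN
  have hN0 : (0 : ℝ) < N := by linarith
  have hl0 : 0 < lam := lt_of_lt_of_le (by positivity) hl1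
  set X : ℝ := (N : ℝ) ^ (ep / 2) with hX
  have hX1 : 1 ≤ X := one_le_rpow hNr (by linarith)
  have hXN : X ≤ N := by
    conv_rhs => rw [← rpow_one (N : ℝ)]
    exact rpow_le_rpow_of_exponent_le hNr (by linarith)
  have key := vdC' (a := a) hN hM hX1 hXN (fun _ => C * (N : ℝ) ^ (1 - δ)) (by
    intro k hk1 hkX
    have hk1' : (1 : ℝ) ≤ k := by exact_mod_cast hk1
    refine h N (M - k) hN (by omega) (k * lam) ?_ ?_ _ (Cl_shift k ha)
    · calc (N : ℝ) ^ (-2 + ep / 2) ≤ (N : ℝ) ^ (-2 + ep) :=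
            rpow_le_rpow_of_exponent_le hNr (by linarith)
        _ ≤ 1 * lam := by linarith
        _ ≤ k * lam := by gcongr
    · calc k * lam ≤ X * (N : ℝ) ^ (-ep) := by gcongr
        _ = (N : ℝ) ^ (-(ep / 2)) := by rw [hX, ← rpow_add hN0]; congr 1; ring)
  simp only [Finset.sum_const, Nat.card_Ico, nsmul_eq_mul] at key
  set m := min (ep / 2) δ with hm
  have hm1 : m ≤ ep / 2 := min_le_left _ _
  have hm2 : m ≤ δ := min_le_right _ _
  have hcard : ((⌈X⌉₊ - 1 : ℕ) : ℝ) ≤ X := by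
    have hH : 1 ≤ ⌈X⌉₊ := Nat.one_le_ceil_iff.2 (by linarith)
    push_cast [Nat.cast_sub hH]
    linarith [Nat.ceil_lt_add_one (show 0 ≤ X by linarith)]
  have b1 : 6 * (N : ℝ) / X * (N + ((⌈X⌉₊ - 1 : ℕ) : ℝ) * (C * (N : ℝ) ^ (1 - δ))) ≤
      6 * (N : ℝ) ^ (2 - m) + 6 * C * (N : ℝ) ^ (2 - m) := by
    calc _ ≤ 6 * (N : ℝ) / X * (N + X * (C * (N : ℝ) ^ (1 - δ))) := by gcongr
      _ = 6 * ((N : ℝ) * N / X) + 6 * C * (N * (N : ℝ) ^ (1 - δ)) := by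
        have : X ≠ 0 := by positivity
        field_simp
      _ ≤ _ := by
        have e1 : (N : ℝ) * N / X = (N : ℝ) ^ (2 - ep / 2) := by
          rw [rpow_sub hN0, ← hX, rpow_two, sq]
        have e2 : (N : ℝ) * (N : ℝ) ^ (1 - δ) = (N : ℝ) ^ (2 - δ) := by
          rw [show (2 - δ) = 1 + (1 - δ) by ring, rpow_add hN0, rpow_one]
        rw [e1, e2]
        gcongr
  have b2 : ((6 + 12 * C) * (N : ℝ) ^ (1 - m / 2)) ^ 2 = (6 + 12 * C) ^ 2 * (N : ℝ) ^ (2 - m) := by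
    rw [mul_pow, ← rpow_natCast ((N : ℝ) ^ (1 - m / 2)), ← rpow_mul hN0.le]
    congr 2; push_cast; ring
  refine le_of_sq_le_sq ?_ (by positivity)
  rw [b2]
  refine (key.trans b1).trans ?_
  have : 0 < (N : ℝ) ^ (2 - m) := by positivity
  nlinarith [mul_nonneg hC this.le, mul_nonneg (mul_nonneg hC hC) this.le]

lemma PS_two {B ep : ℝ} (he : 0 < ep) (he1 : ep ≤ 1) (hB : 0 ≤ B) : PS 2 B ep := by
  obtain ⟨K, hK0, hK⟩ : ∃ K : ℝ, 0 < K ∧ ∀ N : ℕ, 1 ≤ N → 14 * (1 + log (2 * N)) ≤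
      K * (N : ℝ) ^ (ep / 8) := by
    refine ⟨14 * 2 + 14 * (1 / (ep / 8)), by positivity, fun N hN => ?_⟩
    have hNr : (1 : ℝ) ≤ N := by exact_mod_cast hN
    have h1 := log_le_rpow_div (x := (N : ℝ)) (by linarith) (show 0 < ep / 8 by linarith)
    have h2 : 1 ≤ (N : ℝ) ^ (ep / 8) := one_le_rpow hNr (by linarith)
    rw [log_mul (by norm_num) (by linarith)]
    have h3 : log 2 ≤ 1 := by linarith [log_two_lt_d9]
    rw [div_eq_mul_one_div] at h1
    nlinarith
  obtain ⟨N0, hN01, hN0⟩ : ∃ N0 : ℝ, 1 ≤ N0 ∧ ∀ N : ℝ, N0 ≤ N → B * N ^ (-(ep / 4)) ≤ π := by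
    have := (tendsto_rpow_neg_atTop (show 0 < ep / 4 by linarith)).const_mul B
    rw [mul_zero] at this
    have := this.eventually (ge_mem_nhds pi_pos)
    obtain ⟨N0, h⟩ := eventually_atTop.1 this
    exact ⟨max 1 N0, le_max_left _ _, fun N hN => h N ((le_max_right _ _).trans hN)⟩
  refine ⟨ep / 8, by positivity, max N0 (6 + 6 * K), by positivity, ?_⟩
  intro N M hN hM lam hl1 hl2 a ha
  have hNr : (1 : ℝ) ≤ N := by exact_mod_cast hN
  have hNp : (0 : ℝ) < N := by linarith
  have hl0 : 0 < lam := lt_of_lt_of_le (by positivity) hl1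
  by_cases hbig : N0 ≤ (N : ℝ)
  swap
  · have t1 : ‖∑ n ∈ Finset.range M, ee (a n)‖ ≤ M := by
      refine (norm_sum_le _ _).trans ?_
      simp [norm_ee]
    have t2 : (M : ℝ) ≤ N := by exact_mod_cast hM
    have t3 : 1 ≤ (N : ℝ) ^ (1 - ep / 8) := one_le_rpow hNr (by linarith)
    push Not at hbig
    have t4 := le_max_left N0 (6 + 6 * K)
    nlinarith
  -- general bound
  have gen : ∀ X : ℝ, 1 ≤ X → X ≤ N → X * lam ≤ (N : ℝ) ^ (-(ep / 4)) →
      ‖∑ n ∈ Finset.range M, ee (a n)‖ ^ 2 ≤ 6 * N / X * (N + K * (N : ℝ) ^ (ep / 8) / lam) := by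
    intro X hX1 hXN hXl
    refine (vdC' (a := a) hN hM hX1 hXN (fun h => 7 / lam * (1 / h)) ?_).trans ?_
    · intro h hh1 hhX
      have hh0 : (0 : ℝ) < h := by exact_mod_cast hh1
      refine (KL (lam := h * lam) (B := B) (by positivity) ?_ (Cl_shift h ha)).trans_eq ?_
      · calc B * (h * lam) ≤ B * (X * lam) := by gcongr
          _ ≤ B * (N : ℝ) ^ (-(ep / 4)) := by gcongr
          _ ≤ π := hN0 N hbig
      · field_simp
    · have hH : ∑ h ∈ Finset.Ico 1 ⌈X⌉₊, (1 / (h : ℝ)) ≤ 1 + log (2 * N) := by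
        have h1 := harmonic_le_one_add_log (⌈X⌉₊)
        rw [harmonic_eq_sum_Icc] at h1
        push_cast at h1
        have h2 : ∑ h ∈ Finset.Ico 1 ⌈X⌉₊, (1 / (h : ℝ)) ≤ ∑ i ∈ Finset.Icc 1 ⌈X⌉₊, (i : ℝ)⁻¹ := by
          simp_rw [one_div]
          exact Finset.sum_le_sum_of_subset_of_nonneg Finset.Ico_subset_Icc_self
            (fun i _ _ => by positivity)
        have hc : 1 ≤ ⌈X⌉₊ := Nat.one_le_ceil_iff.2 (by linarith)
        have h3 : log (⌈X⌉₊ : ℝ) ≤ log (2 * N) := by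
          refine log_le_log (by exact_mod_cast hc) ?_
          have := Nat.ceil_lt_add_one (show 0 ≤ X by linarith)
          linarith
        linarith
      rw [← Finset.mul_sum]
      have hKN := hK N hN
      have : 7 / lam * ∑ h ∈ Finset.Ico 1 ⌈X⌉₊, (1 / (h : ℝ)) ≤ K * (N : ℝ) ^ (ep / 8) / lam := by
        rw [div_mul_eq_mul_div]
        have hlog : 0 ≤ log (2 * N) := log_nonneg (by linarith)
        refine div_le_div_of_nonneg_right ?_ hl0.le
        linarith
      gcongr
  have fin : ‖∑ n ∈ Finset.range M, ee (a n)‖ ^ 2 ≤ (6 + 6 * K) * (N : ℝ) ^ (2 - ep / 4) := by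
    by_cases hcase : lam ≤ (N : ℝ) ^ (-1 + ep / 4)
    · refine (gen ((N : ℝ) ^ (1 - ep / 2)) (one_le_rpow hNr (by linarith)) ?_ ?_).trans ?_
      · conv_rhs => rw [← rpow_one (N : ℝ)]
        exact rpow_le_rpow_of_exponent_le hNr (by linarith)
      · calc (N : ℝ) ^ (1 - ep / 2) * lam ≤ (N : ℝ) ^ (1 - ep / 2) * (N : ℝ) ^ (-1 + ep / 4) := by
              gcongr
          _ = _ := by rw [← rpow_add hNp]; congr 1; ring
      · have e1 : 6 * (N : ℝ) / (N : ℝ) ^ (1 - ep / 2) = 6 * (N : ℝ) ^ (ep / 2) := by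
          have h0 : (N : ℝ) ^ (ep / 2) * (N : ℝ) ^ (1 - ep / 2) = N := by
            rw [← rpow_add hNp]; ring_nf; exact rpow_one _
          rw [div_eq_iff (by positivity), mul_assoc, h0]
        have e2 : K * (N : ℝ) ^ (ep / 8) / lam ≤ K * (N : ℝ) ^ (2 - 7 * ep / 8) := by
          calc _ ≤ K * (N : ℝ) ^ (ep / 8) / (N : ℝ) ^ (-2 + ep) := by gcongr
            _ = K * ((N : ℝ) ^ (ep / 8) / (N : ℝ) ^ (-2 + ep)) := by ring
            _ = _ := by rw [← rpow_sub hNp]; congr 2; ring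
        rw [e1]
        calc _ ≤ 6 * (N : ℝ) ^ (ep / 2) * (N + K * (N : ℝ) ^ (2 - 7 * ep / 8)) := by gcongr
          _ = 6 * ((N : ℝ) ^ (ep / 2) * (N : ℝ) ^ (1 : ℝ)) +
              6 * K * ((N : ℝ) ^ (ep / 2) * (N : ℝ) ^ (2 - 7 * ep / 8)) := by
              rw [rpow_one]; ring
          _ ≤ 6 * (N : ℝ) ^ (2 - ep / 4) + 6 * K * (N : ℝ) ^ (2 - ep / 4) := by
              rw [← rpow_add hNp, ← rpow_add hNp]
              gcongr <;> first | exact hNr | linarith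
          _ = _ := by ring
    · push Not at hcase
      refine (gen ((N : ℝ) ^ (ep / 2)) (one_le_rpow hNr (by linarith)) ?_ ?_).trans ?_
      · conv_rhs => rw [← rpow_one (N : ℝ)]
        exact rpow_le_rpow_of_exponent_le hNr (by linarith)
      · calc (N : ℝ) ^ (ep / 2) * lam ≤ (N : ℝ) ^ (ep / 2) * (N : ℝ) ^ (-ep) := by
              gcongr
          _ = (N : ℝ) ^ (ep / 2 + -ep) := by rw [← rpow_add hNp]
          _ ≤ _ := rpow_le_rpow_of_exponent_le hNr (by linarith)
      · have e1 : 6 * (N : ℝ) / (N : ℝ) ^ (ep / 2) = 6 * (N : ℝ) ^ (1 - ep / 2) := by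
          rw [mul_div_assoc, rpow_sub hNp 1, rpow_one]
        have e2 : K * (N : ℝ) ^ (ep / 8) / lam ≤ K * (N : ℝ) ^ (1 : ℝ) := by
          calc _ ≤ K * (N : ℝ) ^ (ep / 8) / (N : ℝ) ^ (-1 + ep / 4) := by gcongr
            _ = K * ((N : ℝ) ^ (ep / 8) / (N : ℝ) ^ (-1 + ep / 4)) := by ring
            _ = K * ((N : ℝ) ^ (ep / 8 - (-1 + ep / 4))) := by rw [← rpow_sub hNp]
            _ ≤ _ := by gcongr <;> first | exact hNr | linarith
        rw [e1]
        calc _ ≤ 6 * (N : ℝ) ^ (1 - ep / 2) * (N + K * (N : ℝ) ^ (1 : ℝ)) := by gcongr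
          _ = 6 * (1 + K) * ((N : ℝ) ^ (1 - ep / 2) * (N : ℝ) ^ (1 : ℝ)) := by
              rw [rpow_one]; ring
          _ ≤ 6 * (1 + K) * (N : ℝ) ^ (2 - ep / 4) := by
              rw [← rpow_add hNp]
              gcongr <;> first | exact hNr | linarith
          _ = _ := by ring
  have b2 : ((6 + 6 * K) * (N : ℝ) ^ (1 - ep / 8)) ^ 2 = (6 + 6 * K) ^ 2 * (N : ℝ) ^ (2 - ep / 4) := by
    rw [mul_pow, ← rpow_natCast ((N : ℝ) ^ (1 - ep / 8)), ← rpow_mul hNp.le]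
    congr 2; push_cast; ring
  have : ‖∑ n ∈ Finset.range M, ee (a n)‖ ≤ (6 + 6 * K) * (N : ℝ) ^ (1 - ep / 8) := by
    refine le_of_sq_le_sq ?_ (by positivity)
    rw [b2]
    refine fin.trans ?_
    gcongr
    nlinarith
  refine this.trans ?_
  gcongr
  exact le_max_right _ _

lemma PS_all {B : ℝ} (hB : 0 ≤ B) (j : ℕ) : ∀ ep : ℝ, 0 < ep → ep ≤ 1 → PS (j + 2) B ep := by
  induction j with
  | zero => intro ep h1 h2; exact PS_two h1 h2 hB
  | succ j ih => intro ep h1 h2; exact PS_succ h1 h2 (ih (ep / 2) (by linarith) (by linarith))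

end PF

namespace PF
/-- forward difference on real functions -/
def Dr (f : ℝ → ℝ) (x : ℝ) : ℝ := f (x + 1) - f x

lemma Dr_deriv {f f' : ℝ → ℝ} (h : ∀ x > 0, HasDerivAt f (f' x) x) (j : ℕ) :
    ∀ x > 0, HasDerivAt (Dr^[j] f) ((Dr^[j] f') x) x := by
  induction j with
  | zero => simpa using h
  | succ j ih =>
    intro x hx
    rw [Function.iterate_succ_apply', Function.iterate_succ_apply']
    exact ((ih (x + 1) (by linarith)).comp_add_const x 1).sub (ih x hx)

lemma Dr_mvt {f f' : ℝ → ℝ} (h : ∀ x > 0, HasDerivAt f (f' x) x) (j : ℕ) (x : ℝ) (hx : 0 < x) :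
    ∃ z, x < z ∧ z < x + 1 ∧ (Dr^[j+1] f) x = (Dr^[j] f') z := by
  obtain ⟨z, hz, hz2⟩ := exists_hasDerivAt_eq_slope (Dr^[j] f) (Dr^[j] f') (show x < x + 1 by linarith)
    (fun y hy => (Dr_deriv h j y (by linarith [hy.1])).continuousAt.continuousWithinAt)
    (fun y hy => Dr_deriv h j y (by linarith [hy.1]))
  refine ⟨z, hz.1, hz.2, ?_⟩
  rw [hz2, Function.iterate_succ_apply']
  simp [Dr]

lemma Dr_const_mul (c : ℝ) (f : ℝ → ℝ) (j : ℕ) (x : ℝ) :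
    (Dr^[j] (fun x => c * f x)) x = c * (Dr^[j] f) x := by
  induction j generalizing x with
  | zero => simp
  | succ j ih =>
    rw [Function.iterate_succ_apply', Function.iterate_succ_apply']
    simp only [Dr, ih]; ring

lemma Dr_pow (j : ℕ) : ∀ k : ℕ, ∀ x : ℝ, 0 < x →
    (k + 1).ascFactorial j / (x + j) ^ (k + 1 + j) ≤ (-1) ^ j * (Dr^[j] (fun x => (x ^ (k + 1))⁻¹)) x ∧
    (-1) ^ j * (Dr^[j] (fun x => (x ^ (k + 1))⁻¹)) x ≤ (k + 1).ascFactorial j / x ^ (k + 1 + j) := by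
  induction j with
  | zero => intro k x hx; simp
  | succ j ih =>
    intro k x hx
    obtain ⟨z, hz1, hz2, hz⟩ := Dr_mvt (f := fun x : ℝ => (x ^ (k + 1))⁻¹)
      (f' := fun x => (-(k + 1 : ℝ)) * (x ^ (k + 1 + 1))⁻¹) (fun x hx => by
        have := (hasDerivAt_pow (k + 1) x).inv (by positivity)
        refine this.congr_deriv ?_
        rw [neg_mul, ← div_eq_mul_inv, neg_div, neg_inj, div_eq_div_iff (by positivity) (by positivity)]
        push_cast [Nat.add_sub_cancel]
        ring) j x hx
    rw [hz, Dr_const_mul]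
    obtain ⟨h1, h2⟩ := ih (k + 1) z (by linarith)
    have e : (-1 : ℝ) ^ (j + 1) * (-(k + 1 : ℝ) * (Dr^[j] fun x => (x ^ (k + 1 + 1))⁻¹) z) =
      (k + 1) * ((-1) ^ j * (Dr^[j] fun x => (x ^ (k + 1 + 1))⁻¹) z) := by ring
    have ef : (((k + 1).ascFactorial (j + 1) : ℕ) : ℝ) = (k + 1) * ((k + 1 + 1).ascFactorial j : ℕ) := by
      exact_mod_cast (Nat.ascFactorial_succ.trans (Nat.succ_ascFactorial (k + 1) j).symm)
    have hz0 : 0 < z := by linarith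
    have ei : k + 1 + (j + 1) = k + 1 + 1 + j := by ring
    rw [e, ef, ei, mul_div_assoc, mul_div_assoc]
    constructor
    · refine mul_le_mul_of_nonneg_left (le_trans ?_ h1) (by positivity)
      refine div_le_div_of_nonneg_left (by positivity) (by positivity) (pow_le_pow_left₀ (by positivity) ?_ _)
      push_cast; linarith
    · refine mul_le_mul_of_nonneg_left (h2.trans ?_) (by positivity)
      gcongr

lemma Dr_log (j : ℕ) (x : ℝ) (hx : 0 < x) :
    j.factorial / (x + (j + 1)) ^ (j + 1) ≤ (-1) ^ j * (Dr^[j + 1] log) x ∧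
    (-1) ^ j * (Dr^[j + 1] log) x ≤ j.factorial / x ^ (j + 1) := by
  obtain ⟨z, hz1, hz2, hz⟩ := Dr_mvt (f := log) (f' := fun x => (x ^ (0 + 1))⁻¹) (fun x hx => by
    simpa using hasDerivAt_log hx.ne') j x hx
  obtain ⟨h1, h2⟩ := Dr_pow j 0 z (by linarith)
  rw [Nat.zero_add, Nat.one_ascFactorial, add_comm 1 j] at h1 h2
  have hz0 : 0 < z := by linarith
  rw [hz]
  constructor
  · refine le_trans ?_ h1
    refine div_le_div_of_nonneg_left (by positivity) (by positivity) (pow_le_pow_left₀ (by positivity) ?_ _)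
    linarith
  · refine h2.trans ?_
    gcongr

lemma D_Dr (c : ℝ) (N j n : ℕ) :
    (D^[j] (fun n : ℕ => c * log ((N : ℝ) + n))) n = c * (Dr^[j] log) (N + n) := by
  induction j generalizing n with
  | zero => simp
  | succ j ih =>
    rw [Function.iterate_succ_apply', Function.iterate_succ_apply']
    simp only [D, Dr, ih]
    push_cast
    rw [← add_assoc]; ring

lemma ee_sign (a : ℕ → ℝ) (M : ℕ) :
    ‖∑ n ∈ Finset.range M, ee (-(a n))‖ = ‖∑ n ∈ Finset.range M, ee (a n)‖ := by
  rw [← Complex.norm_conj, map_sum]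
  simp_rw [ee_conj, neg_neg]

lemma ES_j (j : ℕ) : ∃ δ : ℝ, 0 < δ ∧ ∃ C : ℝ, 0 ≤ C ∧ ∀ N M : ℕ, 1 ≤ N → M ≤ N → ∀ t : ℝ,
    (N : ℝ) ^ (-(3/2) : ℝ) ≤ t / (N : ℝ) ^ (j + 2) → t / (N : ℝ) ^ (j + 2) ≤ (N : ℝ) ^ (-(1/4) : ℝ) →
    ‖∑ n ∈ Finset.range M, ee (-(t * log (N + n)))‖ ≤ C * (N : ℝ) ^ (1 - δ) := by
  obtain ⟨δ, hδ, C, hC, h⟩ := PS_all (B := ((j : ℝ) + 4) ^ (j + 2)) (by positivity) j (1/4) (by norm_num) (by norm_num)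
  set c : ℝ := (j + 1).factorial / ((j : ℝ) + 4) ^ (j + 2) with hc
  have hc0 : 0 < c := by positivity
  have hc1 : c ≤ 1 := by
    rw [hc, div_le_one (by positivity)]
    have h1 : (j + 1).factorial ≤ (j + 1) ^ (j + 1) := Nat.factorial_le_pow _
    have h2 : (((j + 1).factorial : ℕ) : ℝ) ≤ ((j : ℝ) + 1) ^ (j + 1) := by exact_mod_cast h1
    refine h2.trans ?_
    calc ((j : ℝ) + 1) ^ (j + 1) ≤ ((j : ℝ) + 4) ^ (j + 1) := by gcongr; norm_num
      _ ≤ _ := pow_le_pow_right₀ (by linarith [(Nat.cast_nonneg j : (0:ℝ) ≤ j)]) (by omega)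
  refine ⟨min δ 1, by positivity, max C (c⁻¹ ^ 4), by positivity, ?_⟩
  intro N M hN hM t ht1 ht2
  have hNr : (1 : ℝ) ≤ N := by exact_mod_cast hN
  have hNp : (0 : ℝ) < N := by linarith
  have hmr : (M : ℝ) ≤ N := by exact_mod_cast hM
  have ht0 : 0 < t := by
    have h0 : 0 < t / (N : ℝ) ^ (j + 2) := lt_of_lt_of_le (by positivity) ht1
    by_contra hneg
    push Not at hneg
    exact absurd (div_nonpos_of_nonpos_of_nonneg hneg (by positivity : (0:ℝ) ≤ (N : ℝ) ^ (j + 2))) (not_le.2 h0)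
  by_cases hbig : c⁻¹ ^ 4 ≤ (N : ℝ)
  swap
  · push Not at hbig
    have t1 : ‖∑ n ∈ Finset.range M, ee (-(t * log (N + n)))‖ ≤ M := by
      refine (norm_sum_le _ _).trans ?_
      simp [norm_ee]
    have t3 : 1 ≤ (N : ℝ) ^ (1 - min δ 1) := one_le_rpow hNr (by linarith [min_le_right δ 1])
    have t4 := le_max_right C (c⁻¹ ^ 4)
    have : 0 < c⁻¹ ^ 4 := by positivity
    nlinarith
  have key : ‖∑ n ∈ Finset.range M, ee ((-1) ^ (j + 1) * t * log (N + n))‖ ≤ C * (N : ℝ) ^ (1 - δ) := by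
    refine h N M hN hM (c * (t / (N : ℝ) ^ (j + 2))) ?_ ?_ _ ?_
    · have h1 : (N : ℝ) ^ (-2 + 1/4 : ℝ) = (N : ℝ) ^ (-(1/4) : ℝ) * (N : ℝ) ^ (-(3/2) : ℝ) := by
        rw [← rpow_add hNp]; norm_num
      have h2 : (N : ℝ) ^ (-(1/4) : ℝ) ≤ c := by
        rw [rpow_neg hNp.le]
        refine inv_le_of_inv_le₀ hc0 ?_
        have := rpow_le_rpow (by positivity) hbig (show (0:ℝ) ≤ 1/4 by norm_num)
        rw [← rpow_natCast, ← rpow_mul (by positivity)] at this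
        norm_num at this ⊢
        exact this
      rw [h1]
      gcongr
    · refine le_trans ?_ ht2
      have : 0 ≤ t / (N : ℝ) ^ (j + 2) := by positivity
      nlinarith
    · intro n hn
      rw [D_Dr, D_Dr]
      have hnr : (n : ℝ) + 1 ≤ M := by exact_mod_cast hn
      have hn0 : (0 : ℝ) ≤ n := by positivity
      obtain ⟨h1, h2⟩ := Dr_log (j + 1) (N + n) (by linarith)
      obtain ⟨h3, -⟩ := Dr_log (j + 1 + 1) (N + n) (by linarith)
      have e1 : (-1) ^ (j + 1) * t * (Dr^[j + 2] log) (N + n) = t * ((-1) ^ (j + 1) * (Dr^[j + 1 + 1] log) (N + n)) := by ring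
      have e2 : (-1) ^ (j + 1) * t * (Dr^[j + 2 + 1] log) (N + n) = - (t * ((-1) ^ (j + 1 + 1) * (Dr^[j + 1 + 1 + 1] log) (N + n))) := by
        ring
      rw [e1, e2]
      have hjN : (j : ℝ) ≤ j * N := le_mul_of_one_le_right (by positivity) hNr
      refine ⟨?_, ?_, ?_⟩
      · calc c * (t / (N : ℝ) ^ (j + 2)) = t * ((j + 1).factorial / (((j : ℝ) + 4) * N) ^ (j + 2)) := by
              rw [hc, mul_pow]; field_simp
          _ ≤ _ := by
            refine mul_le_mul_of_nonneg_left (le_trans ?_ h1) ht0.le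
            refine div_le_div_of_nonneg_left (by positivity) (by positivity) (pow_le_pow_left₀ (by positivity) ?_ _)
            push_cast; linarith
      · calc _ ≤ t * ((j + 1).factorial / (N + n) ^ (j + 1 + 1)) := mul_le_mul_of_nonneg_left h2 ht0.le
          _ ≤ t * ((j + 1).factorial / N ^ (j + 1 + 1)) := by gcongr; linarith
          _ = _ := by rw [hc]; field_simp
      · have := le_trans (by positivity) h3
        have := mul_nonneg ht0.le this
        linarith
  have e3 : ‖∑ n ∈ Finset.range M, ee (-(t * log (N + n)))‖ =
      ‖∑ n ∈ Finset.range M, ee ((-1) ^ (j + 1) * t * log (N + n))‖ := by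
    rcases neg_one_pow_eq_or ℝ (j + 1) with h | h
    · rw [h]; simp only [one_mul]; exact ee_sign (fun n : ℕ => t * log (N + n)) M
    · rw [h]; simp only [neg_mul, one_mul]
  rw [e3]
  refine key.trans ?_
  gcongr
  · exact le_max_left _ _
  · exact min_le_left _ _

lemma ES_unif (K : ℕ) : ∃ δ : ℝ, 0 < δ ∧ ∃ C : ℝ, 0 ≤ C ∧ ∀ j < K, ∀ N M : ℕ, 1 ≤ N → M ≤ N → ∀ t : ℝ,
    (N : ℝ) ^ (-(3/2) : ℝ) ≤ t / (N : ℝ) ^ (j + 2) → t / (N : ℝ) ^ (j + 2) ≤ (N : ℝ) ^ (-(1/4) : ℝ) →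
    ‖∑ n ∈ Finset.range M, ee (-(t * log (N + n)))‖ ≤ C * (N : ℝ) ^ (1 - δ) := by
  induction K with
  | zero => exact ⟨1, by norm_num, 0, le_rfl, fun j hj => absurd hj (by omega)⟩
  | succ K ih =>
    obtain ⟨δ, hδ, C, hC, h⟩ := ih
    obtain ⟨δ', hδ', C', hC', h'⟩ := ES_j K
    refine ⟨min δ δ', by positivity, max C C', by positivity, ?_⟩
    intro j hj N M hN hM t ht1 ht2
    have hNr : (1 : ℝ) ≤ N := by exact_mod_cast hN
    rcases Nat.lt_succ_iff_lt_or_eq.1 hj with hj | rfl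
    · refine (h j hj N M hN hM t ht1 ht2).trans ?_
      gcongr
      · exact le_max_left _ _
      · exact min_le_left _ _
    · refine (h' N M hN hM t ht1 ht2).trans ?_
      gcongr
      · exact le_max_right _ _
      · exact min_le_right _ _

lemma ES (K : ℕ) : ∃ δ : ℝ, 0 < δ ∧ δ < 1 ∧ ∃ C : ℝ, 0 < C ∧ ∀ N M : ℕ, 1 ≤ N → M ≤ N → ∀ t : ℝ,
    (N : ℝ) ≤ t ^ 2 → 0 < t → t ≤ (N : ℝ) ^ K →
    ‖∑ n ∈ Finset.range M, ee (-(t * log (N + n)))‖ ≤ C * (N : ℝ) ^ (1 - δ) := by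
  obtain ⟨δ, hδ, C, hC, h⟩ := ES_unif (K + 2)
  refine ⟨min δ (1/2), by positivity, lt_of_le_of_lt (min_le_right _ _) (by norm_num), max C 1, by positivity, ?_⟩
  intro N M hN hM t ht1 ht0 ht2
  have hNr : (1 : ℝ) ≤ N := by exact_mod_cast hN
  have hNp : (0 : ℝ) < N := by linarith
  have hmr : (M : ℝ) ≤ N := by exact_mod_cast hM
  rcases eq_or_lt_of_le hN with h1 | h1
  · have t1 : ‖∑ n ∈ Finset.range M, ee (-(t * log (N + n)))‖ ≤ M := by
      refine (norm_sum_le _ _).trans ?_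
      simp [norm_ee]
    refine t1.trans (hmr.trans ?_)
    rw [← h1]; simp
  have hNr2 : (1 : ℝ) < N := by exact_mod_cast h1
  have hlN : 0 < log N := log_pos hNr2
  set θ := log t / log N with hθ
  have htθ : t = (N : ℝ) ^ θ := by
    rw [rpow_def_of_pos hNp, hθ, mul_div_cancel₀ _ hlN.ne', exp_log ht0]
  have hθ1 : 1/2 ≤ θ := by
    rw [hθ, le_div_iff₀ hlN]
    have := log_le_log hNp ht1
    rw [log_pow] at this; push_cast at this; linarith
  have hθK : θ ≤ K := by
    rw [hθ, div_le_iff₀ hlN, ← log_pow]; exact log_le_log ht0 ht2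
  obtain ⟨j, hj⟩ : ∃ j, max 2 ⌈θ + 1/4⌉₊ = j + 2 := ⟨max 2 ⌈θ + 1/4⌉₊ - 2, by omega⟩
  have hj1 : θ + 1/4 ≤ j + 2 := by
    have h1 := Nat.le_ceil (θ + 1/4)
    have h2 : ⌈θ + 1/4⌉₊ ≤ j + 2 := by omega
    have h3 : (⌈θ + 1/4⌉₊ : ℝ) ≤ j + 2 := by exact_mod_cast h2
    linarith
  have hj2 : (j : ℝ) + 2 ≤ θ + 3/2 := by
    rcases le_total 2 ⌈θ + 1/4⌉₊ with h2 | h2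
    · rw [max_eq_right h2] at hj
      have := Nat.ceil_lt_add_one (show 0 ≤ θ + 1/4 by linarith); rw [hj] at this; push_cast at this; linarith
    · rw [max_eq_left h2] at hj
      have : j = 0 := by omega
      rw [this]; push_cast; linarith
  have hjK : j < K + 2 := by
    have : (j : ℝ) < ((K + 2 : ℕ) : ℝ) := by push_cast; linarith
    exact_mod_cast this
  have e : t / (N : ℝ) ^ (j + 2) = (N : ℝ) ^ (θ - (j + 2)) := by
    rw [rpow_sub hNp, ← htθ]; congr 1
    rw [← rpow_natCast]; push_cast; rfl
  have := h j hjK N M hN hM t (by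
    rw [e]; exact rpow_le_rpow_of_exponent_le hNr (by linarith)) (by
    rw [e]; exact rpow_le_rpow_of_exponent_le hNr (by linarith))
  refine this.trans ?_
  gcongr
  · exact le_max_left _ _
  · exact min_le_left _ _

end PF

namespace PF
noncomputable def gz (n : ℕ) (s : ℂ) : ℂ :=
  (s - 1) * (n : ℂ) ^ (-s) - ((n : ℂ) ^ (1 - s) - ((n + 1 : ℕ) : ℂ) ^ (1 - s))

lemma hd_cpow (a : ℂ) {x : ℝ} (hx : 0 < x) :
    HasDerivAt (fun y : ℝ => (y : ℂ) ^ a) (a * (x : ℂ) ^ (a - 1)) x := by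
  have h1 : HasDerivAt (fun y : ℂ => y ^ a) (a * (x : ℂ) ^ (a - 1) * 1) (x : ℂ) :=
    (hasDerivAt_id (x : ℂ)).cpow_const (Or.inl (by simpa using hx))
  rw [mul_one] at h1
  exact h1.comp_ofReal

lemma gz_bound {n : ℕ} (hn : 1 ≤ n) {s : ℂ} (hs : 0 ≤ s.re) :
    ‖gz n s‖ ≤ ‖s - 1‖ * ‖s‖ * (n : ℝ) ^ (-s.re - 1) := by
  have hn0 : (0 : ℝ) < n := by exact_mod_cast hn
  have h1 : ∀ x ∈ Set.Icc (n : ℝ) (n + 1), ‖(n : ℂ) ^ (-s) - (x : ℂ) ^ (-s)‖ ≤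
      ‖s‖ * (n : ℝ) ^ (-s.re - 1) := by
    intro x hx
    have := Convex.norm_image_sub_le_of_norm_hasDerivWithin_le (f := fun y : ℝ => (y : ℂ) ^ (-s))
      (f' := fun x : ℝ => (-s) * (x : ℂ) ^ (-s - 1)) (s := Set.Icc (n : ℝ) (n + 1))
      (C := ‖s‖ * (n : ℝ) ^ (-s.re - 1)) (x := x) (y := (n : ℝ))
      (fun y hy => (hd_cpow (-s) (lt_of_lt_of_le hn0 hy.1)).hasDerivWithinAt)
      (fun y hy => by
        have hy0 := lt_of_lt_of_le hn0 hy.1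
        rw [norm_mul, norm_neg, Complex.norm_cpow_eq_rpow_re_of_pos hy0]
        simp only [Complex.sub_re, Complex.neg_re, Complex.one_re]
        gcongr ?_ * ?_
        exact rpow_le_rpow_of_nonpos hn0 hy.1 (by linarith))
      (convex_Icc _ _) hx ⟨le_rfl, by linarith⟩
    simp only [Complex.ofReal_natCast] at this
    refine this.trans ?_
    have h2 : ‖(n : ℝ) - x‖ ≤ 1 := by
      rw [norm_eq_abs, abs_le]; constructor <;> linarith [hx.1, hx.2]
    have : 0 ≤ ‖s‖ * (n : ℝ) ^ (-s.re - 1) := by positivity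
    nlinarith
  have := Convex.norm_image_sub_le_of_norm_hasDerivWithin_le
      (f := fun y : ℝ => (s - 1) * (n : ℂ) ^ (-s) * y + (y : ℂ) ^ (1 - s))
      (f' := fun x : ℝ => (s - 1) * (n : ℂ) ^ (-s) + (1 - s) * (x : ℂ) ^ (1 - s - 1))
      (s := Set.Icc (n : ℝ) (n + 1))
      (C := ‖s - 1‖ * (‖s‖ * (n : ℝ) ^ (-s.re - 1))) (x := (n : ℝ)) (y := (n : ℝ) + 1)
      (fun y hy => by
        have h3 := (hasDerivAt_id (y : ℂ)).comp_ofReal.const_mul ((s - 1) * (n : ℂ) ^ (-s))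
        have h4 := hd_cpow (1 - s) (lt_of_lt_of_le hn0 hy.1)
        have := (h3.fun_add h4).hasDerivWithinAt (s := Set.Icc (n : ℝ) (n + 1))
        simpa using this)
      (fun y hy => by
        have : (s - 1) * (n : ℂ) ^ (-s) + (1 - s) * (y : ℂ) ^ (1 - s - 1) =
          (s - 1) * ((n : ℂ) ^ (-s) - (y : ℂ) ^ (-s)) := by
          rw [show 1 - s - 1 = -s by ring]; ring
        rw [this, norm_mul]
        gcongr
        exact h1 y hy)
      (convex_Icc _ _) ⟨le_rfl, by linarith⟩ ⟨by linarith, le_rfl⟩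
  have e : gz n s = ((s - 1) * (n : ℂ) ^ (-s) * ((n : ℝ) + 1 : ℝ) + (((n : ℝ) + 1 : ℝ) : ℂ) ^ (1 - s)) -
      ((s - 1) * (n : ℂ) ^ (-s) * (n : ℝ) + ((n : ℝ) : ℂ) ^ (1 - s)) := by
    simp only [gz]; push_cast; ring
  rw [e]
  refine this.trans ?_
  simp [mul_assoc]

lemma gz_diff {n : ℕ} (hn : 1 ≤ n) : Differentiable ℂ (gz n) := by
  have hn0 : (n : ℂ) ≠ 0 := by exact_mod_cast (by omega : n ≠ 0)
  have hn1 : ((n + 1 : ℕ) : ℂ) ≠ 0 := by exact_mod_cast (by omega : n + 1 ≠ 0)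
  intro s
  unfold gz
  refine DifferentiableAt.sub (DifferentiableAt.mul (by fun_prop) ?_) (DifferentiableAt.sub ?_ ?_)
  · exact DifferentiableAt.const_cpow (by fun_prop) (Or.inl hn0)
  · exact DifferentiableAt.const_cpow (by fun_prop) (Or.inl hn0)
  · exact DifferentiableAt.const_cpow (by fun_prop) (Or.inl hn1)

lemma gz_summable {N : ℕ} (hN : 1 ≤ N) {s : ℂ} (hs : 0 < s.re) : Summable (fun i => gz (N + i) s) := by
  have h : Summable (fun i : ℕ => ‖s - 1‖ * ‖s‖ * ((N + i : ℕ) : ℝ) ^ (-s.re - 1)) := by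
    refine Summable.mul_left _ ?_
    have := (summable_nat_rpow (p := -s.re - 1)).2 (by linarith)
    have := (summable_nat_add_iff N).2 this
    refine this.congr fun i => by rw [add_comm]
  exact Summable.of_norm_bounded h fun i => gz_bound (by omega) hs.le

lemma zeta1_gt {N : ℕ} (hN : 1 ≤ N) {s : ℂ} (hs : 1 < s.re) :
    riemannZeta₁ s = (s - 1) * ∑ n ∈ Finset.Ico 1 N, (n : ℂ) ^ (-s) + (N : ℂ) ^ (1 - s) +
      ∑' i, gz (N + i) s := by
  have hs1 : s ≠ 1 := by rintro rfl; simp at hs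
  have hs10 : s - 1 ≠ 0 := sub_ne_zero.2 hs1
  have hz : riemannZeta₁ s = (s - 1) * riemannZeta s := by
    rw [riemannZeta_eq_inv_sub_mul hs1]; field_simp
  have hs0 : s ≠ 0 := by rintro rfl; simp at hs; linarith
  have hsum : HasSum (fun n : ℕ => (n : ℂ) ^ (-s)) (riemannZeta s) := by
    have h1 : Summable (fun n : ℕ => 1 / (n : ℂ) ^ s) := Complex.summable_one_div_nat_cpow.2 hs
    rw [zeta_eq_tsum_one_div_nat_cpow hs]
    convert h1.hasSum using 2 with n
    rw [Complex.cpow_neg, one_div]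
  have h0 : ∑ i ∈ Finset.range N, (i : ℂ) ^ (-s) = ∑ n ∈ Finset.Ico 1 N, (n : ℂ) ^ (-s) := by
    rw [Finset.range_eq_Ico, Finset.sum_eq_sum_Ico_succ_bot (by omega)]
    simp [Complex.zero_cpow (neg_ne_zero.2 hs0)]
  have h2 : HasSum (fun i : ℕ => ((N + i : ℕ) : ℂ) ^ (-s)) (riemannZeta s - ∑ n ∈ Finset.Ico 1 N, (n : ℂ) ^ (-s)) := by
    rw [← h0]
    have := (hasSum_nat_add_iff' N).2 hsum
    simpa [add_comm] using this
  have h3 : HasSum (fun i => gz (N + i) s) (riemannZeta₁ s - (s - 1) * ∑ n ∈ Finset.Ico 1 N, (n : ℂ) ^ (-s)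
      - (N : ℂ) ^ (1 - s)) := by
    have h4 := (gz_summable hN (show 0 < s.re by linarith)).hasSum
    have h5 := h4.tendsto_sum_nat
    have h6 := (h2.mul_left (s - 1)).tendsto_sum_nat
    have h7 : Tendsto (fun k : ℕ => ((N + k : ℕ) : ℂ) ^ (1 - s)) atTop (nhds 0) := by
      rw [tendsto_zero_iff_norm_tendsto_zero]
      have : ∀ k : ℕ, ‖((N + k : ℕ) : ℂ) ^ (1 - s)‖ = ((k + N : ℕ) : ℝ) ^ (-(s.re - 1)) := by
        intro k
        rw [Complex.norm_natCast_cpow_of_pos (by omega), add_comm]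
        simp
      simp_rw [this]
      have h8 := (tendsto_rpow_neg_atTop (show 0 < s.re - 1 by linarith)).comp tendsto_natCast_atTop_atTop
      exact (tendsto_add_atTop_iff_nat (f := fun n : ℕ => (n : ℝ) ^ (-(s.re - 1))) N).2 h8
    have h9 : ∀ k, ∑ i ∈ Finset.range k, gz (N + i) s = ∑ i ∈ Finset.range k, (s - 1) * ((N + i : ℕ) : ℂ) ^ (-s)
        - ((N : ℂ) ^ (1 - s) - ((N + k : ℕ) : ℂ) ^ (1 - s)) := by
      intro k
      induction k with
      | zero => simp
      | succ k ih => rw [Finset.sum_range_succ, Finset.sum_range_succ, ih]; simp only [gz]; ring_nf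
    have h10 := h6.sub ((tendsto_const_nhds (x := (N : ℂ) ^ (1 - s))).sub h7)
    rw [sub_zero] at h10
    have h11 := tendsto_nhds_unique h5 (h10.congr fun k => (h9 k).symm)
    rw [h11] at h4
    convert h4 using 1
    rw [hz]; ring
  rw [h3.tsum_eq]; ring

lemma zeta1_eq {N : ℕ} (hN : 1 ≤ N) {s : ℂ} (hs : 0 < s.re) :
    riemannZeta₁ s = (s - 1) * ∑ n ∈ Finset.Ico 1 N, (n : ℂ) ^ (-s) + (N : ℂ) ^ (1 - s) +
      ∑' i, gz (N + i) s := by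
  set U : Set ℂ := {z | s.re / 2 < z.re} ∩ Metric.ball 0 (‖s‖ + 3) with hU
  have hUo : IsOpen U := (isOpen_lt continuous_const Complex.continuous_re).inter Metric.isOpen_ball
  have hUc : Convex ℝ U := (convex_halfSpace_re_gt _).inter (convex_ball _ _)
  have hsU : s ∈ U := ⟨by simp only [Set.mem_ofPred_eq]; linarith, by simp⟩
  have hs2 : s + 2 ∈ U := by
    refine ⟨by simp; linarith, ?_⟩
    simp only [Metric.mem_ball, dist_zero_right]
    refine lt_of_le_of_lt (norm_add_le _ _) ?_
    rw [show ‖(2 : ℂ)‖ = 2 by simp]; linarith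
  have hN0 : (N : ℂ) ≠ 0 := by exact_mod_cast (by omega : N ≠ 0)
  have hd : DifferentiableOn ℂ (fun z => ∑' i, gz (N + i) z) U := by
    refine Complex.differentiableOn_tsum_of_summable_norm
      (u := fun i : ℕ => (‖s‖ + 4) * (‖s‖ + 3) * ((N + i : ℕ) : ℝ) ^ (-(s.re / 2) - 1)) ?_
      (fun i => (gz_diff (by omega)).differentiableOn) hUo ?_
    · refine Summable.mul_left _ ?_
      have := (summable_nat_rpow (p := -(s.re / 2) - 1)).2 (by linarith)
      have := (summable_nat_add_iff N).2 this
      refine this.congr fun i => by rw [add_comm]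
    · rintro i z ⟨hz1, hz2⟩
      simp only [Set.mem_ofPred_eq] at hz1
      simp only [Metric.mem_ball, dist_zero_right] at hz2
      have hni : (1 : ℝ) ≤ ((N + i : ℕ) : ℝ) := by exact_mod_cast (by omega)
      refine (gz_bound (by omega) (by linarith)).trans ?_
      gcongr
      · refine (norm_sub_le _ _).trans ?_
        simp; linarith
  have hfin : Differentiable ℂ (fun z : ℂ => (z - 1) * ∑ n ∈ Finset.Ico 1 N, (n : ℂ) ^ (-z) + (N : ℂ) ^ (1 - z)) := by
    intro z
    refine DifferentiableAt.add (DifferentiableAt.mul (by fun_prop) ?_) ?_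
    · refine DifferentiableAt.fun_sum fun n hn => ?_
      have hn0 : (n : ℂ) ≠ 0 := by
        rw [Finset.mem_Ico] at hn
        exact_mod_cast (by omega : n ≠ 0)
      exact DifferentiableAt.const_cpow (by fun_prop) (Or.inl hn0)
    · exact DifferentiableAt.const_cpow (by fun_prop) (Or.inl hN0)
  have hR := (hfin.differentiableOn (s := U)).add hd
  have hL := differentiable_riemannZeta₁.differentiableOn (s := U)
  refine (hL.analyticOnNhd hUo).eqOn_of_preconnected_of_eventuallyEq (hR.analyticOnNhd hUo)
    hUc.isPreconnected hs2 ?_ hsU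
  have : {z : ℂ | 1 < z.re} ∈ nhds (s + 2) :=
    (isOpen_lt continuous_const Complex.continuous_re).mem_nhds (by simp; linarith)
  filter_upwards [this] with z hz
  exact zeta1_gt hN hz

lemma zeta_approx : ∃ C : ℝ, 0 < C ∧ ∀ N : ℕ, 1 ≤ N → ∀ s : ℂ, 1 / 2 ≤ s.re → s ≠ 1 →
    ‖riemannZeta s - ∑ n ∈ Finset.Ico 1 N, (n : ℂ) ^ (-s) - (N : ℂ) ^ (1 - s) / (s - 1)‖ ≤
      C * ‖s‖ * (N : ℝ) ^ (1 / 4 - s.re) := by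
  have hsm : Summable (fun n : ℕ => (n : ℝ) ^ (-(5/4) : ℝ)) := summable_nat_rpow.2 (by norm_num)
  refine ⟨∑' n : ℕ, (n : ℝ) ^ (-(5/4) : ℝ) + 1, by positivity, ?_⟩
  intro N hN s hs hs1
  have hs10 : s - 1 ≠ 0 := sub_ne_zero.2 hs1
  have hN0 : (0 : ℝ) < N := by exact_mod_cast hN
  have h1 : riemannZeta s - ∑ n ∈ Finset.Ico 1 N, (n : ℂ) ^ (-s) - (N : ℂ) ^ (1 - s) / (s - 1) =
      (∑' i, gz (N + i) s) / (s - 1) := by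
    have := zeta1_eq hN (show 0 < s.re by linarith)
    rw [riemannZeta_eq_inv_sub_mul hs1, this]
    field_simp; ring
  rw [h1, norm_div, div_le_iff₀ (norm_pos_iff.2 hs10)]
  have hsm2 : Summable (fun i : ℕ => ((N + i : ℕ) : ℝ) ^ (-(5/4) : ℝ)) := by
    have := (summable_nat_add_iff N).2 hsm
    refine this.congr fun i => by rw [add_comm]
  have hle : ∑' i : ℕ, ((N + i : ℕ) : ℝ) ^ (-(5/4) : ℝ) ≤ ∑' n : ℕ, (n : ℝ) ^ (-(5/4) : ℝ) + 1 := by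
    have := hsm.sum_add_tsum_nat_add N
    have h2 : 0 ≤ ∑ i ∈ Finset.range N, (i : ℝ) ^ (-(5/4) : ℝ) := Finset.sum_nonneg fun i _ => by positivity
    simp_rw [add_comm N]
    linarith
  have hb : ∀ i, ‖gz (N + i) s‖ ≤ ‖s - 1‖ * ‖s‖ * (N : ℝ) ^ (1 / 4 - s.re) * ((N + i : ℕ) : ℝ) ^ (-(5/4) : ℝ) := by
    intro i
    refine (gz_bound (by omega) (by linarith)).trans ?_
    have hni : (0 : ℝ) < ((N + i : ℕ) : ℝ) := by exact_mod_cast (by omega)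
    rw [mul_assoc (‖s - 1‖ * ‖s‖)]
    refine mul_le_mul_of_nonneg_left ?_ (by positivity)
    rw [show -s.re - 1 = (1/4 - s.re) + (-(5/4)) by ring, rpow_add hni]
    refine mul_le_mul_of_nonneg_right ?_ (by positivity)
    exact rpow_le_rpow_of_nonpos hN0 (by push_cast; linarith [(Nat.cast_nonneg i : (0:ℝ) ≤ i)]) (by linarith)
  have hfin := tsum_of_norm_bounded (hsm2.mul_left _).hasSum hb
  refine hfin.trans ?_
  rw [tsum_mul_left]
  calc _ ≤ ‖s - 1‖ * ‖s‖ * (N : ℝ) ^ (1 / 4 - s.re) * (∑' n : ℕ, (n : ℝ) ^ (-(5/4) : ℝ) + 1) := by gcongr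
    _ = _ := by ring

end PF

namespace PF
lemma abel_w (z : ℕ → ℂ) (w : ℕ → ℝ) (A : ℝ) (M : ℕ) (hw : Antitone w) (hw0 : ∀ n, 0 ≤ w n)
    (hz : ∀ k ≤ M, ‖∑ i ∈ Finset.range k, z i‖ ≤ A) :
    ‖∑ i ∈ Finset.range M, (w i : ℂ) * z i‖ ≤ w 0 * A := by
  have key : ∀ k ≤ M, ‖∑ i ∈ Finset.range k, (w i : ℂ) * z i - w k * ∑ i ∈ Finset.range k, z i‖ ≤
      (w 0 - w k) * A := by
    intro k
    induction k with
    | zero => simp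
    | succ k ih =>
      intro hk
      have h1 := ih (by omega)
      have e : ∑ i ∈ Finset.range (k + 1), (w i : ℂ) * z i - w (k + 1) * ∑ i ∈ Finset.range (k + 1), z i =
        (∑ i ∈ Finset.range k, (w i : ℂ) * z i - w k * ∑ i ∈ Finset.range k, z i) +
          ((w k - w (k + 1) : ℝ) : ℂ) * ∑ i ∈ Finset.range (k + 1), z i := by
        rw [Finset.sum_range_succ, Finset.sum_range_succ]; push_cast; ring
      rw [e]
      refine (norm_add_le _ _).trans ?_
      rw [norm_mul, Complex.norm_real, norm_of_nonneg (by linarith [hw (Nat.le_succ k)])]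
      have := mul_le_mul_of_nonneg_left (hz (k + 1) hk) (show 0 ≤ w k - w (k + 1) by linarith [hw (Nat.le_succ k)])
      linarith
  have h1 := key M le_rfl
  have h2 : ‖(w M : ℂ) * ∑ i ∈ Finset.range M, z i‖ ≤ w M * A := by
    rw [norm_mul, Complex.norm_real, norm_of_nonneg (hw0 M)]
    exact mul_le_mul_of_nonneg_left (hz M le_rfl) (hw0 M)
  have := norm_add_le (∑ i ∈ Finset.range M, (w i : ℂ) * z i - w M * ∑ i ∈ Finset.range M, z i)
    ((w M : ℂ) * ∑ i ∈ Finset.range M, z i)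
  rw [sub_add_cancel] at this
  linarith

lemma cpow_eq {n : ℕ} (hn : 1 ≤ n) (σ t : ℝ) :
    (n : ℂ) ^ (-(σ + t * Complex.I)) = (((n : ℝ) ^ (-σ) : ℝ) : ℂ) * ee (-(t * log n)) := by
  have hn0 : (0 : ℝ) < n := by exact_mod_cast hn
  have hnc : (n : ℂ) ≠ 0 := by exact_mod_cast (by omega : n ≠ 0)
  rw [Complex.cpow_def_of_ne_zero hnc, rpow_def_of_pos hn0, ee, Complex.ofReal_exp, ← Complex.exp_add]
  congr 1
  rw [← Complex.ofReal_natCast, ← Complex.ofReal_log hn0.le]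
  push_cast; ring

lemma block {K : ℕ} {δ C : ℝ}
    (hES : ∀ N M : ℕ, 1 ≤ N → M ≤ N → ∀ t : ℝ, (N : ℝ) ≤ t ^ 2 → 0 < t → t ≤ (N : ℝ) ^ K →
    ‖∑ n ∈ Finset.range M, ee (-(t * log (N + n)))‖ ≤ C * (N : ℝ) ^ (1 - δ)) (hC : 0 < C)
    {N : ℕ} (hN : 1 ≤ N) {t σ : ℝ} (ht : 0 < t) (h1 : (N : ℝ) ≤ t ^ 2) (h2 : t ≤ (N : ℝ) ^ K)
    (hσ : 1 - δ ≤ σ) (hσ0 : 0 ≤ σ) :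
    ‖∑ n ∈ Finset.Ico N (2 * N), (n : ℂ) ^ (-(σ + t * Complex.I))‖ ≤ C := by
  have hNr : (1 : ℝ) ≤ N := by exact_mod_cast hN
  have hN0 : (0 : ℝ) < N := by linarith
  have e : ∑ n ∈ Finset.Ico N (2 * N), (n : ℂ) ^ (-(σ + t * Complex.I)) =
      ∑ i ∈ Finset.range N, ((((N : ℝ) + i) ^ (-σ) : ℝ) : ℂ) * ee (-(t * log (N + i))) := by
    rw [Finset.sum_Ico_eq_sum_range, show 2 * N - N = N by omega]
    refine Finset.sum_congr rfl fun i _ => ?_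
    rw [cpow_eq (by omega)]; push_cast; rfl
  rw [e]
  refine (abel_w (fun i => ee (-(t * log (N + i)))) (fun i => ((N : ℝ) + i) ^ (-σ)) (C * (N : ℝ) ^ (1 - δ)) N ?_ ?_ ?_).trans ?_
  · intro a b hab
    have : (a : ℝ) ≤ b := by exact_mod_cast hab
    exact rpow_le_rpow_of_nonpos (by positivity) (by linarith) (by linarith)
  · intro n; positivity
  · intro k hk; exact hES N k hN hk t h1 ht h2
  · simp only [Nat.cast_zero, add_zero]
    rw [mul_left_comm, ← rpow_add hN0]
    have : (N : ℝ) ^ (-σ + (1 - δ)) ≤ 1 := rpow_le_one_of_one_le_of_nonpos hNr (by linarith)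
    nlinarith

lemma blocks {K : ℕ} {δ C : ℝ}
    (hES : ∀ N M : ℕ, 1 ≤ N → M ≤ N → ∀ t : ℝ, (N : ℝ) ≤ t ^ 2 → 0 < t → t ≤ (N : ℝ) ^ K →
    ‖∑ n ∈ Finset.range M, ee (-(t * log (N + n)))‖ ≤ C * (N : ℝ) ^ (1 - δ)) (hC : 0 < C)
    {N : ℕ} (hN : 1 ≤ N) {t σ : ℝ} (ht : 0 < t) (h2 : t ≤ (N : ℝ) ^ K)
    (hσ : 1 - δ ≤ σ) (hσ0 : 0 ≤ σ) (m : ℕ) (h1 : (N : ℝ) * 2 ^ m ≤ t ^ 2) :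
    ‖∑ n ∈ Finset.Ico N (N * 2 ^ (m + 1)), (n : ℂ) ^ (-(σ + t * Complex.I))‖ ≤ C * (m + 1) := by
  induction m with
  | zero =>
    have := block hES hC hN ht (by simpa using h1) h2 hσ hσ0
    simpa [mul_comm] using this
  | succ m ih =>
    have hp : (1 : ℝ) ≤ 2 ^ (m + 1) := one_le_pow₀ (by norm_num)
    have h3 : (2 : ℝ) ^ m ≤ 2 ^ (m + 1) := pow_le_pow_right₀ (by norm_num) (by omega)
    have hN0 : (0 : ℝ) ≤ N := by positivity
    have ih' := ih (le_trans (by gcongr) h1)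
    rw [← Finset.sum_Ico_consecutive _ (show N ≤ N * 2 ^ (m + 1) from Nat.le_mul_of_pos_right _ (by positivity))
      (show N * 2 ^ (m + 1) ≤ N * 2 ^ (m + 1 + 1) from Nat.mul_le_mul_left _ (Nat.pow_le_pow_right (by omega) (by omega)))]
    refine (norm_add_le _ _).trans ?_
    have h4 := block hES hC (N := N * 2 ^ (m + 1)) (Nat.mul_pos hN (by positivity)) ht (by push_cast; exact h1)
      (h2.trans (by push_cast; gcongr; nlinarith)) hσ hσ0
    rw [show 2 * (N * 2 ^ (m + 1)) = N * 2 ^ (m + 1 + 1) by ring] at h4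
    push_cast
    linarith

lemma init_bound {t δ σ : ℝ} {K N : ℕ} (ht : 1 ≤ t) (hδ : 0 ≤ δ) (hσ : 1 - δ ≤ σ)
    (hN : ∀ n < N, (n : ℝ) ≤ t ^ (1 / (K : ℝ))) (hNt : (N : ℝ) ≤ 2 * t) :
    ‖∑ n ∈ Finset.Ico 1 N, (n : ℂ) ^ (-(σ + t * Complex.I))‖ ≤ t ^ (δ / K) * (1 + log (2 * t)) := by
  have h1 : ‖∑ n ∈ Finset.Ico 1 N, (n : ℂ) ^ (-(σ + t * Complex.I))‖ ≤
      ∑ n ∈ Finset.Ico 1 N, t ^ (δ / K) * (n : ℝ)⁻¹ := by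
    refine (norm_sum_le _ _).trans (Finset.sum_le_sum fun n hn => ?_)
    rw [Finset.mem_Ico] at hn
    have hn1 : (1 : ℝ) ≤ n := by exact_mod_cast hn.1
    have hn0 : (0 : ℝ) < n := by linarith
    rw [cpow_eq hn.1, norm_mul, norm_ee, mul_one, Complex.norm_real, norm_of_nonneg (by positivity)]
    calc (n : ℝ) ^ (-σ) ≤ (n : ℝ) ^ (δ + (-1)) := rpow_le_rpow_of_exponent_le hn1 (by linarith)
      _ = (n : ℝ) ^ δ * (n : ℝ)⁻¹ := by rw [rpow_add hn0, rpow_neg_one]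
      _ ≤ (t ^ (1 / (K : ℝ))) ^ δ * (n : ℝ)⁻¹ := by gcongr; exact hN n hn.2
      _ = _ := by rw [← rpow_mul (by linarith)]; ring_nf
  refine h1.trans ?_
  rw [← Finset.mul_sum]
  gcongr
  rcases Nat.eq_zero_or_pos N with rfl | hNp
  · simp; linarith [log_nonneg (show 1 ≤ 2 * t by linarith)]
  have h2 := harmonic_le_one_add_log N
  rw [harmonic_eq_sum_Icc] at h2
  push_cast at h2
  have h3 : ∑ h ∈ Finset.Ico 1 N, (h : ℝ)⁻¹ ≤ ∑ i ∈ Finset.Icc 1 N, (i : ℝ)⁻¹ :=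
    Finset.sum_le_sum_of_subset_of_nonneg Finset.Ico_subset_Icc_self (fun i _ _ => by positivity)
  have h4 := log_le_log (by exact_mod_cast hNp) hNt
  linarith

set_option maxHeartbeats 400000 in
/-- growth of zeta near the 1-line -/
lemma zeta_growth {ε : ℝ} (hε : 0 < ε) : ∃ δ : ℝ, 0 < δ ∧ δ ≤ 1 / 4 ∧ ∃ T0 : ℝ, 1 ≤ T0 ∧ ∀ t : ℝ, T0 ≤ t →
    ∀ σ : ℝ, 1 - δ ≤ σ → σ ≤ 2 → ‖riemannZeta (σ + t * Complex.I)‖ ≤ t ^ (ε * δ) := by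
  obtain ⟨K, hK⟩ := exists_nat_gt (max 1 (2 / ε))
  have hK1 : (1 : ℝ) < K := lt_of_le_of_lt (le_max_left _ _) hK
  have hK2 : 2 / ε < K := lt_of_le_of_lt (le_max_right _ _) hK
  have hK0 : (0 : ℝ) < K := by linarith
  obtain ⟨δ', hδ', hδ1', C, hC, hES⟩ := ES K
  obtain ⟨C2, hC2, happ⟩ := zeta_approx
  set δ := min δ' (1/4) with hδdef
  have hδ : 0 < δ := by positivity
  have hδ4 : δ ≤ 1/4 := min_le_right _ _
  have hδδ : δ ≤ δ' := min_le_left _ _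
  -- eventual inequality
  set A : ℝ := 4 + 5 * C + 2 + 3 * C2 with hA
  obtain ⟨T0, hT0⟩ : ∃ T0 : ℝ, ∀ t, T0 ≤ t → A * (1 + log t) ≤ t ^ (ε * δ / 2) := by
    have h1 : Tendsto (fun t : ℝ => A * (1 / t ^ (ε * δ / 2) + log t / t ^ (ε * δ / 2))) atTop (nhds (A * (0 + 0))) := by
      refine Tendsto.const_mul _ (Tendsto.add ?_ ?_)
      · have := tendsto_rpow_neg_atTop (show 0 < ε * δ / 2 by positivity)
        refine this.congr' ?_
        filter_upwards [eventually_ge_atTop 0] with t ht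
        rw [rpow_neg ht, one_div]
      · exact (isLittleO_log_rpow_atTop (show 0 < ε * δ / 2 by positivity)).tendsto_div_nhds_zero
    rw [add_zero, mul_zero] at h1
    obtain ⟨T, hT⟩ := eventually_atTop.1 (h1.eventually (ge_mem_nhds zero_lt_one))
    refine ⟨max 1 T, fun t ht => ?_⟩
    have ht1 : 1 ≤ t := (le_max_left _ _).trans ht
    have h2 := hT t ((le_max_right _ _).trans ht)
    have h3 : 0 < t ^ (ε * δ / 2) := by positivity
    rw [← add_div, mul_div_assoc', div_le_one h3] at h2
    exact h2
  refine ⟨δ, hδ, hδ4, max 2 T0, le_trans (by norm_num) (le_max_left _ _), ?_⟩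
  intro t ht σ hσ1 hσ2
  have ht2 : 2 ≤ t := (le_max_left _ _).trans ht
  have ht1 : 1 ≤ t := by linarith
  have ht0 : 0 < t := by linarith
  have hlt : 0 ≤ log t := log_nonneg ht1
  set N0 := ⌈t ^ (1 / (K : ℝ))⌉₊ with hN0
  have hp1 : 1 ≤ t ^ (1 / (K : ℝ)) := one_le_rpow ht1 (by positivity)
  have hpt : t ^ (1 / (K : ℝ)) ≤ t := by
    conv_rhs => rw [← rpow_one t]
    exact rpow_le_rpow_of_exponent_le ht1 (by rw [div_le_one hK0]; exact hK1.le)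
  have hN01 : 1 ≤ N0 := Nat.one_le_ceil_iff.2 (by linarith)
  have hN0r : (1 : ℝ) ≤ N0 := by exact_mod_cast hN01
  have hN0t : (N0 : ℝ) ≤ 2 * t := by
    have := Nat.ceil_lt_add_one (show 0 ≤ t ^ (1 / (K : ℝ)) by linarith)
    linarith
  have hN0K : t ≤ (N0 : ℝ) ^ K := by
    calc t = (t ^ (1 / (K : ℝ))) ^ K := by
          rw [← rpow_natCast, ← rpow_mul ht0.le, one_div, inv_mul_cancel₀ hK0.ne', rpow_one]
      _ ≤ _ := by gcongr; exact Nat.le_ceil _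
  have hb1 := init_bound (K := K) (N := N0) ht1 hδ.le hσ1
    (fun n hn => (Nat.lt_ceil.1 hn).le) hN0t
  have hN0t2 : (N0 : ℝ) ≤ t ^ 2 := hN0t.trans (by rw [pow_two]; gcongr)
  obtain ⟨m, hm1, hm2⟩ := exists_nat_pow_near (x := t ^ 2 / N0) (y := 2) (by rw [le_div_iff₀ (by linarith)]; linarith) (by norm_num)
  rw [le_div_iff₀ (by linarith), mul_comm] at hm1
  rw [div_lt_iff₀ (by linarith), mul_comm] at hm2
  have hb2 := blocks hES hC hN01 ht0 hN0K (by linarith) (by linarith) m hm1 (σ := σ)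
  set N := N0 * 2 ^ (m + 1) with hN
  have hNr : (N : ℝ) = (N0 : ℝ) * 2 ^ (m + 1) := by rw [hN]; push_cast; rfl
  rw [← hNr] at hm2
  have hN1 : 1 ≤ N := Nat.mul_pos hN01 (by positivity)
  have hN1r : (1 : ℝ) ≤ N := by exact_mod_cast hN1
  have hN2 : (N : ℝ) ≤ 2 * t ^ 2 := by rw [hNr, pow_succ]; linarith
  have hm3 : (m : ℝ) ≤ 4 * log t := by
    have h1 : (2 : ℝ) ^ m ≤ t ^ 2 := by
      have : (2 : ℝ) ^ m ≤ N0 * 2 ^ m := le_mul_of_one_le_left (by positivity) hN0r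
      linarith
    have h2 := log_le_log (by positivity) h1
    rw [log_pow, log_pow] at h2
    push_cast at h2
    have := log_two_gt_d9
    have hm0 : (0 : ℝ) ≤ m := by positivity
    have := mul_le_mul_of_nonneg_left (show (1/2:ℝ) ≤ log 2 by linarith) hm0
    linarith
  set s : ℂ := σ + t * Complex.I with hs
  have hsre : s.re = σ := by simp [hs]
  have hsim : s.im = t := by simp [hs]
  have hs1 : s ≠ 1 := by
    intro h; rw [h] at hsim; simp at hsim; linarith
  have h3 := happ N hN1 s (by rw [hsre]; linarith) hs1
  rw [hsre] at h3
  have hns : ‖s‖ ≤ 2 + t := by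
    rw [hs]
    refine (norm_add_le _ _).trans ?_
    simp only [Complex.norm_real, norm_mul, Complex.norm_I, mul_one, norm_eq_abs, abs_of_pos ht0]
    rw [abs_of_nonneg (by linarith)]; linarith
  have hns1 : t ≤ ‖s - 1‖ := by
    have := Complex.abs_im_le_norm (s - 1)
    simp only [Complex.sub_im, hsim, Complex.one_im, sub_zero, abs_of_pos ht0] at this
    exact this
  have h4 : ‖(N : ℂ) ^ (1 - s) / (s - 1)‖ ≤ 2 := by
    rw [norm_div, div_le_iff₀ (by linarith), Complex.norm_natCast_cpow_of_pos (by omega)]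
    simp only [Complex.sub_re, Complex.one_re, hsre]
    calc (N : ℝ) ^ (1 - σ) ≤ (N : ℝ) ^ (1/2 : ℝ) := rpow_le_rpow_of_exponent_le hN1r (by linarith)
      _ ≤ (2 * t ^ 2) ^ (1/2 : ℝ) := by gcongr
      _ ≤ ((2 * t) ^ 2) ^ (1/2 : ℝ) := by
          gcongr
          have := sq_nonneg t
          rw [mul_pow]; linarith
      _ = 2 * t := by rw [← sqrt_eq_rpow, sqrt_sq (by linarith)]
      _ ≤ _ := by linarith
  have h5 : C2 * ‖s‖ * (N : ℝ) ^ (1/4 - σ) ≤ 3 * C2 := by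
    have : (N : ℝ) ^ (1/4 - σ) ≤ t⁻¹ := by
      calc (N : ℝ) ^ (1/4 - σ) ≤ (N : ℝ) ^ (-(1/2) : ℝ) := rpow_le_rpow_of_exponent_le hN1r (by linarith)
        _ ≤ (t ^ 2) ^ (-(1/2) : ℝ) := rpow_le_rpow_of_nonpos (by positivity) hm2.le (by norm_num)
        _ = t⁻¹ := by rw [rpow_neg (by positivity), ← sqrt_eq_rpow, sqrt_sq ht0.le]
    calc C2 * ‖s‖ * (N : ℝ) ^ (1/4 - σ) ≤ C2 * (2 + t) * t⁻¹ := by gcongr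
      _ ≤ C2 * (3 * t) * t⁻¹ := by gcongr; linarith
      _ = _ := by field_simp
  have h6 : ‖riemannZeta s‖ ≤ t ^ (δ / K) * (1 + log (2 * t)) + C * (m + 1) + 2 + 3 * C2 := by
    have e : riemannZeta s = (riemannZeta s - ∑ n ∈ Finset.Ico 1 N, (n : ℂ) ^ (-s) - (N : ℂ) ^ (1 - s) / (s - 1)) +
      (∑ n ∈ Finset.Ico 1 N0, (n : ℂ) ^ (-s)) + (∑ n ∈ Finset.Ico N0 N, (n : ℂ) ^ (-s)) + (N : ℂ) ^ (1 - s) / (s - 1) := by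
      rw [← Finset.sum_Ico_consecutive _ hN01 (show N0 ≤ N from Nat.le_mul_of_pos_right _ (by positivity))]
      ring
    rw [e]
    refine (norm_add_le _ _).trans ?_
    have := (norm_add₃_le (a := riemannZeta s - ∑ n ∈ Finset.Ico 1 N, (n : ℂ) ^ (-s) - (N : ℂ) ^ (1 - s) / (s - 1))
      (b := ∑ n ∈ Finset.Ico 1 N0, (n : ℂ) ^ (-s)) (c := ∑ n ∈ Finset.Ico N0 N, (n : ℂ) ^ (-s)))
    linarith
  have hX : 1 ≤ t ^ (δ / K) := one_le_rpow ht1 (by positivity)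
  have hXle : t ^ (δ / K) ≤ t ^ (ε * δ / 2) := by
    refine rpow_le_rpow_of_exponent_le ht1 ?_
    rw [div_le_iff₀ hK0]
    rw [div_lt_iff₀ hε] at hK2
    have := mul_le_mul_of_nonneg_left hK2.le hδ.le
    linarith
  have hl2 : log (2 * t) ≤ 1 + log t := by
    rw [log_mul (by norm_num) ht0.ne']
    linarith [log_two_lt_d9]
  have h7 : ‖riemannZeta s‖ ≤ t ^ (ε * δ / 2) * (A * (1 + log t)) := by
    refine h6.trans ?_
    have h8 : t ^ (δ / K) * (1 + log (2 * t)) ≤ t ^ (ε * δ / 2) * (2 + 2 * log t) :=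
      mul_le_mul hXle (by linarith) (by linarith [log_nonneg (show 1 ≤ 2 * t by linarith)]) (by positivity)
    have h9 : C * (m + 1) + 2 + 3 * C2 ≤ (5 * C + 2 + 3 * C2) * (1 + log t) := by
      have q1 := mul_le_mul_of_nonneg_left hm3 hC.le
      have q2 := mul_nonneg hC.le hlt
      have q3 := mul_nonneg hC2.le hlt
      linarith
    have hY : 1 ≤ t ^ (ε * δ / 2) := hX.trans hXle
    have h10 : (5 * C + 2 + 3 * C2) * (1 + log t) ≤ t ^ (ε * δ / 2) * ((5 * C + 2 + 3 * C2) * (1 + log t)) :=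
      le_mul_of_one_le_left (by positivity) hY
    have h11 : t ^ (ε * δ / 2) * (2 + 2 * log t) ≤ t ^ (ε * δ / 2) * (4 * (1 + log t)) := by gcongr; linarith
    rw [hA]
    linarith
  refine h7.trans ?_
  calc _ ≤ t ^ (ε * δ / 2) * t ^ (ε * δ / 2) := by gcongr; exact hT0 t ((le_max_right _ _).trans ht)
    _ = _ := by rw [← rpow_add ht0]; ring_nf

end PF

namespace PF
open Metric Complex in
lemma lemC {f : ℂ → ℂ} {R M : ℝ} (hR : 0 < R) (hM : 0 < M) (hf : DifferentiableOn ℂ f (ball 0 R))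
    (h0 : ∀ z ∈ ball (0:ℂ) R, f z ≠ 0) (hb : ∀ z ∈ ball (0:ℂ) R, ‖f z‖ ≤ Real.exp M * ‖f 0‖)
    {z : ℂ} (hz : ‖z‖ ≤ R / 2) : ‖deriv f z / f z‖ ≤ 24 * M / R := by
  have hm0 : (0:ℂ) ∈ ball (0:ℂ) R := mem_ball_self hR
  have hq : DifferentiableOn ℂ (fun w => deriv f w / f w) (ball 0 R) :=
    (hf.deriv isOpen_ball).div hf h0
  obtain ⟨F, hF0, hF⟩ := hq.isExactOn_ball.with_val_at 0 0
  have hFd : DifferentiableOn ℂ F (ball 0 R) := fun w hw => (hF w hw).differentiableAt.differentiableWithinAt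
  have hc : ∀ w ∈ ball (0:ℂ) R, f w * Complex.exp (- F w) = f 0 := by
    intro w hw
    have := (convex_ball (0:ℂ) R).is_const_of_fderivWithin_eq_zero (𝕜 := ℂ)
      (f := fun w => f w * Complex.exp (- F w)) (hf.mul hFd.neg.cexp) ?_ hw hm0
    · simpa [hF0] using this
    · intro v hv
      have hfv : HasDerivAt f (deriv f v) v := (hf.differentiableAt (isOpen_ball.mem_nhds hv)).hasDerivAt
      have h1 := hfv.mul ((hF v hv).neg.cexp)
      have h2 : deriv f v * Complex.exp (-F v) + f v * (Complex.exp (-F v) * -(deriv f v / f v)) = 0 := by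
        have := h0 v hv
        field_simp; ring
      simp only [Pi.neg_apply] at h1
      rw [h2] at h1
      have h3 := h1.hasFDerivAt.hasFDerivWithinAt (s := ball 0 R)
      have h4 := h3.fderivWithin (isOpen_ball.uniqueDiffWithinAt hv)
      refine h4.trans ?_
      ext; simp
  have hre : Set.MapsTo F (ball 0 R) {z | z.re ≤ M} := by
    intro w hw
    have h1 := hc w hw
    have h2 : f w = f 0 * Complex.exp (F w) := by
      rw [← h1, mul_assoc, ← Complex.exp_add]; simp
    have h3 := hb w hw
    rw [h2, norm_mul, Complex.norm_exp, mul_comm] at h3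
    have h4 : 0 < ‖f 0‖ := norm_pos_iff.2 (h0 0 hm0)
    exact Real.exp_le_exp.1 (le_of_mul_le_mul_right h3 h4)
  have hzb : z ∈ ball (0:ℂ) R := by rw [mem_ball_zero_iff]; linarith
  have hsub : closedBall z (R/4) ⊆ ball (0:ℂ) R := by
    intro w hw
    rw [mem_closedBall, dist_eq_norm] at hw
    rw [mem_ball_zero_iff]
    have := norm_add_le (w - z) z
    rw [sub_add_cancel] at this; linarith
  rw [← (hF z hzb).deriv]
  have := Complex.norm_deriv_le_of_forall_mem_sphere_norm_le (f := F) (c := z) (R := R/4) (C := 6*M)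
    (by linarith) ?_ ?_
  · refine this.trans (le_of_eq ?_); field_simp; norm_num
  · refine DifferentiableOn.diffContOnCl ?_
    rw [closure_ball _ (by linarith)]; exact hFd.mono hsub
  · intro w hw
    have hwb := hsub (sphere_subset_closedBall hw)
    have h1 := Complex.borelCaratheodory_zero hM hFd hre hR hwb hF0
    have h2 : ‖w‖ ≤ 3 * R / 4 := by
      rw [mem_sphere, dist_eq_norm] at hw
      have := norm_add_le (w - z) z
      rw [sub_add_cancel] at this; linarith
    refine h1.trans ?_
    rw [div_le_iff₀ (by linarith)]
    nlinarith

open Metric Complex in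
lemma lemRem {f : ℂ → ℂ} {R r B : ℝ} (hr : 0 < r) (hrR : r < R) (hf : DifferentiableOn ℂ f (ball 0 R))
    (h0 : f 0 ≠ 0) (hb : ∀ z, ‖z‖ ≤ r → ‖f z‖ ≤ B) {ρ : ℂ} (hρ : f ρ = 0) (hρr : ‖ρ‖ ≤ r / 2) :
    ∃ g : ℂ → ℂ, DifferentiableOn ℂ g (ball 0 R) ∧ (∀ z, ‖z‖ ≤ r → ‖g z‖ ≤ B) ∧
      2 * ‖f 0‖ ≤ ‖g 0‖ ∧ (∀ z, ‖z‖ ≤ r / 2 → g z = 0 → f z = 0) ∧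
      deriv f 0 / f 0 = deriv g 0 / g 0 - 1 / ρ + (starRingEnd ℂ) ρ / r ^ 2 := by
  have hm0 : (0:ℂ) ∈ ball (0:ℂ) R := mem_ball_self (by linarith)
  have hρR : ρ ∈ ball (0:ℂ) R := by rw [mem_ball_zero_iff]; linarith
  have hρ0 : ρ ≠ 0 := by rintro rfl; exact h0 hρ
  have hrc : (r:ℂ) ≠ 0 := by exact_mod_cast hr.ne'
  set k := dslope f ρ with hk
  have hkd : DifferentiableOn ℂ k (ball 0 R) :=
    (Complex.differentiableOn_dslope (isOpen_ball.mem_nhds hρR)).2 hf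
  have hfk : ∀ z, f z = (z - ρ) * k z := fun z => by
    have := sub_smul_dslope f ρ z
    rw [hρ, sub_zero, smul_eq_mul] at this; exact this.symm
  have hk0 : k 0 ≠ 0 := fun h => h0 (by rw [hfk, h, mul_zero])
  set b : ℂ → ℂ := fun z => ((r:ℂ)^2 - (starRingEnd ℂ) ρ * z) / r with hbdef
  have hbd : ∀ z, HasDerivAt b (-(starRingEnd ℂ) ρ / r) z := fun z => by
    have := (((hasDerivAt_id z).const_mul ((starRingEnd ℂ) ρ)).const_sub ((r:ℂ)^2)).div_const (r:ℂ)
    simpa using this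
  have hgd : DifferentiableOn ℂ (fun z => k z * b z) (ball 0 R) :=
    hkd.mul (fun z _ => (hbd z).differentiableAt.differentiableWithinAt)
  have hb0 : b 0 = r := by simp [hbdef]; field_simp
  refine ⟨fun z => k z * b z, hgd, ?_, ?_, ?_, ?_⟩
  · intro z hz
    have hcl : closure (ball (0:ℂ) r) = closedBall 0 r := closure_ball _ hr.ne'
    refine Complex.norm_le_of_forall_mem_frontier_norm_le (f := fun z => k z * b z) (U := ball (0:ℂ) r) isBounded_ball ?_ ?_
      (z := z) (by rw [hcl]; simpa using hz)
    · refine DifferentiableOn.diffContOnCl ?_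
      rw [hcl]; exact hgd.mono (closedBall_subset_ball hrR)
    · intro w hw
      rw [frontier_ball _ hr.ne', mem_sphere_zero_iff_norm] at hw
      have h1 : ‖b w‖ = ‖w - ρ‖ := by
        have h2 : (r:ℂ)^2 = w * (starRingEnd ℂ) w := by
          rw [Complex.mul_conj, Complex.normSq_eq_norm_sq, hw]; push_cast; rfl
        have h3 : b w = w * (starRingEnd ℂ) (w - ρ) / r := by
          simp only [hbdef]; rw [h2, map_sub]; ring
        rw [h3, norm_div, norm_mul, hw, RCLike.norm_conj, Complex.norm_real, Real.norm_of_nonneg hr.le]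
        field_simp
      rw [norm_mul, h1, mul_comm, ← norm_mul, ← hfk]
      exact hb w hw.le
  · show 2 * ‖f 0‖ ≤ ‖k 0 * b 0‖
    rw [hb0, hfk 0, norm_mul, norm_mul, zero_sub, norm_neg, Complex.norm_real, Real.norm_of_nonneg hr.le]
    nlinarith [norm_nonneg (k 0)]
  · intro z hz hgz
    have hbz : b z ≠ 0 := by
      intro h
      simp only [hbdef, div_eq_zero_iff, hrc, or_false] at h
      have h2 : ‖(r:ℂ)^2‖ = ‖(starRingEnd ℂ) ρ * z‖ := by rw [sub_eq_zero.1 h]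
      rw [norm_pow, norm_mul, RCLike.norm_conj, Complex.norm_real, Real.norm_of_nonneg hr.le] at h2
      nlinarith [norm_nonneg z, norm_nonneg ρ]
    rw [hfk, (mul_eq_zero.1 hgz).resolve_right hbz, mul_zero]
  · have hkd0 : HasDerivAt k (deriv k 0) 0 := (hkd.differentiableAt (isOpen_ball.mem_nhds hm0)).hasDerivAt
    have h1 := (hkd0.fun_mul (hbd 0)).deriv
    have h2 : HasDerivAt f (1 * k 0 + (0 - ρ) * deriv k 0) 0 := by
      have := ((hasDerivAt_id (0:ℂ)).sub_const ρ).fun_mul hkd0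
      refine this.congr_of_eventuallyEq (Eventually.of_forall fun z => ?_)
      simp [hfk]
    rw [h1, h2.deriv, hfk 0]
    beta_reduce
    rw [hb0]
    field_simp
    ring

open Metric Complex in
lemma lemA {R r B K : ℝ} (hr : 0 < r) (hrR : r < R) (hK : 0 < K) (n : ℕ) :
    ∀ f : ℂ → ℂ, DifferentiableOn ℂ f (ball 0 R) →
    f 0 ≠ 0 → (∀ z, ‖z‖ ≤ r → ‖f z‖ ≤ B) → (∀ z, ‖z‖ ≤ r / 2 → f z = 0 → z.re ≤ 0) →
    B ≤ 2 ^ n * ‖f 0‖ → B ≤ Real.exp K * ‖f 0‖ →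
    - (48 * K / r) ≤ (deriv f 0 / f 0).re := by
  induction n with
  | zero =>
    intro f hf h0 hb hz hn hBK
    by_cases hex : ∃ ρ, ‖ρ‖ ≤ r / 2 ∧ f ρ = 0
    · obtain ⟨ρ, hρr, hρ⟩ := hex
      obtain ⟨g, -, h2, h3, -⟩ := lemRem hr hrR hf h0 hb hρ hρr
      have := h2 0 (by simpa using hr.le)
      have h4 : 0 < ‖f 0‖ := norm_pos_iff.2 h0
      linarith
    · push Not at hex
      have := lemC (R := r / 2) (M := K) (z := 0) (by linarith) hK
        (hf.mono (ball_subset_ball (by linarith)))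
        (fun z hz => hex z (by rw [mem_ball_zero_iff] at hz; exact hz.le))
        (fun z hz => (hb z (by rw [mem_ball_zero_iff] at hz; linarith)).trans hBK) (by simp; linarith)
      have h2 := (abs_le.1 ((Complex.abs_re_le_norm _).trans this)).1
      refine le_trans (le_of_eq ?_) h2
      field_simp; norm_num
  | succ n ih =>
    intro f hf h0 hb hz hn hBK
    by_cases hex : ∃ ρ, ‖ρ‖ ≤ r / 2 ∧ f ρ = 0
    · obtain ⟨ρ, hρr, hρ⟩ := hex
      obtain ⟨g, h1, h2, h3, h4, h5⟩ := lemRem hr hrR hf h0 hb hρ hρr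
      have hf0 : 0 < ‖f 0‖ := norm_pos_iff.2 h0
      have := ih g h1 (norm_pos_iff.1 (by linarith)) h2 (fun z hz' hg => hz z hz' (h4 z hz' hg))
        (hn.trans (by rw [pow_succ, mul_assoc]; gcongr)) (hBK.trans (by gcongr; linarith))
      have h6 : 0 ≤ (- (1 / ρ) + (starRingEnd ℂ) ρ / r ^ 2).re := by
        have hρ0 : ρ ≠ 0 := by rintro rfl; exact h0 hρ
        have hn : 0 < ‖ρ‖ := norm_pos_iff.2 hρ0
        have e : - (1 / ρ) + (starRingEnd ℂ) ρ / r ^ 2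
            = (starRingEnd ℂ) ρ * ((1 / r ^ 2 - 1 / ‖ρ‖ ^ 2 : ℝ) : ℂ) := by
          have : 1 / ρ = (starRingEnd ℂ) ρ * ((1 / ‖ρ‖ ^ 2 : ℝ) : ℂ) := by
            rw [one_div, Complex.inv_def, Complex.normSq_eq_norm_sq]; push_cast; rw [one_div]
          rw [this]; push_cast; ring
        rw [e, Complex.re_mul_ofReal, Complex.conj_re]
        refine mul_nonneg_of_nonpos_of_nonpos (hz ρ hρr hρ) ?_
        rw [sub_nonpos]
        gcongr; linarith
      rw [h5, show deriv g 0 / g 0 - 1 / ρ + (starRingEnd ℂ) ρ / r ^ 2 = deriv g 0 / g 0 +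
        (- (1 / ρ) + (starRingEnd ℂ) ρ / r ^ 2) by ring, Complex.add_re]
      linarith
    · push Not at hex
      have := lemC (R := r / 2) (M := K) (z := 0) (by linarith) hK
        (hf.mono (ball_subset_ball (by linarith)))
        (fun z hz => hex z (by rw [mem_ball_zero_iff] at hz; exact hz.le))
        (fun z hz => (hb z (by rw [mem_ball_zero_iff] at hz; linarith)).trans hBK) (by simp; linarith)
      have h2 := (abs_le.1 ((Complex.abs_re_le_norm _).trans this)).1
      refine le_trans (le_of_eq ?_) h2
      field_simp; norm_num

open Metric Complex in
lemma lemA' {R r K : ℝ} (hr : 0 < r) (hrR : r < R) (hK : 0 < K) 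
    {f : ℂ → ℂ} (hf : DifferentiableOn ℂ f (ball 0 R)) (h0 : f 0 ≠ 0)
    (hb : ∀ z, ‖z‖ ≤ r → ‖f z‖ ≤ Real.exp K * ‖f 0‖)
    (hz : ∀ z, ‖z‖ ≤ r / 2 → f z = 0 → z.re ≤ 0) :
    - (48 * K / r) ≤ (deriv f 0 / f 0).re := by
  obtain ⟨n, hn⟩ := pow_unbounded_of_one_lt (Real.exp K) (by norm_num : (1:ℝ) < 2)
  exact lemA hr hrR hK n f hf h0 hb hz (by gcongr) le_rfl

open Metric Complex in
lemma lemB {R r K d : ℝ} (hr : 0 < r) (hrR : r < R) (hK : 0 < K) (hd : 0 < d) (hdr : d ≤ r / 2)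
    {f : ℂ → ℂ} (hf : DifferentiableOn ℂ f (ball 0 R)) (h0 : f 0 ≠ 0)
    (hb : ∀ z, ‖z‖ ≤ r → ‖f z‖ ≤ Real.exp K * ‖f 0‖)
    (hz : ∀ z, ‖z‖ ≤ r / 2 → f z = 0 → z.re ≤ 0) (hρ : f (-d) = 0) :
    1 / d - d / r ^ 2 - 48 * K / r ≤ (deriv f 0 / f 0).re := by
  obtain ⟨g, h1, h2, h3, h4, h5⟩ := lemRem hr hrR hf h0 hb hρ (by simpa [abs_of_pos hd] using hdr)
  have hf0 : 0 < ‖f 0‖ := norm_pos_iff.2 h0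
  have := lemA' hr hrR hK h1 (norm_pos_iff.1 (by linarith))
    (fun z hz => (h2 z hz).trans (by gcongr; linarith)) (fun z hz' hg => hz z hz' (h4 z hz' hg))
  have h6 : deriv f 0 / f 0 = deriv g 0 / g 0 + ((1 / d - d / r ^ 2 : ℝ) : ℂ) := by
    rw [h5]; simp; ring
  rw [h6, Complex.add_re, Complex.ofReal_re]
  linarith
end PF

namespace PF
/-- the point `σ + i t` -/
noncomputable def pt (σ t : ℝ) : ℂ := (σ:ℂ) + (t:ℂ) * Complex.I
lemma pt_re (σ t : ℝ) : (pt σ t).re = σ := by simp [pt]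
lemma pt_im (σ t : ℝ) : (pt σ t).im = t := by simp [pt]

noncomputable def VM (σ : ℝ) : ℝ := ∑' n : ℕ, ‖LSeries.term (fun n => (ArithmeticFunction.vonMangoldt n : ℂ)) (pt σ 0) n‖

lemma vm_term (σ t : ℝ) (n : ℕ) :
    ‖LSeries.term (fun n => (ArithmeticFunction.vonMangoldt n : ℂ)) (pt σ t) n‖ =
    if n = 0 then 0 else ArithmeticFunction.vonMangoldt n / (n:ℝ) ^ σ := by
  rw [LSeries.norm_term_eq, pt_re, Complex.norm_real, norm_of_nonneg ArithmeticFunction.vonMangoldt_nonneg]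

lemma vm_summable {σ : ℝ} (hσ : 1 < σ) (t : ℝ) :
    Summable fun n => LSeries.term (fun n => (ArithmeticFunction.vonMangoldt n : ℂ)) (pt σ t) n :=
  ArithmeticFunction.LSeriesSummable_vonMangoldt (by rw [pt_re]; exact hσ)

lemma vm_eq {σ : ℝ} (hσ : 1 < σ) (t : ℝ) :
    deriv riemannZeta (pt σ t) / riemannZeta (pt σ t) =
     - ∑' n, LSeries.term (fun n => (ArithmeticFunction.vonMangoldt n : ℂ)) (pt σ t) n := by
  have := ArithmeticFunction.LSeries_vonMangoldt_eq_deriv_riemannZeta_div (s := pt σ t) (by rw [pt_re]; exact hσ)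
  rw [LSeries] at this
  rw [this]; ring

lemma vm_norm {σ : ℝ} (hσ : 1 < σ) (t : ℝ) :
    ‖deriv riemannZeta (pt σ t) / riemannZeta (pt σ t)‖ ≤ VM σ := by
  rw [vm_eq hσ, norm_neg]
  refine (norm_tsum_le_tsum_norm (vm_summable hσ t).norm).trans (le_of_eq ?_)
  refine tsum_congr fun n => ?_
  rw [vm_term, vm_term]

lemma vm_zero {σ : ℝ} (hσ : 1 < σ) :
    deriv riemannZeta (pt σ 0) / riemannZeta (pt σ 0) = - (VM σ : ℂ) := by
  rw [vm_eq hσ, VM, Complex.ofReal_tsum]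
  congr 1
  refine tsum_congr fun n => ?_
  rw [vm_term, LSeries.term_def]
  split_ifs with h
  · simp
  · simp only [pt]; push_cast [Complex.ofReal_cpow (Nat.cast_nonneg n)]; simp

lemma vm_anti {σ σ' : ℝ} (hσ : 1 < σ) (h : σ ≤ σ') : VM σ' ≤ VM σ := by
  refine (vm_summable (hσ.trans_le h) 0).norm.tsum_le_tsum (fun n => ?_) (vm_summable hσ 0).norm
  rw [vm_term, vm_term]
  split_ifs with hn
  · exact le_rfl
  · have : (1:ℝ) ≤ n := by exact_mod_cast Nat.one_le_iff_ne_zero.2 hn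
    have h0 := ArithmeticFunction.vonMangoldt_nonneg (n := n)
    gcongr

lemma vm_341 {σ : ℝ} (hσ : 1 < σ) (t : ℝ) :
    0 ≤ 3 * VM σ - 4 * (deriv riemannZeta (pt σ t) / riemannZeta (pt σ t)).re
      - (deriv riemannZeta (pt σ (2*t)) / riemannZeta (pt σ (2*t))).re := by
  have h3 : ∀ u, HasSum (fun n => (LSeries.term (fun n => (ArithmeticFunction.vonMangoldt n : ℂ)) (pt σ u) n).re)
    (-(deriv riemannZeta (pt σ u) / riemannZeta (pt σ u)).re) := by
    intro u
    rw [vm_eq hσ u, Complex.neg_re, neg_neg]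
    exact Complex.hasSum_re (vm_summable hσ u).hasSum
  have h1 := (((h3 0).mul_left 3).add ((h3 t).mul_left 4)).add (h3 (2*t))
  have h4 := h1.nonneg ?_
  · rw [vm_zero hσ] at h4
    simp only [Complex.neg_re, Complex.ofReal_re] at h4
    linarith
  · intro n
    by_cases hn : n = 0
    · simp [hn]
    · have hn0 : (0:ℝ) < n := by exact_mod_cast Nat.pos_of_ne_zero hn
      have key : ∀ u, (LSeries.term (fun n => (ArithmeticFunction.vonMangoldt n : ℂ)) (pt σ u) n).re
        = ArithmeticFunction.vonMangoldt n / (n:ℝ)^σ * cos (u * log n) := by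
        intro u
        have e : (n:ℂ) ^ (pt σ u) = (((n:ℝ)^σ : ℝ) : ℂ) * Complex.exp ((u * log n : ℝ) * Complex.I) := by
          rw [pt, Complex.cpow_add _ _ (by exact_mod_cast hn), Complex.ofReal_cpow hn0.le]
          congr 1
          rw [Complex.cpow_def_of_ne_zero (by exact_mod_cast hn)]
          congr 1
          push_cast
          ring
        rw [LSeries.term_of_ne_zero hn, e, div_mul_eq_div_div, ← Complex.ofReal_div, div_eq_mul_inv _ (Complex.exp _),
          ← Complex.exp_neg, ← neg_mul, ← Complex.ofReal_neg, Complex.re_ofReal_mul, Complex.exp_ofReal_mul_I_re, cos_neg]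
      rw [key, key, key]
      have e2 : cos (2*t*log n) = 2 * cos (t * log n)^2 - 1 := by
        rw [mul_assoc, cos_two_mul]
      rw [e2, zero_mul, cos_zero]
      have h5 : 0 ≤ ArithmeticFunction.vonMangoldt n / (n:ℝ)^σ :=
        div_nonneg ArithmeticFunction.vonMangoldt_nonneg (by positivity)
      have h6 : 0 ≤ ArithmeticFunction.vonMangoldt n / (n:ℝ)^σ * (2 * (1 + cos (t * log n))^2) := by positivity
      linarith

lemma vm_le : ∃ C : ℝ, 0 < C ∧ ∀ η : ℝ, 0 < η → VM (1+η) ≤ 1 / η + C := by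
  obtain ⟨C, hC⟩ := log_deriv_riemannZeta_add_inv_sub_bounded.bound
  rw [eventually_nhdsWithin_iff, Metric.eventually_nhds_iff] at hC
  obtain ⟨e, he, hC⟩ := hC
  have h1 : ∀ η : ℝ, 0 < η → η < e → VM (1+η) ≤ 1 / η + C := by
    intro η h0 h1
    have hne : pt (1+η) 0 - 1 = (η:ℂ) := by simp [pt]
    have h2 := hC (y := pt (1+η) 0) (by rw [dist_eq_norm, hne]; simpa [abs_of_pos h0] using h1)
      (by intro h; rw [Set.mem_singleton_iff] at h; rw [h, sub_self] at hne; exact h0.ne (by exact_mod_cast hne))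
    rw [vm_zero (by linarith), hne, norm_one, mul_one, ← Complex.ofReal_inv, ← Complex.ofReal_neg, ← Complex.ofReal_add,
      Complex.norm_real] at h2
    have := (abs_le.1 h2).1
    rw [one_div]; linarith
  refine ⟨|C| + 2 / e + 1, by positivity, fun η h0 => ?_⟩
  have hC := le_abs_self C
  have : 0 < 2 / e := by positivity
  rcases lt_or_ge η e with h | h
  · have := h1 η h0 h; linarith
  · have h2 := h1 (e/2) (by linarith) (by linarith)
    have h3 := vm_anti (σ := 1 + e/2) (σ' := 1 + η) (by linarith) (by linarith)
    have h4 : 0 < 1 / η := by positivity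
    rw [one_div_div] at h2
    linarith

lemma zlow : ∃ C : ℝ, 0 < C ∧ ∀ η : ℝ, 0 < η → η ≤ 1 → ∀ t : ℝ, η ≤ C * ‖riemannZeta (pt (1+η) t)‖ := by
  obtain ⟨C, hC0, hC⟩ := zeta_approx
  refine ⟨1 + 2 * C, by positivity, fun η h0 h1 t => ?_⟩
  have hre : 1 < (pt (1+η) t).re := by rw [pt_re]; linarith
  have hre0 : 1 < (pt (1+η) 0).re := by rw [pt_re]; linarith
  have h2 := LSeries_one_mul_Lseries_moebius hre
  rw [LSeries_one_eq_riemannZeta hre] at h2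
  have h3 : ‖LSeries (fun n => ((ArithmeticFunction.moebius n : ℤ) : ℂ)) (pt (1+η) t)‖ ≤ ‖riemannZeta (pt (1+η) 0)‖ := by
    have hs1 : LSeriesSummable 1 (pt (1+η) 0) := LSeriesSummable_one_iff.2 hre0
    have hsm : LSeriesSummable (fun n => ((ArithmeticFunction.moebius n : ℤ) : ℂ)) (pt (1+η) t) :=
      ArithmeticFunction.LSeriesSummable_moebius_iff.2 hre
    have e1 : riemannZeta (pt (1+η) 0) = ((∑' n, ‖LSeries.term 1 (pt (1+η) 0) n‖ : ℝ) : ℂ) := by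
      rw [← LSeries_one_eq_riemannZeta hre0, LSeries, Complex.ofReal_tsum]
      refine tsum_congr fun n => ?_
      rw [LSeries.norm_term_eq, LSeries.term_def]
      split_ifs with h
      · simp
      · rw [pt_re]; simp only [pt]; push_cast [Complex.ofReal_cpow (Nat.cast_nonneg n)]; simp
    rw [e1, Complex.norm_real, norm_of_nonneg (tsum_nonneg fun n => norm_nonneg _)]
    refine (norm_tsum_le_tsum_norm hsm.norm).trans ?_
    refine hsm.norm.tsum_le_tsum (fun n => ?_) hs1.norm
    rw [LSeries.norm_term_eq, LSeries.norm_term_eq, pt_re, pt_re]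
    split_ifs with h
    · exact le_rfl
    · gcongr
      have := ArithmeticFunction.abs_moebius_le_one (n := n)
      simp only [Pi.one_apply, norm_one]
      rw [Complex.norm_intCast]; exact_mod_cast this
  have hne : pt (1+η) 0 - 1 = (η:ℂ) := by simp [pt]
  have h4 := hC 1 le_rfl (pt (1+η) 0) (by linarith) (by
    intro h; rw [h, sub_self] at hne; exact h0.ne (by exact_mod_cast hne))
  rw [Finset.Ico_self, Finset.sum_empty, hne] at h4
  simp only [Nat.cast_one, Complex.one_cpow, one_rpow, sub_zero, mul_one] at h4
  have h5 : ‖pt (1+η) 0‖ ≤ 2 := by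
    simp only [pt, Complex.ofReal_zero, zero_mul, add_zero, Complex.norm_real]
    rw [norm_of_nonneg (by linarith)]; linarith
  have h6 : ‖riemannZeta (pt (1+η) 0)‖ ≤ 1 / η + 2 * C := by
    have := norm_sub_norm_le (riemannZeta (pt (1+η) 0)) (1 / (η:ℂ))
    rw [norm_div, norm_one, Complex.norm_real, norm_of_nonneg h0.le] at this
    have := mul_le_mul_of_nonneg_left h5 hC0.le
    linarith
  have h7 : 1 ≤ ‖riemannZeta (pt (1+η) t)‖ * (1 / η + 2 * C) := by
    have : ‖riemannZeta (pt (1+η) t) * LSeries (fun n => ((ArithmeticFunction.moebius n : ℤ) : ℂ)) (pt (1+η) t)‖ = 1 := by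
      rw [h2, norm_one]
    rw [norm_mul] at this
    exact this.ge.trans (mul_le_mul_of_nonneg_left (h3.trans h6) (norm_nonneg _))
  have h8 : 1 / η + 2 * C ≤ (1 + 2 * C) / η := by
    rw [add_div]
    have : 2 * C ≤ 2 * C / η := by rw [le_div_iff₀ h0]; nlinarith
    linarith
  have h9 := h7.trans (mul_le_mul_of_nonneg_left h8 (norm_nonneg _))
  rw [← mul_div_assoc, le_div_iff₀ h0] at h9
  linarith
end PF

namespace PF
lemma zlog {ε a : ℝ} (hε : 0 < ε) (ha : 0 < a) : ∃ δ : ℝ, 0 < δ ∧ δ ≤ 1/4 ∧ ∀ᶠ t : ℝ in atTop,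
    4 ≤ t ∧ 0 < a / log t ∧ a / log t ≤ 1 / 2 ∧ ∀ v, t ≤ v → v ≤ 2 * t → ∀ z : ℂ, ‖z‖ ≤ δ →
      ‖riemannZeta (pt (1 + a / log t) v + z)‖ ≤ exp (6 * ε * δ * log t) *
        ‖riemannZeta (pt (1 + a / log t) v)‖ := by
  obtain ⟨δ, hδ0, hδ1, T0, hT0, hg⟩ := zeta_growth hε
  obtain ⟨C, hC0, hC⟩ := zlow
  refine ⟨δ, hδ0, hδ1, ?_⟩
  have e1 := (isLittleO_log_rpow_atTop (r := 3 * ε * δ) (by positivity)).bound (c := a / C) (by positivity)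
  have e2 := tendsto_log_atTop.eventually_ge_atTop (2 * a + 1)
  filter_upwards [eventually_ge_atTop 4, eventually_ge_atTop (T0 + 1), e1, e2] with t h4 hT h1 h2
  have hl : 0 < log t := by linarith
  have ht0 : 0 < t := by linarith
  have hη : 0 < a / log t := by positivity
  have hη1 : a / log t ≤ 1 / 2 := by rw [div_le_iff₀ hl]; linarith
  refine ⟨h4, hη, hη1, fun v hv hv2 z hz => ?_⟩
  have hzr := abs_le.1 (Complex.abs_re_le_norm z)
  have hzi := abs_le.1 (Complex.abs_im_le_norm z)
  have b1 : ‖riemannZeta (pt (1 + a / log t) v + z)‖ ≤ (v + z.im) ^ (ε * δ) := by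
    have := hg (v + z.im) (by linarith) (1 + a / log t + z.re) (by linarith) (by linarith)
    convert this using 3
    apply Complex.ext <;> simp [pt]
  have b2 : (v + z.im) ^ (ε * δ) ≤ exp (3 * ε * δ * log t) := by
    have h3 : v + z.im ≤ t ^ 3 := by
      have : 4 * t * t ≤ t * t * t := by gcongr
      have : 4 * t ≤ t * t := by gcongr
      have : t^3 = t * t * t := by ring
      linarith
    refine (rpow_le_rpow (by linarith) h3 (by positivity)).trans (le_of_eq ?_)
    rw [rpow_def_of_pos (by positivity), log_pow]
    congr 1; push_cast; ring
  have b3 := hC _ hη (by linarith) v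
  rw [norm_of_nonneg hl.le, norm_of_nonneg (by positivity), rpow_def_of_pos ht0] at h1
  have b4 : 1 ≤ exp (3 * ε * δ * log t) * ‖riemannZeta (pt (1 + a / log t) v)‖ := by
    have h5 : log t * C ≤ a * exp (3 * ε * δ * log t) := by
      rw [div_mul_eq_mul_div, le_div_iff₀ hC0] at h1
      rw [mul_comm (3 * ε * δ)]; exact h1
    rw [div_le_iff₀ hl] at b3
    set E := exp (3 * ε * δ * log t)
    set Z := ‖riemannZeta (pt (1 + a / log t) v)‖
    have hE : 0 < E := exp_pos _
    have h6 : a * 1 ≤ a * (E * Z) := by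
      have hZ : 0 ≤ Z := norm_nonneg _
      have := mul_le_mul_of_nonneg_right h5 hZ
      calc a * 1 ≤ log t * C * Z := by linarith
        _ ≤ _ := by linarith
    exact le_of_mul_le_mul_left h6 ha
  refine (b1.trans b2).trans ?_
  rw [show 6 * ε * δ * log t = 3 * ε * δ * log t + 3 * ε * δ * log t by ring, exp_add, mul_assoc (exp _)]
  exact le_mul_of_one_le_right (exp_pos _).le b4

lemma zdiff {s : ℂ} {R : ℝ} (h : R ≤ s.im) :
    DifferentiableOn ℂ (fun z => riemannZeta (s + z)) (Metric.ball 0 R) := by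
  intro z hz
  rw [mem_ball_zero_iff] at hz
  have hzi := abs_le.1 (Complex.abs_im_le_norm z)
  refine DifferentiableAt.differentiableWithinAt ?_
  refine DifferentiableAt.comp z (g := riemannZeta) (differentiableAt_riemannZeta ?_)
    ((differentiableAt_const s).add differentiableAt_id)
  intro h1
  have := congrArg Complex.im h1
  simp at this
  linarith

lemma zderiv (s : ℂ) (w : ℂ) : deriv (fun z => riemannZeta (s + z)) w = deriv riemannZeta (s + w) :=
  deriv_comp_const_add _ _ _

lemma zne {s : ℂ} (h : riemannZeta s = 0) : s.re < 1 := by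
  by_contra h'
  exact riemannZeta_ne_zero_of_one_le_re (not_lt.1 h') h

lemma zfree {c : ℝ} (hc : 0 < c) : ∃ T0 : ℝ, 4 ≤ T0 ∧ ∀ t, T0 ≤ t → ∀ β, 1 - c / log t ≤ β →
    riemannZeta (pt β t) ≠ 0 := by
  set ε : ℝ := 1 / (40320 * c) with hεd
  have hε : 0 < ε := by positivity
  obtain ⟨δ, hδ0, hδ1, hz⟩ := zlog hε (a := 7 * c) (by positivity)
  obtain ⟨C0, hC0, hVM⟩ := vm_le
  have e2 := tendsto_log_atTop.eventually_ge_atTop (16 * c / δ)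
  have e3 := tendsto_log_atTop.eventually_gt_atTop (28 * c * (3 * C0 + 2 / δ))
  obtain ⟨T0, hT0⟩ := eventually_atTop.1 ((hz.and e2).and e3)
  refine ⟨max T0 4, le_max_right _ _, fun t ht β hβ h0 => ?_⟩
  obtain ⟨⟨⟨h4, hη0, hη1, hb⟩, h2⟩, h3⟩ := hT0 t ((le_max_left _ _).trans ht)
  set L := log t with hL
  set η := 7 * c / L with hη
  have hβ1 : β < 1 := by simpa [pt_re] using zne h0
  have hLpos : 0 < L := by
    have : 0 < 7 * c / L := hη0
    by_contra h'
    have : 7 * c / L ≤ 0 := div_nonpos_of_nonneg_of_nonpos (by positivity) (not_lt.1 h')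
    linarith
  set d := η + 1 - β with hd
  have hd0 : 0 < d := by linarith
  have hcL : c / L = η / 7 := by rw [hη]; ring
  have hdle : d ≤ 8 * (c / L) := by linarith
  have hdle2 : d ≤ δ / 2 := by
    refine hdle.trans ?_
    rw [div_le_iff₀ hδ0] at h2
    rw [← mul_div_assoc, div_le_iff₀ hLpos]; linarith
  set K := 6 * ε * δ * L with hK
  have hK0 : 0 < K := by positivity
  have hKδ : 48 * K / δ = 288 * ε * L := by rw [hK]; field_simp; norm_num
  have hne : ∀ v, riemannZeta (pt (1 + η) v) ≠ 0 := fun v =>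
    riemannZeta_ne_zero_of_one_le_re (by rw [pt_re]; linarith)
  have hzz : ∀ v, ∀ z : ℂ, ‖z‖ ≤ δ / 2 → riemannZeta (pt (1+η) v + z) = 0 → z.re ≤ 0 := by
    intro v z _ h
    have := zne h
    rw [Complex.add_re, pt_re] at this; linarith
  have A := lemA' (R := 2) (r := δ) (K := K) (f := fun z => riemannZeta (pt (1+η) (2*t) + z)) hδ0 (by linarith) hK0
    (zdiff (by rw [pt_im]; linarith)) (by simpa using hne _)
    (by simpa using hb (2*t) (by linarith) le_rfl) (hzz _)
  have B := lemB (R := 2) (r := δ) (K := K) (d := d) (f := fun z => riemannZeta (pt (1+η) t + z)) hδ0 (by linarith) hK0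
    hd0 hdle2
    (zdiff (by rw [pt_im]; linarith)) (by simpa using hne _)
    (by simpa using hb t le_rfl (by linarith)) (hzz _) (by
      rw [← h0]; congr 1; simp [pt, hd]; ring)
  simp only [zderiv, add_zero] at A B
  have D := vm_341 (σ := 1 + η) (by linarith) t
  have V := hVM η hη0
  rw [hKδ] at A B
  have q1 : d / δ ^ 2 ≤ 1 / (2 * δ) := by
    rw [div_le_div_iff₀ (by positivity) (by positivity)]; nlinarith
  have q2 : L / (8 * c) ≤ 1 / d := by
    rw [div_le_div_iff₀ (by positivity) hd0]
    have := mul_le_mul_of_nonneg_left hdle hLpos.le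
    have e : L * (8 * (c / L)) = 8 * c := by field_simp
    linarith
  have q3 : 1 / η = L / (7 * c) := by rw [hη, one_div_div]
  have q4 : 1 / (2 * δ) = (2/δ) / 4 := by field_simp; norm_num
  have q5 : 1440 * ε * L = L / c / 28 := by rw [hεd]; field_simp; norm_num
  have q6 : L / (8 * c) = L / c / 8 := by field_simp
  have q7 : L / (7 * c) = L / c / 7 := by field_simp
  have q8 : 3 * C0 + 2 / δ < L / c / 28 := by
    rw [lt_div_iff₀ (by norm_num), lt_div_iff₀ hc]; linarith
  have : 0 < 2 / δ := by positivity
  have : 0 < L / c := by positivity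
  linarith
end PF

namespace PF
lemma zbig {c : ℝ} (hc : 0 < c) : ∃ A : ℝ, 0 < A ∧ ∃ T1 : ℝ, 4 ≤ T1 ∧ ∀ t, T1 ≤ t → ∀ σ,
    1 - c / log t ≤ σ → σ ≤ 2 → riemannZeta (pt σ t) ≠ 0 ∧
    ‖deriv riemannZeta (pt σ t) / riemannZeta (pt σ t)‖ + ‖riemannZeta (pt σ t)‖ ≤ A * t ^ (1/2:ℝ) := by
  obtain ⟨δ, hδ0, hδ1, hz⟩ := zlog one_pos hc
  obtain ⟨T0, hT04, hfree⟩ := zfree (c := 4 * c) (by positivity)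
  obtain ⟨C0, hC0, hVM⟩ := vm_le
  obtain ⟨δ', hδ'0, hδ'1, Tg, hTg, hg⟩ := zeta_growth one_pos
  have e1 := tendsto_log_atTop.eventually_ge_atTop (4 * c / δ)
  have e2 := tendsto_log_atTop.eventually_ge_atTop (c / δ')
  obtain ⟨T2, hT2⟩ := eventually_atTop.1 (((hz.and e1).and e2).and
    ((eventually_ge_atTop (T0+1)).and ((eventually_ge_atTop Tg).and (eventually_ge_atTop 8))))
  refine ⟨36 * δ / c * 16 + (1 / c * 2 + C0) + 1, by positivity, max T2 8, (by norm_num : (4:ℝ) ≤ 8).trans (le_max_right _ _), fun t ht σ hσ hσ2 => ?_⟩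
  obtain ⟨⟨⟨⟨h4, hη0, hη1, hb⟩, h1⟩, h2⟩, h3, h5, h8⟩ := hT2 t ((le_max_left _ _).trans ht)
  have ht0 : 0 < t := by linarith
  set L := log t with hL
  have hLpos : 0 < L := log_pos (by linarith)
  have ht1 : 1 ≤ t ^ (1/2:ℝ) := one_le_rpow (by linarith) (by norm_num)
  have hL2 : L ≤ 2 * t ^ (1/2:ℝ) := by
    have := log_le_rpow_div ht0.le (ε := 1/2) (by norm_num)
    linarith
  have hL4 : L ^ 2 ≤ 16 * t ^ (1/2:ℝ) := by
    have h := log_le_rpow_div ht0.le (ε := 1/4) (by norm_num)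
    have h' : L ≤ 4 * t ^ (1/4:ℝ) := by linarith
    have e : t ^ (1/2:ℝ) = t ^ (1/4:ℝ) * t ^ (1/4:ℝ) := by rw [← rpow_add ht0]; norm_num
    rw [e]
    calc L ^ 2 ≤ (4 * t ^ (1/4:ℝ))^2 := by gcongr
      _ = _ := by ring
  have hzt : ‖riemannZeta (pt σ t)‖ ≤ 1 * t ^ (1/2:ℝ) := by
    have hcl : c / L ≤ δ' := by
      rw [div_le_iff₀ hδ'0] at h2; rw [div_le_iff₀ hLpos]; linarith
    refine (hg t h5 σ (by linarith) hσ2).trans ?_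
    rw [one_mul, one_mul]
    exact rpow_le_rpow_of_exponent_le (by linarith) (by linarith)
  have p1 : 0 ≤ 36 * δ / c * 16 * t ^ (1/2:ℝ) := by positivity
  have p2 : 0 ≤ (1 / c * 2 + C0) * t ^ (1/2:ℝ) := by positivity
  have hne : riemannZeta (pt σ t) ≠ 0 := hfree t (by linarith) σ (le_trans (by
    rw [mul_div_assoc]; have : 0 < c / L := hη0
    linarith) hσ)
  refine ⟨hne, ?_⟩
  rcases le_or_gt (1 + c / L) σ with h | h
  · have b1 := vm_norm (σ := σ) (by linarith) t
    have b2 := vm_anti (σ := 1 + c / L) (by linarith) h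
    have b3 := hVM (c / L) hη0
    have b4 : 1 / (c / L) ≤ 1 / c * 2 * t ^ (1/2:ℝ) := by
      rw [one_div_div, div_le_iff₀ hc]; field_simp; linarith
    have b5 : C0 ≤ C0 * t ^ (1/2:ℝ) := le_mul_of_one_le_right hC0.le ht1
    linarith
  · set R := 4 * c / L with hR
    have hR0 : 0 < R := by positivity
    have hRc : R = 4 * (c / L) := by rw [hR]; ring
    have hRδ : R ≤ δ := by
      rw [div_le_iff₀ hδ0] at h1; rw [hR, div_le_iff₀ hLpos]; linarith
    have hK : 0 < 6 * 1 * δ * L := by positivity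
    have hzero : ∀ z ∈ Metric.ball (0:ℂ) R, riemannZeta (pt (1 + c/L) t + z) ≠ 0 := by
      intro z hz
      rw [mem_ball_zero_iff] at hz
      have hzr := abs_le.1 (Complex.abs_re_le_norm z)
      have hzi := abs_le.1 (Complex.abs_im_le_norm z)
      have e : pt (1 + c/L) t + z = pt (1 + c/L + z.re) (t + z.im) := by
        apply Complex.ext <;> simp [pt]
      rw [e]
      refine hfree _ (by linarith) _ ?_
      have hlog : log (t + z.im) ≤ 4/3 * L := by
        have : t + z.im ≤ t ^ (4/3:ℝ) := by
          have e2 : t ^ (4/3:ℝ) = t * t ^ (1/3:ℝ) := by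
            rw [show (4/3:ℝ) = 1 + 1/3 by norm_num, rpow_add ht0, rpow_one]
          have e3 : (2:ℝ) ≤ t ^ (1/3:ℝ) := by
            have : (2:ℝ) = (8:ℝ) ^ (1/3:ℝ) := by
              rw [show (8:ℝ) = 2 ^ (3:ℝ) by norm_num, ← rpow_mul (by norm_num)]; norm_num
            rw [this]; gcongr
          rw [e2]
          have := mul_le_mul_of_nonneg_left e3 ht0.le
          linarith
        have := log_le_log (by linarith) this
        rwa [log_rpow ht0] at this
      have hlp : 0 < log (t + z.im) := log_pos (by linarith)
      have : 3 * (c / L) ≤ 4 * c / log (t + z.im) := by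
        rw [← mul_div_assoc, div_le_div_iff₀ hLpos hlp]
        have := mul_le_mul_of_nonneg_left hlog hc.le
        linarith
      linarith
    have hcl : σ - (1 + c/L) = -(1 + c / L - σ) := by ring
    have key := lemC (f := fun z => riemannZeta (pt (1 + c/L) t + z)) (R := R) hR0 hK
      (zdiff (by rw [pt_im]; linarith)) hzero
      (fun z hz => by
        have := hb t le_rfl (by linarith) z (by rw [mem_ball_zero_iff] at hz; linarith)
        simpa using this) (z := ((σ - (1 + c/L) : ℝ) : ℂ)) (by
          rw [Complex.norm_real, hcl, norm_neg, norm_of_nonneg (by linarith)]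
          linarith)
    simp only [zderiv] at key
    have e : pt (1 + c/L) t + ((σ - (1 + c/L) : ℝ) : ℂ) = pt σ t := by
      apply Complex.ext <;> simp [pt]
    rw [e] at key
    have e2 : 24 * (6 * 1 * δ * L) / R = 36 * δ / c * L ^ 2 := by
      rw [hR]; field_simp; norm_num
    have := mul_le_mul_of_nonneg_left hL4 (show 0 ≤ 36 * δ / c by positivity)
    linarith

noncomputable def hh (s : ℂ) : ℂ := - deriv riemannZeta₁ s / riemannZeta₁ s - riemannZeta₀ s

lemma hh_eq {s : ℂ} (hs : s ≠ 1) (h0 : riemannZeta₁ s ≠ 0) :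
    hh s = - (deriv riemannZeta s / riemannZeta s) - riemannZeta s := by
  have h1 : s - 1 ≠ 0 := sub_ne_zero.2 hs
  rw [deriv_riemannZeta_eq_neg_inv_sub_sq_mul_add hs, hh]
  nth_rw 2 [riemannZeta_eq_inv_sub_add hs]
  rw [riemannZeta_eq_inv_sub_mul hs]
  field_simp
  ring

lemma hh_diff {s : ℂ} (h0 : riemannZeta₁ s ≠ 0) : DifferentiableAt ℂ hh s := by
  have h1 : DifferentiableAt ℂ (deriv riemannZeta₁) s := differentiable_riemannZeta₁.deriv s
  exact (h1.neg.div (differentiable_riemannZeta₁ s) h0).sub (differentiable_riemannZeta₀ s)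

lemma Z1_ne {s : ℂ} (h : s = 1 ∨ riemannZeta s ≠ 0) : riemannZeta₁ s ≠ 0 := by
  by_cases hs : s = 1
  · rw [hs]; simp
  · intro h1
    rcases h with h | h
    · exact hs h
    · exact h (by rw [riemannZeta_eq_inv_sub_mul hs, h1, mul_zero])

lemma zderiv_conj (s : ℂ) : deriv riemannZeta ((starRingEnd ℂ) s) = (starRingEnd ℂ) (deriv riemannZeta s) := by
  have h : (starRingEnd ℂ) ∘ riemannZeta ∘ (starRingEnd ℂ) = riemannZeta := by
    funext s; simp [riemannZeta_conj]
  have h2 := congrFun (deriv_conj_conj (f := riemannZeta)) ((starRingEnd ℂ) s)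
  rw [h] at h2
  simpa using h2

lemma hsmall (T1 : ℝ) : ∃ κ : ℝ, 0 < κ ∧ ∃ A : ℝ, 0 < A ∧ ∀ s : ℂ, 1 - κ ≤ s.re → s.re ≤ 2 → |s.im| ≤ T1 →
    riemannZeta₁ s ≠ 0 ∧ ‖hh s‖ ≤ A := by
  set K : Set ℂ := (Set.Icc 1 2) ×ℂ (Set.Icc (-T1) T1) with hK
  have hKc : IsCompact K := isCompact_Icc.reProdIm isCompact_Icc
  set U : Set ℂ := {s | riemannZeta₁ s ≠ 0} with hU
  have hUo : IsOpen U := isOpen_ne_fun differentiable_riemannZeta₁.continuous continuous_const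
  have hKU : K ⊆ U := by
    intro s hs
    refine Z1_ne ?_
    right
    exact riemannZeta_ne_zero_of_one_le_re hs.1.1
  obtain ⟨κ, hκ, hsub⟩ := hKc.exists_cthickening_subset_open hUo hKU
  have hc2 : IsCompact (Metric.cthickening κ K) := hKc.cthickening
  obtain ⟨A, hA⟩ := hc2.exists_bound_of_continuousOn (f := hh)
    (fun s hs => (hh_diff (hsub hs)).continuousAt.continuousWithinAt)
  refine ⟨κ, hκ, |A| + 1, by positivity, fun s h1 h2 h3 => ?_⟩
  have hmem : s ∈ Metric.cthickening κ K := by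
    have h3' := abs_le.1 h3
    rcases le_or_gt 1 s.re with h | h
    · exact Metric.self_subset_cthickening _ ⟨⟨h, h2⟩, h3'⟩
    · refine Metric.mem_cthickening_of_dist_le s (pt 1 s.im) κ K ⟨?_, ?_⟩ ?_
      · simp [pt_re]
      · simpa [pt_im] using h3'
      · have e : s - pt 1 s.im = ((s.re - 1 : ℝ) : ℂ) := by apply Complex.ext <;> simp [pt]
        rw [dist_eq_norm, e, Complex.norm_real, norm_eq_abs, abs_le]
        constructor <;> linarith
  exact ⟨hsub hmem, (hA s hmem).trans (by linarith [le_abs_self A])⟩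

lemma P3final {c : ℝ} (hc : 0 < c) : ∃ A : ℝ, 0 < A ∧ ∃ T0 : ℝ, 2 ≤ T0 ∧ ∀ T, T0 ≤ T → ∀ s : ℂ, |s.im| ≤ T →
    1 - c / log T ≤ s.re → s.re ≤ 2 → riemannZeta₁ s ≠ 0 ∧ ‖hh s‖ ≤ A * (1 + |s.im|) ^ (1/2:ℝ) := by
  obtain ⟨A, hA, T1, hT1, h⟩ := zbig hc
  obtain ⟨κ, hκ, A2, hA2, h2⟩ := hsmall T1
  have e1 := tendsto_log_atTop.eventually_ge_atTop (c / κ)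
  obtain ⟨T0, hT0⟩ := eventually_atTop.1 (e1.and (eventually_ge_atTop 2))
  have hpos : ∀ T, T0 ≤ T → ∀ s : ℂ, 0 ≤ s.im → s.im ≤ T →  1 - c / log T ≤ s.re → s.re ≤ 2 → T1 ≤ s.im →
      riemannZeta s ≠ 0 ∧ ‖deriv riemannZeta s / riemannZeta s‖ + ‖riemannZeta s‖ ≤ A * s.im ^ (1/2:ℝ) := by
    intro T hT s h0 h3 h4 h5 h6
    have e : pt s.re s.im = s := by apply Complex.ext <;> simp [pt]
    have := h s.im h6 s.re (le_trans (by
      have : 0 < log s.im := log_pos (by linarith)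
      have := log_le_log (by linarith) h3
      gcongr) h4) h5
    rwa [e] at this
  refine ⟨A + A2, by positivity, max T0 2, le_max_right _ _, fun T hT s h3 h4 h5 => ?_⟩
  have hT' := (le_max_left _ _).trans hT
  obtain ⟨g1, g2⟩ := hT0 T hT'
  have hr : 1 ≤ (1 + |s.im|) ^ (1/2:ℝ) := one_le_rpow (by linarith [abs_nonneg s.im]) (by norm_num)
  rcases le_or_gt |s.im| T1 with h6 | h6
  · have hlog : 0 < log T := log_pos (by linarith)
    have : c / log T ≤ κ := by rw [div_le_iff₀ hκ] at g1; rw [div_le_iff₀ hlog]; linarith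
    obtain ⟨q1, q2⟩ := h2 s (by linarith) h5 h6
    refine ⟨q1, q2.trans ?_⟩
    nlinarith
  · have hs1 : s ≠ 1 := by rintro rfl; simp at h6; linarith
    have key : riemannZeta s ≠ 0 ∧ ‖deriv riemannZeta s / riemannZeta s‖ + ‖riemannZeta s‖ ≤ A * |s.im| ^ (1/2:ℝ) := by
      rcases le_or_gt 0 s.im with h7 | h7
      · rw [abs_of_nonneg h7] at *
        exact hpos T hT' s h7 h3 h4 h5 h6.le
      · rw [abs_of_neg h7] at *
        have := hpos T hT' ((starRingEnd ℂ) s) (by simpa using h7.le) (by simpa using h3) (by simpa using h4)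
          (by simpa using h5) (by simpa using h6.le)
        rw [riemannZeta_conj, zderiv_conj] at this
        simpa using this
    have hZ := Z1_ne (Or.inr key.1)
    refine ⟨hZ, ?_⟩
    rw [hh_eq hs1 hZ]
    refine (norm_sub_le _ _).trans ?_
    rw [norm_neg]
    refine key.2.trans ?_
    gcongr <;> linarith
end PF

namespace PF
lemma pt_ge {σ : ℝ} (hσ : 1/2 ≤ σ) (t : ℝ) : (1 + |t|) ^ 2 / 9 ≤ ‖pt σ t * (pt σ t + 1)‖ := by
  have h1 := Complex.abs_re_le_norm (pt σ t)
  have h2 := Complex.abs_im_le_norm (pt σ t)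
  have h3 := Complex.abs_re_le_norm (pt σ t + 1)
  have h4 := Complex.abs_im_le_norm (pt σ t + 1)
  simp only [Complex.add_re, Complex.add_im, Complex.one_re, Complex.one_im, pt_re, pt_im, add_zero] at h1 h2 h3 h4
  have h5 := le_abs_self σ
  have h6 := le_abs_self (σ + 1)
  rw [norm_mul]
  have h7 : (1 + |t|) / 3 ≤ ‖pt σ t‖ := by linarith
  have h8 : (1 + |t|) / 3 ≤ ‖pt σ t + 1‖ := by linarith
  have := abs_nonneg t
  calc (1 + |t|) ^ 2 / 9 = (1 + |t|) / 3 * ((1 + |t|) / 3) := by ring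
    _ ≤ _ := by gcongr

lemma pt_ne {σ : ℝ} (hσ : 1/2 ≤ σ) (t : ℝ) : pt σ t * (pt σ t + 1) ≠ 0 := by
  have := pt_ge hσ t
  have h2 := abs_nonneg t
  exact norm_pos_iff.1 (lt_of_lt_of_le (by positivity) this)

lemma pt_cont (σ : ℝ) : Continuous (fun t => pt σ t) := by unfold pt; fun_prop

lemma ker_int {σ : ℝ} (hσ : 1/2 ≤ σ) : Integrable (fun t : ℝ => 1 / (pt σ t * (pt σ t + 1))) := by
  have h0 : Integrable (fun t : ℝ => 9 * (1 + ‖t‖) ^ (-2:ℝ)) :=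
    (integrable_one_add_norm (by simp)).const_mul 9
  refine h0.mono' ?_ (Eventually.of_forall fun t => ?_)
  · refine Continuous.aestronglyMeasurable ?_
    have := pt_cont σ
    exact continuous_const.div (by fun_prop) (pt_ne hσ)
  · rw [norm_div, norm_one]
    have h1 := pt_ge hσ t
    have h2 := abs_nonneg t
    rw [norm_eq_abs, rpow_neg (by positivity), rpow_two, ← div_eq_mul_inv]
    refine (one_div_le_one_div_of_le (by positivity) h1).trans (le_of_eq ?_)
    field_simp

lemma ker_mellin {σ : ℝ} (hσ : 1/2 ≤ σ) {y : ℝ} (hy : 0 < y) :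
    ∫ t : ℝ, (y:ℂ) ^ (-(pt σ t)) * (1 / (pt σ t * (pt σ t + 1))) = 2 * π * ((max (1 - y) 0 : ℝ) : ℂ) := by
  set φ : ℝ → ℂ := fun t => Set.indicator (Set.Ioc 0 1) (fun _ => 1 : ℝ → ℂ) t -
    Set.indicator (Set.Ioc 0 1) (fun t => (t:ℂ) ^ (1:ℂ) : ℝ → ℂ) t with hφ
  have hm : ∀ s : ℂ, 0 < s.re → HasMellin φ s (1 / s - 1 / (s + 1)) := by
    intro s hs
    have h1 := hasMellin_one_Ioc hs
    have h2 := hasMellin_cpow_Ioc 1 (s := s) (by simp; linarith)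
    have := hasMellin_sub h1.1 h2.1
    rw [h1.2, h2.2] at this
    exact this
  have hmv : ∀ t, mellin φ (pt σ t) = 1 / (pt σ t * (pt σ t + 1)) := by
    intro t
    rw [(hm (pt σ t) (by rw [pt_re]; linarith)).2]
    have h1 := left_ne_zero_of_mul (pt_ne hσ t)
    have h2 := right_ne_zero_of_mul (pt_ne hσ t)
    field_simp; ring
  have heq : ∀ t : ℝ, 0 < t → φ t = ((max (1 - t) 0 : ℝ) : ℂ) := by
    intro t ht
    simp only [hφ, Complex.cpow_one]
    by_cases h : t ≤ 1
    · have hmm : t ∈ Set.Ioc (0:ℝ) 1 := ⟨ht, h⟩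
      rw [Set.indicator_of_mem hmm, Set.indicator_of_mem hmm, max_eq_left (by linarith)]; push_cast; ring
    · have hmm : t ∉ Set.Ioc (0:ℝ) 1 := fun hh => h hh.2
      rw [Set.indicator_of_notMem hmm, Set.indicator_of_notMem hmm, max_eq_right (by linarith)]; simp
  have key := mellinInv_mellin_eq σ φ hy (hm σ (by simp; linarith)).1 ?_ ?_
  · rw [heq y hy, mellinInv] at key
    rw [← key, Complex.real_smul]
    push_cast
    rw [← mul_assoc, mul_one_div_cancel (by simp [pi_ne_zero]), one_mul]
    refine integral_congr_ae (Eventually.of_forall fun t => ?_)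
    simp only [← hmv, smul_eq_mul]
    rfl
  · show Integrable (fun t : ℝ => mellin φ (pt σ t))
    simp only [hmv]
    exact ker_int hσ
  · have : ContinuousAt (fun t : ℝ => ((max (1 - t) 0 : ℝ) : ℂ)) y := by fun_prop
    refine this.congr ?_
    filter_upwards [lt_mem_nhds hy] with t ht
    exact (heq t ht).symm

lemma perron {a x : ℝ} (ha : 1 < a) (hx : 0 < x) :
    ∫ t : ℝ, hh (pt a t) * ((x:ℂ) ^ (pt a t) * (1 / (pt a t * (pt a t + 1)))) =
      2 * π * ((∑ n ∈ Finset.Icc 1 ⌊x⌋₊, (ArithmeticFunction.vonMangoldt n - 1) * (1 - n / x) : ℝ) : ℂ) := by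
  have ha2 : 1/2 ≤ a := by linarith
  set b : ℕ → ℂ := fun n => (ArithmeticFunction.vonMangoldt n : ℂ) - 1 with hb
  have hre : ∀ t, 1 < (pt a t).re := fun t => by rw [pt_re]; exact ha
  have hs1 : ∀ t, LSeriesSummable (fun n => (ArithmeticFunction.vonMangoldt n : ℂ)) (pt a t) :=
    fun t => ArithmeticFunction.LSeriesSummable_vonMangoldt (hre t)
  have hs2 : ∀ t, LSeriesSummable 1 (pt a t) := fun t => LSeriesSummable_one_iff.2 (hre t)
  have hbs : ∀ t, LSeriesSummable b (pt a t) := fun t => (hs1 t).sub (hs2 t)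
  have hL : ∀ t, LSeries b (pt a t) = hh (pt a t) := by
    intro t
    have hne : pt a t ≠ 1 := fun h => by have := hre t; rw [h] at this; simp at this
    rw [hh_eq hne (Z1_ne (Or.inr (riemannZeta_ne_zero_of_one_le_re (hre t).le))),
      ← LSeries_one_eq_riemannZeta (hre t)]
    have := LSeries_sub (hs1 t) (hs2 t)
    refine this.trans ?_
    rw [ArithmeticFunction.LSeries_vonMangoldt_eq_deriv_riemannZeta_div (hre t),
      LSeries_one_eq_riemannZeta (hre t)]; ring
  set F : ℕ → ℝ → ℂ := fun n t => LSeries.term b (pt a t) n * ((x:ℂ) ^ (pt a t) * (1 / (pt a t * (pt a t + 1)))) with hF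
  have hxc : (x:ℂ) ≠ 0 := by exact_mod_cast hx.ne'
  have hFn : ∀ n t, ‖F n t‖ = ‖LSeries.term b (pt a 0) n‖ * (x ^ a * ‖1 / (pt a t * (pt a t + 1))‖) := by
    intro n t
    simp only [hF]
    rw [norm_mul, norm_mul, LSeries.norm_term_eq, LSeries.norm_term_eq, pt_re, pt_re,
      Complex.norm_cpow_eq_rpow_re_of_pos hx, pt_re]
  have hcont : ∀ n, Continuous (F n) := by
    intro n
    have := pt_cont a
    have h1 : Continuous (fun t => 1 / (pt a t * (pt a t + 1))) := continuous_const.div (by fun_prop) (pt_ne ha2)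
    have h2 : Continuous (fun t => (x:ℂ) ^ (pt a t)) := this.const_cpow (Or.inl hxc)
    refine Continuous.mul ?_ (h2.mul h1)
    by_cases hn : n = 0
    · simp [hn, continuous_const]
    · have hnc : (n:ℂ) ≠ 0 := by exact_mod_cast hn
      simp only [LSeries.term_of_ne_zero hn]
      exact continuous_const.div (this.const_cpow (Or.inl hnc)) (fun t => by
        rw [Complex.cpow_def_of_ne_zero hnc]; exact Complex.exp_ne_zero _)
  have hFi : ∀ n, Integrable (F n) := by
    intro n
    refine (((ker_int ha2).norm.const_mul (x^a)).const_mul (‖LSeries.term b (pt a 0) n‖)).mono'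
      (hcont n).aestronglyMeasurable (Eventually.of_forall fun t => (hFn n t).le)
  have hsum : Summable fun n => ∫ t, ‖F n t‖ := by
    simp only [hFn, integral_const_mul]
    exact (hbs 0).norm.mul_right _
  have key := integral_tsum_of_summable_integral_norm hFi hsum
  have e1 : ∀ t, ∑' n, F n t = hh (pt a t) * ((x:ℂ) ^ (pt a t) * (1 / (pt a t * (pt a t + 1)))) := by
    intro t
    rw [← hL t, LSeries]; exact tsum_mul_right
  simp only [e1] at key
  rw [← key]
  have e2 : ∀ n : ℕ, ∫ t, F n t = if n = 0 then 0 else 2 * π * (((ArithmeticFunction.vonMangoldt n - 1) * max (1 - n / x) 0 : ℝ) : ℂ) := by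
    intro n
    split_ifs with hn
    · simp [hF, hn]
    · have hn0 : (0:ℝ) < n := by exact_mod_cast Nat.pos_of_ne_zero hn
      have h1 := ker_mellin ha2 (y := n / x) (by positivity)
      have h2 : ∀ t, F n t = b n * ((((n / x : ℝ)):ℂ) ^ (-(pt a t)) * (1 / (pt a t * (pt a t + 1)))) := by
        intro t
        simp only [hF]
        rw [LSeries.term_of_ne_zero hn, Complex.cpow_neg]
        have : (((n / x : ℝ)):ℂ) ^ (pt a t) = (n:ℂ) ^ (pt a t) / (x:ℂ) ^ (pt a t) := by
          rw [div_eq_mul_inv, Complex.ofReal_mul, Complex.mul_cpow_ofReal_nonneg hn0.le (by positivity),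
            Complex.ofReal_inv, Complex.inv_cpow _ _ (by rw [Complex.arg_ofReal_of_nonneg hx.le]; exact pi_pos.ne)]
          rw [div_eq_mul_inv]; push_cast; rfl
        rw [this, inv_div]; ring
      simp only [h2, integral_const_mul, h1, hb]
      push_cast; ring
  simp only [e2]
  rw [tsum_eq_sum (s := Finset.Icc 1 ⌊x⌋₊)]
  · push_cast
    rw [Finset.mul_sum]
    refine Finset.sum_congr rfl fun n hn => ?_
    rw [Finset.mem_Icc] at hn
    rw [if_neg (by omega)]
    have : (n:ℝ) ≤ x := (Nat.le_floor_iff hx.le).1 hn.2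
    rw [max_eq_left (by rw [sub_nonneg]; exact (div_le_one hx).2 this)]
    push_cast; ring
  · intro n hn
    split_ifs with h
    · rfl
    · rw [Finset.mem_Icc] at hn
      have : x < n := by
        by_contra h'
        exact hn ⟨Nat.pos_of_ne_zero h, Nat.le_floor (not_lt.1 h')⟩
      rw [max_eq_right (by rw [sub_nonpos]; exact (one_le_div hx).2 this.le)]; simp
end PF

namespace PF
noncomputable def W1 (x : ℝ) : ℝ := ∑ n ∈ Finset.Icc 1 ⌊x⌋₊, (ArithmeticFunction.vonMangoldt n - 1) * (1 - n / x)

lemma g_bound {A x σ t : ℝ} (hx : 0 < x) (hσ : 1/2 ≤ σ)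
    (h : ‖hh (pt σ t)‖ ≤ A * (1 + |t|) ^ (1/2:ℝ)) :
    ‖hh (pt σ t) * ((x:ℂ) ^ (pt σ t) * (1 / (pt σ t * (pt σ t + 1))))‖ ≤ 9 * A * x ^ σ * (1 + |t|) ^ (-(3/2:ℝ)) := by
  have h1 := pt_ge hσ t
  have h2 := abs_nonneg t
  rw [norm_mul, norm_mul, Complex.norm_cpow_eq_rpow_re_of_pos hx, pt_re, norm_div, norm_one]
  have h3 : 1 / ‖pt σ t * (pt σ t + 1)‖ ≤ 9 * (1 + |t|) ^ (-2:ℝ) := by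
    rw [rpow_neg (by positivity), rpow_two, ← div_eq_mul_inv]
    refine (one_div_le_one_div_of_le (by positivity) h1).trans (le_of_eq ?_)
    field_simp
  calc _ ≤ (A * (1 + |t|) ^ (1/2:ℝ)) * (x ^ σ * (9 * (1 + |t|) ^ (-2:ℝ))) := by
        gcongr
        exact (norm_nonneg _).trans h
    _ = 9 * A * x ^ σ * ((1 + |t|) ^ (1/2:ℝ) * (1 + |t|) ^ (-2:ℝ)) := by ring
    _ = _ := by rw [← rpow_add (by positivity)]; norm_num

lemma W1_bound : ∃ C : ℝ, 0 < C ∧ ∀ᶠ x : ℝ in atTop, |W1 x| ≤ C * x * exp (-(5 * √(log x))) := by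
  obtain ⟨A, hA, T0, hT0, hP⟩ := P3final (c := 100) (by norm_num)
  have hJi : Integrable (fun t : ℝ => (1 + |t|) ^ (-(5/4:ℝ))) := by
    have := integrable_one_add_norm (E := ℝ) (μ := volume) (r := 5/4) (by simp; norm_num)
    simpa only [norm_eq_abs] using this
  set J := ∫ t : ℝ, (1 + |t|) ^ (-(5/4:ℝ)) with hJ
  have hJ0 : 0 ≤ J := integral_nonneg fun t => by positivity
  have hline : ∀ σ, 1 ≤ σ → σ ≤ 2 → ∀ t, riemannZeta₁ (pt σ t) ≠ 0 ∧ ‖hh (pt σ t)‖ ≤ A * (1 + |t|) ^ (1/2:ℝ) := by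
    intro σ h1 h2 t
    have hl : 0 < log (max T0 |t|) := log_pos (by have := le_max_left T0 |t|; linarith)
    have := hP (max T0 |t|) (le_max_left _ _) (pt σ t) (by rw [pt_im]; exact le_max_right _ _) (by
      rw [pt_re]; have : 0 < 100 / log (max T0 |t|) := by positivity
      linarith) (by rwa [pt_re])
    rwa [pt_im] at this
  set e := exp 1 with he
  have he0 : 0 < e := exp_pos 1
  refine ⟨9 * A * e * J + (9 * A * J + (18 * A * e + 18 * A * e)), by positivity, ?_⟩
  have hv : Tendsto (fun x => √(log x)) atTop atTop := tendsto_sqrt_atTop.comp tendsto_log_atTop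
  filter_upwards [eventually_ge_atTop (3:ℝ), hv.eventually_ge_atTop 10, hv.eventually_ge_atTop (log T0)]
    with x hx3 hv10 hvT
  have hx : 0 < x := by linarith
  set v := √(log x) with hvd
  have hv2 : v * v = log x := mul_self_sqrt (log_nonneg (by linarith))
  have hv0 : 0 < v := by linarith
  have hl1 : 1 ≤ log x := by rw [← hv2]; nlinarith
  set a := 1 + 1 / log x with ha
  have hl0 : 0 < 1 / log x := by positivity
  have hl2 : 1 / log x ≤ 1 := by rw [div_le_one (by linarith)]; exact hl1
  have ha1 : 1 < a := by linarith
  have ha2 : a ≤ 2 := by linarith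
  set T := exp (20 * v) with hT
  have hlT : log T = 20 * v := log_exp _
  have hTT0 : T0 ≤ T := by
    rw [← log_le_log_iff (by linarith) (exp_pos _), hlT]; linarith
  have hT1 : 1 ≤ T := by linarith
  set σ := 1 - 5 / v with hσ
  have h5v : 5 / v ≤ 1/2 := by rw [div_le_iff₀ hv0]; linarith
  have h5v0 : 0 < 5 / v := by positivity
  have hσ2 : 1/2 ≤ σ := by linarith
  have hxa : x ^ a = e * x := by
    rw [ha, rpow_add hx, rpow_one, rpow_def_of_pos hx, mul_one_div_cancel (by linarith)]; ring
  set E := exp (-(5 * v)) with hE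
  have hE0 : 0 < E := exp_pos _
  have hxσ : x ^ σ = x * E := by
    rw [hσ, rpow_sub hx, rpow_one, div_eq_mul_inv, ← rpow_neg hx.le, rpow_def_of_pos hx, ← hv2, hE]
    congr 2; field_simp
  have hTE : T ^ (-(1/4:ℝ)) = E := by
    rw [hT, ← exp_mul, hE]; congr 1; ring
  have hreg : ∀ u t, σ ≤ u → u ≤ 2 → |t| ≤ T → riemannZeta₁ (pt u t) ≠ 0 ∧ ‖hh (pt u t)‖ ≤ A * (1 + |t|) ^ (1/2:ℝ) := by
    intro u t h1 h2 h3
    have := hP T hTT0 (pt u t) (by rwa [pt_im]) (by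
      rw [pt_re, hlT]; refine le_trans (le_of_eq ?_) h1
      rw [hσ]; congr 1; field_simp; norm_num) (by rwa [pt_re])
    rwa [pt_im] at this
  set g : ℂ → ℂ := fun s => hh s * ((x:ℂ) ^ s * (1 / (s * (s + 1)))) with hg
  have hxc : (x:ℂ) ≠ 0 := by exact_mod_cast hx.ne'
  have hgd : ∀ s : ℂ, riemannZeta₁ s ≠ 0 → 1/2 ≤ s.re → DifferentiableAt ℂ g s := by
    intro s h1 h2
    have h3 : s * (s + 1) ≠ 0 := by
      have := pt_ne h2 s.im
      have e : pt s.re s.im = s := by apply Complex.ext <;> simp [pt]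
      rwa [e] at this
    have h4 : DifferentiableAt ℂ (fun s : ℂ => (x:ℂ) ^ s) s := differentiableAt_id.const_cpow (Or.inl hxc)
    exact (hh_diff h1).mul (h4.mul ((differentiableAt_const _).div (by fun_prop) h3))
  -- decay comparison
  have hdec : ∀ t : ℝ, (1 + |t|) ^ (-(3/2:ℝ)) ≤ (1 + |t|) ^ (-(5/4:ℝ)) := fun t =>
    rpow_le_rpow_of_exponent_le (by linarith [abs_nonneg t]) (by norm_num)
  have hdecT : ∀ t : ℝ, T ≤ |t| → (1 + |t|) ^ (-(3/2:ℝ)) ≤ E * (1 + |t|) ^ (-(5/4:ℝ)) := by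
    intro t ht
    have e1 : (1 + |t|) ^ (-(3/2:ℝ)) = (1 + |t|) ^ (-(1/4:ℝ)) * (1 + |t|) ^ (-(5/4:ℝ)) := by
      rw [← rpow_add (by linarith)]; norm_num
    rw [e1, ← hTE]
    gcongr ?_ * _
    exact rpow_le_rpow_of_nonpos (by linarith) (by linarith) (by norm_num)
  have hga : ∀ t, ‖g (pt a t)‖ ≤ 9 * A * (e * x) * (1 + |t|) ^ (-(3/2:ℝ)) := by
    intro t; rw [← hxa]
    exact g_bound hx (by linarith) (hline a ha1.le ha2 t).2
  have hgi : Integrable (fun t => g (pt a t)) := by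
    refine (hJi.const_mul (9 * A * (e * x))).mono' (Continuous.aestronglyMeasurable ?_)
      (Eventually.of_forall fun t => (hga t).trans (mul_le_mul_of_nonneg_left (hdec t) (by positivity)))
    rw [continuous_iff_continuousAt]
    intro t
    exact ContinuousAt.comp (g := g) (hgd _ (hline a ha1.le ha2 t).1 (by rw [pt_re]; linarith)).continuousAt
      (pt_cont a).continuousAt
  have hsplit := integral_add_compl (μ := volume) (s := Set.Ioc (-T) T) measurableSet_Ioc hgi
  have hper := perron ha1 hx
  have tail : ‖∫ t in (Set.Ioc (-T) T)ᶜ, g (pt a t)‖ ≤ 9 * A * e * J * x * E := by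
    have hb : Integrable (fun t : ℝ => 9 * A * (e * x) * (E * (1 + |t|) ^ (-(5/4:ℝ)))) := (hJi.const_mul E).const_mul _
    refine (norm_integral_le_of_norm_le hb.integrableOn ?_).trans ?_
    · refine (ae_restrict_iff' measurableSet_Ioc.compl).2 (Eventually.of_forall fun t ht => ?_)
      refine (hga t).trans ?_
      have : T ≤ |t| := by
        by_contra h'
        have := abs_lt.1 (not_le.1 h')
        exact ht ⟨this.1, this.2.le⟩
      gcongr
      exact hdecT t this
    · refine (setIntegral_le_integral hb (Eventually.of_forall fun t => by positivity)).trans (le_of_eq ?_)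
      rw [integral_const_mul, integral_const_mul]; ring
  have left : ‖∫ t in (-T)..T, g (pt σ t)‖ ≤ 9 * A * J * x * E := by
    rw [intervalIntegral.integral_of_le (by linarith)]
    have hb : Integrable (fun t : ℝ => 9 * A * (x * E) * (1 + |t|) ^ (-(5/4:ℝ))) := hJi.const_mul _
    refine (norm_integral_le_of_norm_le hb.integrableOn ?_).trans ?_
    · refine (ae_restrict_iff' measurableSet_Ioc).2 (Eventually.of_forall fun t ht => ?_)
      have := g_bound hx hσ2 (hreg σ t le_rfl (by linarith) (abs_le.2 ⟨ht.1.le, ht.2⟩)).2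
      rw [hxσ] at this
      exact this.trans (mul_le_mul_of_nonneg_left (hdec t) (by positivity))
    · refine (setIntegral_le_integral hb (Eventually.of_forall fun t => by positivity)).trans (le_of_eq ?_)
      rw [integral_const_mul]; ring
  have horiz : ∀ τ, |τ| = T → ‖∫ u in σ..a, g (pt u τ)‖ ≤ 18 * A * e * x * E := by
    intro τ hτ
    have := intervalIntegral.norm_integral_le_of_norm_le_const (a := σ) (b := a) (f := fun u => g (pt u τ))
      (C := 9 * A * (e * x) * E) ?_
    · refine this.trans ?_
      rw [abs_of_nonneg (by linarith)]
      have : 0 ≤ 9 * A * (e * x) * E := by positivity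
      have h3 : a - σ ≤ 2 := by linarith
      have := mul_le_mul_of_nonneg_left h3 this
      linarith
    · intro u hu
      rw [Set.uIoc_of_le (by linarith)] at hu
      refine (g_bound hx (by linarith [hu.1]) (hreg u τ hu.1.le (by linarith [hu.2]) hτ.le).2).trans ?_
      have h1 : x ^ u ≤ e * x := by
        rw [← hxa]; exact rpow_le_rpow_of_exponent_le (by linarith) hu.2
      have h2 : (1 + |τ|) ^ (-(3/2:ℝ)) ≤ E := by
        refine (hdecT τ hτ.ge).trans ?_
        refine mul_le_of_le_one_right hE0.le ?_
        exact rpow_le_one_of_one_le_of_nonpos (by linarith [abs_nonneg τ]) (by norm_num)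
      gcongr
  have hrect := Complex.integral_boundary_rect_eq_zero_of_differentiableOn g (pt σ (-T)) (pt a T) (by
    intro s hs
    rw [pt_re, pt_re, pt_im, pt_im, Set.uIcc_of_le (by linarith), Set.uIcc_of_le (by linarith)] at hs
    have e : pt s.re s.im = s := by apply Complex.ext <;> simp [pt]
    have := (hreg s.re s.im hs.1.1 (by linarith [hs.1.2]) (abs_le.2 hs.2)).1
    rw [e] at this
    exact (hgd s this (by linarith [hs.1.1])).differentiableWithinAt)
  rw [pt_re, pt_re, pt_im, pt_im] at hrect
  change (∫ u in σ..a, g (pt u (-T))) - (∫ u in σ..a, g (pt u T)) + Complex.I • (∫ t in (-T)..T, g (pt a t))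
    - Complex.I • (∫ t in (-T)..T, g (pt σ t)) = 0 at hrect
  have hmain : ‖∫ t in (-T)..T, g (pt a t)‖ ≤ (9 * A * J + (18 * A * e + 18 * A * e)) * x * E := by
    have h1 := horiz (-T) (by rw [abs_neg, abs_of_pos (by linarith)])
    have h2 := horiz T (abs_of_pos (by linarith))
    have e1 : Complex.I * (∫ t in (-T)..T, g (pt a t)) = Complex.I * (∫ t in (-T)..T, g (pt σ t)) +
      ((∫ u in σ..a, g (pt u T)) - (∫ u in σ..a, g (pt u (-T)))) := by
      simp only [smul_eq_mul] at hrect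
      linear_combination hrect
    have e2 : ‖∫ t in (-T)..T, g (pt a t)‖ = ‖Complex.I * (∫ t in (-T)..T, g (pt a t))‖ := by
      rw [norm_mul, Complex.norm_I, one_mul]
    rw [e2, e1]
    refine (norm_add_le _ _).trans ?_
    have h3 := norm_sub_le (∫ u in σ..a, g (pt u T)) (∫ u in σ..a, g (pt u (-T)))
    rw [norm_mul, Complex.norm_I, one_mul]
    linarith
  rw [intervalIntegral.integral_of_le (by linarith)] at hmain
  have htot : ‖∫ t : ℝ, g (pt a t)‖ ≤ (9 * A * e * J + (9 * A * J + (18 * A * e + 18 * A * e))) * x * E := by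
    rw [← hsplit]
    refine (norm_add_le _ _).trans ?_
    linarith
  rw [hper, norm_mul, Complex.norm_real] at htot
  have hpi : ‖(2 * (π:ℂ))‖ = 2 * π := by
    rw [norm_mul, Complex.norm_real, norm_of_nonneg pi_pos.le]; simp
  rw [hpi] at htot
  have h1 : |W1 x| ≤ 2 * π * |W1 x| := le_mul_of_one_le_left (abs_nonneg _) (by linarith [pi_gt_three])
  exact h1.trans htot
end PF

namespace PF
noncomputable def DD (x : ℝ) : ℝ := ∑ n ∈ Finset.Icc 1 ⌊x⌋₊, (ArithmeticFunction.vonMangoldt n - 1)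
noncomputable def WW (x : ℝ) : ℝ := ∑ n ∈ Finset.Icc 1 ⌊x⌋₊, (ArithmeticFunction.vonMangoldt n - 1) * (x - n)

lemma WW_eq {x : ℝ} (hx : 0 < x) : WW x = x * W1 x := by
  unfold WW W1
  rw [Finset.mul_sum]
  refine Finset.sum_congr rfl fun n _ => ?_
  field_simp

lemma Icc_split {X X' : ℝ} (h : X ≤ X') (f : ℕ → ℝ) :
    ∑ n ∈ Finset.Icc 1 ⌊X'⌋₊, f n = ∑ n ∈ Finset.Icc 1 ⌊X⌋₊, f n + ∑ n ∈ Finset.Ioc ⌊X⌋₊ ⌊X'⌋₊, f n := by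
  have hf := Nat.floor_mono h
  rw [← Finset.sum_union]
  · congr 1; ext n; simp only [Finset.mem_Icc, Finset.mem_union, Finset.mem_Ioc]; omega
  · rw [Finset.disjoint_left]; intro n; simp only [Finset.mem_Icc, Finset.mem_Ioc]; omega

lemma Ioc_low {X X' : ℝ} (hX : 0 ≤ X) (h : X ≤ X') (g : ℕ → ℝ)
    (hg : ∀ n ∈ Finset.Ioc ⌊X⌋₊ ⌊X'⌋₊, 0 ≤ g n ∧ g n ≤ X' - X) :
    -((X' - X) * (X' - X + 1)) ≤ ∑ n ∈ Finset.Ioc ⌊X⌋₊ ⌊X'⌋₊, (ArithmeticFunction.vonMangoldt n - 1) * g n := by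
  have hf := Nat.floor_mono h
  have h1 : ∑ n ∈ Finset.Ioc ⌊X⌋₊ ⌊X'⌋₊, (-(X' - X)) ≤
      ∑ n ∈ Finset.Ioc ⌊X⌋₊ ⌊X'⌋₊, (ArithmeticFunction.vonMangoldt n - 1) * g n := by
    refine Finset.sum_le_sum fun n hn => ?_
    have h0 : 0 ≤ ArithmeticFunction.vonMangoldt n := ArithmeticFunction.vonMangoldt_nonneg
    have := mul_nonneg h0 (hg n hn).1
    linarith [(hg n hn).2]
  refine le_trans ?_ h1
  rw [Finset.sum_const, Nat.card_Ioc, nsmul_eq_mul, Nat.cast_sub hf]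
  have h2 := Nat.floor_le (hX.trans h)
  have h3 := Nat.lt_floor_add_one X
  have : ((⌊X'⌋₊:ℝ) - ⌊X⌋₊) * (X' - X) ≤ (X' - X + 1) * (X' - X) :=
    mul_le_mul_of_nonneg_right (by linarith) (by linarith)
  linarith

lemma WW_up {X X' : ℝ} (hX : 0 ≤ X) (h : X ≤ X') :
    (X' - X) * DD X ≤ WW X' - WW X + (X' - X) * (X' - X + 1) := by
  have := Ioc_low hX h (fun n => X' - n) (fun n hn => by
    rw [Finset.mem_Ioc] at hn
    have h1 := (Nat.le_floor_iff (hX.trans h)).1 hn.2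
    have h2 := (Nat.floor_lt hX).1 hn.1
    constructor <;> linarith)
  unfold WW DD
  rw [Icc_split h, Finset.mul_sum]
  have e : ∑ n ∈ Finset.Icc 1 ⌊X⌋₊, (ArithmeticFunction.vonMangoldt n - 1) * (X' - n) =
    ∑ n ∈ Finset.Icc 1 ⌊X⌋₊, (X' - X) * (ArithmeticFunction.vonMangoldt n - 1)
     + ∑ n ∈ Finset.Icc 1 ⌊X⌋₊, (ArithmeticFunction.vonMangoldt n - 1) * (X - n) := by
    rw [← Finset.sum_add_distrib]; exact Finset.sum_congr rfl fun n _ => by ring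
  linarith

lemma WW_lo {X X' : ℝ} (hX : 0 ≤ X) (h : X ≤ X') :
    WW X' - WW X - (X' - X) * (X' - X + 1) ≤ (X' - X) * DD X' := by
  have := Ioc_low hX h (fun n => n - X) (fun n hn => by
    rw [Finset.mem_Ioc] at hn
    have h1 := (Nat.le_floor_iff (hX.trans h)).1 hn.2
    have h2 := (Nat.floor_lt hX).1 hn.1
    constructor <;> linarith)
  unfold WW DD
  rw [Icc_split h, Icc_split h, mul_add (X' - X) (∑ n ∈ Finset.Icc 1 ⌊X⌋₊, (ArithmeticFunction.vonMangoldt n - 1)), Finset.mul_sum, Finset.mul_sum]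
  have e : ∑ n ∈ Finset.Icc 1 ⌊X⌋₊, (ArithmeticFunction.vonMangoldt n - 1) * (X' - n) =
    ∑ n ∈ Finset.Icc 1 ⌊X⌋₊, (X' - X) * (ArithmeticFunction.vonMangoldt n - 1)
     + ∑ n ∈ Finset.Icc 1 ⌊X⌋₊, (ArithmeticFunction.vonMangoldt n - 1) * (X - n) := by
    rw [← Finset.sum_add_distrib]; exact Finset.sum_congr rfl fun n _ => by ring
  have e2 : ∑ n ∈ Finset.Ioc ⌊X⌋₊ ⌊X'⌋₊, (ArithmeticFunction.vonMangoldt n - 1) * (X' - n) =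
    ∑ n ∈ Finset.Ioc ⌊X⌋₊ ⌊X'⌋₊, (X' - X) * (ArithmeticFunction.vonMangoldt n - 1)
     - ∑ n ∈ Finset.Ioc ⌊X⌋₊ ⌊X'⌋₊, (ArithmeticFunction.vonMangoldt n - 1) * (n - X) := by
    rw [← Finset.sum_sub_distrib]; exact Finset.sum_congr rfl fun n _ => by ring
  linarith

lemma DD_bound : ∃ C : ℝ, 0 < C ∧ ∀ᶠ x : ℝ in atTop, |DD x| ≤ C * x * exp (-(2 * √(log x))) := by
  obtain ⟨C, hC, h⟩ := W1_bound
  obtain ⟨X0, hX0⟩ := eventually_atTop.1 h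
  refine ⟨8 * C * exp 5 + 2, by positivity, ?_⟩
  filter_upwards [eventually_ge_atTop (2 * max X0 1), eventually_ge_atTop (exp 9)] with x hx hx9
  have hxX : 2 * X0 ≤ x := by linarith [le_max_left X0 1]
  have hx1 : 2 ≤ x := by linarith [le_max_right X0 1]
  have hL : 9 ≤ log x := by rwa [le_log_iff_exp_le (by linarith)]
  set s := √(log x) with hs
  have hss : s * s = log x := mul_self_sqrt (by linarith)
  have hs3 : 3 ≤ s := by rw [hs]; exact le_sqrt_of_sq_le (by linarith)
  have hxe : x = exp (s * s) := by rw [hss, exp_log (by linarith)]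
  have key : ∀ X, x / 2 ≤ X → X ≤ 2 * x → |WW X| ≤ 4 * C * exp 5 * (x * x * exp (-(5 * s))) := by
    intro X h1 h2
    have hXp : 0 < X := by linarith
    rw [WW_eq hXp, abs_mul, abs_of_pos hXp]
    have hb := hX0 X (by linarith)
    have hlog : log x ≤ log X + 1 := by
      have : log x ≤ log (2 * X) := log_le_log (by linarith) (by linarith)
      rw [log_mul (by norm_num) hXp.ne'] at this
      linarith [log_two_lt_d9]
    have hsq : s - 1 ≤ √(log X) := by
      apply le_sqrt_of_sq_le; nlinarith
    calc X * |W1 X| ≤ X * (C * X * exp (-(5 * √(log X)))) := by gcongr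
      _ ≤ (2 * x) * (C * (2 * x) * exp (5 + -(5 * s))) := by
        gcongr; linarith
      _ = _ := by rw [exp_add]; ring
  set E := exp (-(5/2 * s)) with hE
  have hEE : E * E = exp (-(5 * s)) := by rw [hE, ← exp_add]; congr 1; ring
  have hEp : 0 < E := exp_pos _
  have hE2 : E ≤ exp (-(2 * s)) := exp_le_exp.2 (by linarith)
  have hE12 : E ≤ 1 / 2 := by
    have : E ≤ exp (-1) := exp_le_exp.2 (by linarith)
    linarith [exp_neg_one_lt_d9]
  set H := x * E with hH
  have hHp : 0 < H := by positivity
  have hHx : H ≤ x / 2 := by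
    have := mul_le_mul_of_nonneg_left hE12 (by linarith : 0 ≤ x); linarith
  have hH1 : 1 ≤ H := by
    rw [hH, hE]; nth_rw 1 [hxe]; rw [← exp_add]
    exact one_le_exp (by nlinarith)
  have u := WW_up (X := x) (X' := x + H) (by linarith) (by linarith)
  have l := WW_lo (X := x - H) (X' := x) (by linarith) (by linarith)
  have k0 := abs_le.1 (key x (by linarith) (by linarith))
  have k1 := abs_le.1 (key (x + H) (by linarith) (by linarith))
  have k2 := abs_le.1 (key (x - H) (by linarith) (by linarith))
  have hq : x * x * exp (-(5 * s)) = H * (x * E) := by rw [← hEE, hH]; ring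
  rw [hq] at k0 k1 k2
  rw [show x + H - x = H by ring] at u
  rw [show x - (x - H) = H by ring] at l
  have e1 : H * DD x ≤ H * ((8 * C * exp 5 + 2) * (x * E)) := by
    have : H * (H + 1) ≤ H * (2 * (x * E)) := mul_le_mul_of_nonneg_left (by linarith) hHp.le
    linarith
  have e2 : H * (-((8 * C * exp 5 + 2) * (x * E))) ≤ H * DD x := by
    have : H * (H + 1) ≤ H * (2 * (x * E)) := mul_le_mul_of_nonneg_left (by linarith) hHp.le
    linarith
  have e1' := le_of_mul_le_mul_left e1 hHp
  have e2' := le_of_mul_le_mul_left e2 hHp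
  refine (abs_le.2 ⟨e2', e1'⟩).trans ?_
  rw [mul_assoc _ x]
  exact mul_le_mul_of_nonneg_left (mul_le_mul_of_nonneg_left hE2 (by linarith : 0 ≤ x)) (by positivity)

/-- `z * exp(-2 sqrt(log z))` -/
noncomputable def RR (z : ℝ) : ℝ := z * exp (-(2 * √(log z)))

lemma RR_eq {z : ℝ} (hz : 1 ≤ z) : RR z = exp (√(log z) * √(log z) - 2 * √(log z)) := by
  rw [mul_self_sqrt (log_nonneg hz), RR, sub_eq_add_neg, exp_add, exp_log (by linarith)]

lemma RR_low {z : ℝ} (hz : 1 ≤ z) : exp (-1) ≤ RR z := by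
  rw [RR_eq hz]; apply exp_le_exp.2; nlinarith [sq_nonneg (√(log z) - 1)]

lemma RR_mono {y z : ℝ} (hy : 1 ≤ y) (hz : y ≤ z) : RR y ≤ exp 1 * RR z := by
  rw [RR_eq hy, RR_eq (hy.trans hz), ← exp_add]
  apply exp_le_exp.2
  have : √(log y) ≤ √(log z) := sqrt_le_sqrt (log_le_log (by linarith) hz)
  have h0 := sqrt_nonneg (log y)
  set a := √(log y)
  set b := √(log z)
  rcases le_total a 2 with h | h
  · nlinarith [sq_nonneg (b - 1), mul_nonneg h0 (by linarith : 0 ≤ 2 - a)]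
  · nlinarith [mul_nonneg (by linarith : 0 ≤ b - a) (by linarith : 0 ≤ a + b - 2)]

lemma psi_bound : ∃ C : ℝ, 0 < C ∧ ∀ z : ℝ, 1 ≤ z → |Chebyshev.psi z - z| ≤ C * RR z := by
  obtain ⟨C, hC, h⟩ := DD_bound
  obtain ⟨X0, hX0⟩ := eventually_atTop.1 h
  have hpsi : ∀ z, DD z = Chebyshev.psi z - ⌊z⌋₊ := by
    intro z
    rw [DD, Chebyshev.psi, Finset.sum_sub_distrib]
    have : Finset.Icc 1 ⌊z⌋₊ = Finset.Ioc 0 ⌊z⌋₊ := by ext; simp [Nat.succ_le_iff]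
    rw [this]; simp
  have he : exp 1 * exp (-1) = 1 := by rw [← exp_add]; norm_num
  refine ⟨C + exp 1 + exp 1 * (Chebyshev.psi X0 + |X0|), by
    have := Chebyshev.psi_nonneg X0; positivity, fun z hz => ?_⟩
  have hR := RR_low hz
  have hR' : 1 ≤ exp 1 * RR z := by 
    calc 1 = _ := he.symm
      _ ≤ _ := by gcongr
  have hRp : 0 < RR z := (exp_pos _).trans_le hR
  have hp0 := Chebyshev.psi_nonneg X0
  rcases le_total X0 z with h1 | h1
  · have h2 := abs_le.1 (hX0 z h1)
    rw [hpsi, mul_assoc] at h2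
    have h3 := Nat.floor_le (by linarith : 0 ≤ z)
    have h4 := Nat.lt_floor_add_one z
    have : 0 ≤ exp 1 * (Chebyshev.psi X0 + |X0|) * RR z := by positivity
    have h5 : C * (z * exp (-(2 * √(log z)))) = C * RR z := rfl
    rw [h5] at h2
    rw [abs_le]; constructor <;> linarith
  · have h2 := Chebyshev.psi_mono h1
    have h3 := Chebyshev.psi_nonneg z
    have h4 : z ≤ |X0| := h1.trans (le_abs_self _)
    have : (Chebyshev.psi X0 + |X0|) * 1 ≤ (Chebyshev.psi X0 + |X0|) * (exp 1 * RR z) := by gcongr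
    have h5 : 0 ≤ (C + exp 1) * RR z := by positivity
    rw [abs_le]; constructor <;> linarith

lemma psith_bound : ∃ C : ℝ, 0 < C ∧ ∀ z : ℝ, 1 ≤ z → Chebyshev.psi z - Chebyshev.theta z ≤ C * RR z := by
  refine ⟨4 * exp (9/2), by positivity, fun z hz => (Chebyshev.psi_sub_theta_le hz).trans ?_⟩
  rw [RR_eq hz]
  have hl : √(log z) * √(log z) = log z := mul_self_sqrt (log_nonneg hz)
  have h0 := sqrt_nonneg (log z)
  have hz2 : √z = exp (√(log z) * √(log z) / 2) := by
    rw [hl, sqrt_eq_rpow, rpow_def_of_pos (by linarith)]; congr 1; ring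
  rw [hz2]
  nth_rw 3 [← hl]
  clear hz2 hl
  generalize √(log z) = s at *
  have h1 : s * s ≤ 2 * exp s := by
    have := quadratic_le_exp_of_nonneg h0; nlinarith
  calc 2 * exp (s * s / 2) * (s * s) ≤ 2 * exp (s * s / 2) * (2 * exp s) := by gcongr
    _ = 4 * exp (s * s / 2 + s) := by rw [exp_add]; ring
    _ ≤ 4 * exp (9 / 2 + (s * s - 2 * s)) := by
      gcongr 4 * exp ?_; nlinarith [sq_nonneg (s - 3)]
    _ = 4 * exp (9 / 2) * exp (s * s - 2 * s) := by rw [exp_add (9/2)]; ring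

noncomputable def psiy (y z : ℝ) : ℝ :=
  ∑ n ∈ (Finset.Icc 1 ⌊z⌋₊).filter (fun n => y < (n.minFac : ℝ)), ArithmeticFunction.vonMangoldt n

lemma psiy_zero {y z : ℝ} (hy : 0 ≤ y) (hz : z ≤ y) : psiy y z = 0 := by
  unfold psiy
  rw [Finset.filter_eq_empty_iff.2, Finset.sum_empty]
  intro n hn
  rw [Finset.mem_Icc] at hn
  have h1 : (n.minFac : ℝ) ≤ n := by exact_mod_cast Nat.minFac_le (by omega)
  have h2 : (n : ℝ) ≤ y := (Nat.cast_le.2 hn.2).trans ((Nat.floor_le_floor hz |> Nat.cast_le.2).trans (Nat.floor_le hy))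
  linarith

lemma psiy_sand {y z : ℝ} (hy : 0 ≤ y) (hz : y ≤ z) :
    Chebyshev.theta z - Chebyshev.theta y ≤ psiy y z ∧
    psiy y z ≤ Chebyshev.psi z - Chebyshev.theta y := by
  have hfl := Nat.floor_mono hz
  have hpr : ∀ n : ℕ, n.Prime → ArithmeticFunction.vonMangoldt n = log n := fun n hn =>
    ArithmeticFunction.vonMangoldt_apply_prime hn
  constructor
  · rw [sub_le_iff_le_add, Chebyshev.theta, Chebyshev.theta, psiy]
    have hd : Disjoint ((Finset.Ioc 0 ⌊z⌋₊).filter (fun n : ℕ => n.Prime ∧ y < (n:ℝ))) ((Finset.Ioc 0 ⌊y⌋₊).filter Nat.Prime) := by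
      rw [Finset.disjoint_left]; intro n h1 h2
      rw [Finset.mem_filter, Finset.mem_Ioc] at h1 h2
      have := (Nat.le_floor_iff hy).1 h2.1.2
      linarith [h1.2.2]
    have hu : (Finset.Ioc 0 ⌊z⌋₊).filter Nat.Prime = ((Finset.Ioc 0 ⌊z⌋₊).filter (fun n : ℕ => n.Prime ∧ y < (n:ℝ))) ∪ ((Finset.Ioc 0 ⌊y⌋₊).filter Nat.Prime) := by
      ext n
      simp only [Finset.mem_union, Finset.mem_filter, Finset.mem_Ioc]
      constructor
      · rintro ⟨⟨a, b⟩, c⟩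
        rcases lt_or_ge y (n:ℝ) with h | h
        · exact Or.inl ⟨⟨a, b⟩, c, h⟩
        · exact Or.inr ⟨⟨a, Nat.le_floor h⟩, c⟩
      · rintro (⟨⟨a, b⟩, c, d⟩ | ⟨⟨a, b⟩, c⟩)
        · exact ⟨⟨a, b⟩, c⟩
        · exact ⟨⟨a, b.trans hfl⟩, c⟩
    rw [hu, Finset.sum_union hd]
    gcongr ?_ + _
    rw [Finset.sum_congr rfl fun n hn => (hpr n (Finset.mem_filter.1 hn).2.1).symm]
    refine Finset.sum_le_sum_of_subset_of_nonneg (fun n hn => ?_) (fun n _ _ => ArithmeticFunction.vonMangoldt_nonneg)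
    rw [Finset.mem_filter, Finset.mem_Ioc] at hn
    rw [Finset.mem_filter, Finset.mem_Icc, hn.2.1.minFac_eq]
    exact ⟨⟨hn.1.1, hn.1.2⟩, hn.2.2⟩
  · rw [le_sub_iff_add_le, Chebyshev.theta, Chebyshev.psi, psiy]
    rw [Finset.sum_congr rfl fun n hn => (hpr n (Finset.mem_filter.1 hn).2).symm]
    rw [← Finset.sum_union]
    · refine Finset.sum_le_sum_of_subset_of_nonneg (fun n hn => ?_) (fun n _ _ => ArithmeticFunction.vonMangoldt_nonneg)
      simp only [Finset.mem_union, Finset.mem_filter, Finset.mem_Ioc, Finset.mem_Icc] at hn ⊢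
      rcases hn with h | h
      · exact ⟨h.1.1, h.1.2⟩
      · exact ⟨h.1.1, h.1.2.trans hfl⟩
    · rw [Finset.disjoint_left]; intro n h1 h2
      rw [Finset.mem_filter] at h1 h2
      rw [h2.2.minFac_eq] at h1
      have := (Nat.le_floor_iff hy).1 (Finset.mem_Ioc.1 h2.1).2
      linarith [h1.2]

lemma psiy_bound : ∃ C : ℝ, 0 < C ∧ ∀ y z : ℝ, 1 ≤ y → y ≤ z → |psiy y z - (z - y)| ≤ C * RR z := by
  obtain ⟨A, hA, hpsi⟩ := psi_bound
  obtain ⟨B, hB, hth⟩ := psith_bound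
  refine ⟨(A + B) * (1 + exp 1), by positivity, fun y z hy hz => ?_⟩
  have s := psiy_sand (by linarith) hz
  have a1 := abs_le.1 (hpsi z (hy.trans hz))
  have a2 := abs_le.1 (hpsi y hy)
  have b1 := hth z (hy.trans hz)
  have b2 := hth y hy
  have b3 := Chebyshev.theta_le_psi y
  have m := RR_mono hy hz
  have m1 : (A + B) * RR y ≤ (A + B) * (exp 1 * RR z) := by gcongr
  have r0 : 0 ≤ RR y := (exp_pos _).le.trans (RR_low hy)
  have r1 : 0 ≤ RR z := (exp_pos _).le.trans (RR_low (hy.trans hz))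
  have : 0 ≤ B * RR y := by positivity
  have : 0 ≤ B * RR z := by positivity
  rw [abs_le]; constructor <;> linarith
end PF

namespace PF
noncomputable def aa (k : ℕ) (y : ℝ) : ArithmeticFunction ℝ where
  toFun n := if n ≠ 0 ∧ (n = 1 ∨ y < (n.minFac : ℝ)) then (n.divisors.card : ℝ) ^ k else 0
  map_zero' := by simp

noncomputable def Lamy (y : ℝ) : ArithmeticFunction ℝ where
  toFun n := if n ≠ 0 ∧ y < (n.minFac : ℝ) then ArithmeticFunction.vonMangoldt n else 0
  map_zero' := by simp

noncomputable def FF (k : ℕ) (y x : ℝ) : ℝ := ∑ n ∈ Finset.Icc 0 ⌊x⌋₊, aa k y n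

lemma aa_apply (k : ℕ) (y : ℝ) (n : ℕ) :
    aa k y n = if n ≠ 0 ∧ (n = 1 ∨ y < (n.minFac : ℝ)) then (n.divisors.card : ℝ) ^ k else 0 := rfl

lemma Lamy_apply (y : ℝ) (n : ℕ) :
    Lamy y n = if n ≠ 0 ∧ y < (n.minFac : ℝ) then ArithmeticFunction.vonMangoldt n else 0 := rfl

lemma Icc0_eq (f : ArithmeticFunction ℝ) (N : ℕ) : ∑ n ∈ Finset.Icc 0 N, f n = ∑ n ∈ Finset.Ioc 0 N, f n := by
  rw [Finset.Icc_eq_cons_Ioc (Nat.zero_le _), Finset.sum_cons]; simp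

lemma Icc1_eq (N : ℕ) : Finset.Icc 1 N = Finset.Ioc 0 N := by
  ext; simp [Nat.succ_le_iff]

lemma aa_nonneg (k : ℕ) (y : ℝ) (n : ℕ) : 0 ≤ aa k y n := by
  rw [aa_apply]; split_ifs <;> positivity

lemma aa_le (k : ℕ) (y : ℝ) (n : ℕ) : aa k y n ≤ (n.divisors.card : ℝ) ^ k := by
  rw [aa_apply]; split_ifs
  · exact le_rfl
  · positivity

lemma FF_nonneg (k : ℕ) (y x : ℝ) : 0 ≤ FF k y x := Finset.sum_nonneg fun n _ => aa_nonneg k y n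

lemma psiy_eq (y z : ℝ) : psiy y z = ∑ n ∈ Finset.Ioc 0 ⌊z⌋₊, Lamy y n := by
  unfold psiy
  rw [Finset.sum_filter, Icc1_eq]
  refine Finset.sum_congr rfl fun n hn => ?_
  have : n ≠ 0 := by have := (Finset.mem_Ioc.1 hn).1; omega
  rw [Lamy_apply]; simp [this]

lemma tau_log {k : ℕ} (hk : k ≤ 1) (n : ℕ) :
    ((n.divisors.card : ℝ)) ^ k * log n =
      (k + 1) * ∑ p ∈ n.divisorsAntidiagonal, ((p.1.divisors.card : ℝ)) ^ k * ArithmeticFunction.vonMangoldt p.2 := by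
  interval_cases k
  · simp only [pow_zero, one_mul, Nat.cast_zero, zero_add]
    rw [Nat.sum_divisorsAntidiagonal' (f := fun _ j => ArithmeticFunction.vonMangoldt j)]
    exact ArithmeticFunction.vonMangoldt_sum.symm
  · have h1 : ∑ p ∈ n.divisorsAntidiagonal, ((p.1.divisors.card : ℝ)) ^ 1 * ArithmeticFunction.vonMangoldt p.2
      = ∑ d ∈ n.divisors, log d := by
      have e1 : ((ArithmeticFunction.zeta : ArithmeticFunction ℝ) * ArithmeticFunction.zeta * ArithmeticFunction.vonMangoldt) n
          = ((ArithmeticFunction.zeta : ArithmeticFunction ℝ) * ArithmeticFunction.log) n := by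
        rw [mul_assoc, ArithmeticFunction.zeta_mul_vonMangoldt]
      rw [ArithmeticFunction.coe_zeta_mul_apply, ArithmeticFunction.mul_apply] at e1
      refine Eq.trans (Finset.sum_congr rfl fun p _ => ?_) e1
      rw [ArithmeticFunction.coe_zeta_mul_apply, pow_one]
      congr 1
      rw [Finset.card_eq_sum_ones, Nat.cast_sum]
      refine Finset.sum_congr rfl fun d hd => ?_
      simp [(Nat.pos_of_mem_divisors hd).ne']
    have h2 : ∑ d ∈ n.divisors, log (n / d : ℕ) = ∑ d ∈ n.divisors, log d :=
      Nat.sum_div_divisors n (fun d => log d)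
    have h3 : ∑ d ∈ n.divisors, log (n / d : ℕ) + ∑ d ∈ n.divisors, log d = n.divisors.card * log n := by
      rw [← Finset.sum_add_distrib, ← nsmul_eq_mul, ← Finset.sum_const]
      refine Finset.sum_congr rfl fun d hd => ?_
      rw [Nat.mem_divisors] at hd
      have hd0 : d ≠ 0 := ne_zero_of_dvd_ne_zero hd.2 hd.1
      have hd1 : n / d ≠ 0 := (Nat.div_pos (Nat.le_of_dvd (Nat.pos_of_ne_zero hd.2) hd.1) (Nat.pos_of_ne_zero hd0)).ne'
      rw [← log_mul (by exact_mod_cast hd1) (by exact_mod_cast hd0)]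
      congr 1
      exact_mod_cast Nat.div_mul_cancel hd.1
    rw [h1, pow_one, ← h3, h2]; push_cast; ring

lemma aa_log {k : ℕ} (hk : k ≤ 1) (y : ℝ) (n : ℕ) :
    aa k y n * log n = (k + 1) * (aa k y * Lamy y) n := by
  rw [ArithmeticFunction.mul_apply]
  rcases eq_or_ne n 0 with rfl | hn0
  · simp
  by_cases hn : n = 1 ∨ y < (n.minFac : ℝ)
  · rw [aa_apply, if_pos ⟨hn0, hn⟩, tau_log hk]
    congr 1
    refine Finset.sum_congr rfl fun p hp => ?_
    obtain ⟨hp1, -⟩ := Nat.mem_divisorsAntidiagonal.1 hp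
    have hd1 : p.1 ∣ n := ⟨p.2, hp1.symm⟩
    have hd2 : p.2 ∣ n := ⟨p.1, by rw [← hp1, mul_comm]⟩
    have key : ∀ d, d ∣ n → d ≠ 1 → y < (d.minFac : ℝ) := by
      intro d hd hdn
      rcases hn with rfl | hn
      · exact absurd (Nat.dvd_one.1 hd) hdn
      · exact hn.trans_le (by exact_mod_cast Nat.minFac_le_of_dvd (Nat.minFac_prime hdn).two_le ((Nat.minFac_dvd d).trans hd))
    rw [aa_apply, Lamy_apply, if_pos]
    · rcases eq_or_ne p.2 1 with h2 | h2
      · simp [h2]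
      · rw [if_pos ⟨ne_zero_of_dvd_ne_zero hn0 hd2, key _ hd2 h2⟩]
    · refine ⟨ne_zero_of_dvd_ne_zero hn0 hd1, ?_⟩
      by_cases h1 : p.1 = 1
      · exact Or.inl h1
      · exact Or.inr (key _ hd1 h1)
  · rw [aa_apply, if_neg (fun h => hn h.2), zero_mul, Finset.sum_eq_zero, mul_zero]
    intro p hp
    obtain ⟨hp1, -⟩ := Nat.mem_divisorsAntidiagonal.1 hp
    by_contra hne
    have h1 := left_ne_zero_of_mul hne
    have h2 := right_ne_zero_of_mul hne
    rw [aa_apply] at h1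
    rw [Lamy_apply] at h2
    have h1' := (ite_ne_right_iff.1 h1).1
    have h2' := (ite_ne_right_iff.1 h2).1
    push Not at hn
    have hpr := Nat.minFac_prime hn.1
    have hdv := Nat.minFac_dvd n
    nth_rw 2 [← hp1] at hdv
    rcases (Nat.Prime.dvd_mul hpr).1 hdv with h | h
    · have hle : p.1.minFac ≤ n.minFac := Nat.minFac_le_of_dvd hpr.two_le h
      rcases h1'.2 with h3 | h3
      · rw [h3] at h; exact hpr.one_lt.ne' (Nat.dvd_one.1 h)
      · have : (p.1.minFac : ℝ) ≤ n.minFac := by exact_mod_cast hle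
        linarith [hn.2]
    · have hle : p.2.minFac ≤ n.minFac := Nat.minFac_le_of_dvd hpr.two_le h
      have : (p.2.minFac : ℝ) ≤ n.minFac := by exact_mod_cast hle
      linarith [hn.2, h2'.2]

lemma sum_aa_log {k : ℕ} (hk : k ≤ 1) (y : ℝ) {x : ℝ} :
    ∑ n ∈ Finset.Icc 0 ⌊x⌋₊, log n * aa k y n =
      (k + 1) * ∑ m ∈ Finset.Ioc 0 ⌊x⌋₊, aa k y m * psiy y (x / m) := by
  rw [Finset.Icc_eq_cons_Ioc (Nat.zero_le _), Finset.sum_cons, ArithmeticFunction.map_zero, mul_zero, zero_add]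
  rw [Finset.sum_congr rfl (fun n _ => (mul_comm _ _).trans (aa_log hk y n)), ← Finset.mul_sum,
    ArithmeticFunction.sum_Ioc_mul_eq_sum_sum]
  congr 1
  refine Finset.sum_congr rfl fun m _ => ?_
  rw [psiy_eq, Nat.floor_div_natCast]

/-- trivial bound -/
lemma triv {k : ℕ} (hk : k ≤ 1) {z : ℝ} (hz : 1 ≤ z) :
    ∑ n ∈ Finset.Ioc 0 ⌊z⌋₊, (n.divisors.card : ℝ) ^ k ≤ z * (1 + log z) ^ k := by
  interval_cases k
  · simp [Nat.floor_le (by linarith : 0 ≤ z)]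
  · simp only [pow_one]
    have h := ArithmeticFunction.sum_Ioc_sigma0_eq_sum_div ⌊z⌋₊
    have h1 : ∑ n ∈ Finset.Ioc 0 ⌊z⌋₊, (n.divisors.card : ℝ) = ((∑ n ∈ Finset.Ioc 0 ⌊z⌋₊, (⌊z⌋₊ / n) : ℕ) : ℝ) := by
      rw [← h]; push_cast; simp [ArithmeticFunction.sigma_zero_apply]
    rw [h1]; push_cast
    calc ∑ n ∈ Finset.Ioc 0 ⌊z⌋₊, ((⌊z⌋₊ / n : ℕ) : ℝ) ≤ ∑ n ∈ Finset.Ioc 0 ⌊z⌋₊, z * (n:ℝ)⁻¹ := by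
          refine Finset.sum_le_sum fun n _ => Nat.cast_div_le.trans ?_
          rw [div_eq_mul_inv]
          gcongr
          exact Nat.floor_le (by linarith)
      _ = z * (harmonic ⌊z⌋₊ : ℝ) := by
          rw [← Finset.mul_sum, harmonic_eq_sum_Icc, Icc1_eq]; push_cast; rfl
      _ ≤ _ := by gcongr; exact harmonic_floor_le_one_add_log z hz

lemma FF_triv {k : ℕ} (hk : k ≤ 1) (y : ℝ) {z : ℝ} (hz : 1 ≤ z) : FF k y z ≤ z * (1 + log z) ^ k := by
  refine le_trans ?_ (triv hk hz)
  rw [FF, Icc0_eq]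
  exact Finset.sum_le_sum fun n _ => aa_le k y n
end PF

namespace PF
lemma summ_sqrt : Summable (fun j : ℕ => exp (-(1/2 * √(j:ℝ)))) := by
  rw [← summable_nat_add_iff 1]
  have h : Summable (fun j : ℕ => 384 * (1 / ((j + 1 : ℕ) : ℝ) ^ 2)) :=
    ((summable_nat_add_iff 1).2 (summable_one_div_nat_pow.2 (by norm_num : 1 < 2))).mul_left 384
  refine Summable.of_nonneg_of_le (fun j => (exp_pos _).le) (fun j => ?_) h
  have hj : (0:ℝ) < ((j + 1 : ℕ) : ℝ) := by positivity
  set r : ℝ := ((j + 1 : ℕ) : ℝ)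
  have h1 := pow_div_factorial_le_exp (1/2 * √r) (by positivity) 4
  have h2 : (1/2 * √r) ^ 4 = r ^ 2 / 16 := by
    have : √r ^ 2 = r := sq_sqrt hj.le
    calc (1/2 * √r) ^ 4 = (√r ^ 2) ^ 2 / 16 := by ring
      _ = _ := by rw [this]
  rw [h2] at h1
  rw [exp_neg, show 384 * (1 / r ^ 2) = (r ^ 2 / 16 / (Nat.factorial 4 : ℝ))⁻¹ by
    simp [Nat.factorial]; field_simp; norm_num]
  exact inv_anti₀ (by positivity) h1

lemma blockE : ∃ B : ℝ, 0 < B ∧ ∀ k ≤ 1, ∀ x : ℝ, 1 ≤ x →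
    ∑ m ∈ Finset.Ioc 0 ⌊x⌋₊, (m.divisors.card : ℝ) ^ k / m * exp (-(1/2 * √(log (x / m)))) ≤
      B * (1 + log x) ^ k := by
  refine ⟨exp 1 * (∑' j : ℕ, exp (-(1/2 * √(j:ℝ)))), mul_pos (exp_pos _)
    (summ_sqrt.tsum_pos (fun j => (exp_pos _).le) 0 (exp_pos _)), fun k hk x hx => ?_⟩
  have hlx := log_nonneg hx
  have hxp : 0 < x := by linarith
  rw [← Finset.sum_fiberwise_of_maps_to (s := Finset.Ioc 0 ⌊x⌋₊) (t := Finset.range (⌊log x⌋₊ + 1))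
    (g := fun m : ℕ => ⌊log (x / m)⌋₊)]
  · calc _ ≤ ∑ j ∈ Finset.range (⌊log x⌋₊ + 1), (exp 1 * (1 + log x) ^ k) * exp (-(1/2 * √(j:ℝ))) := by
          refine Finset.sum_le_sum fun j hj => ?_
          have hj' : (j : ℝ) ≤ log x := (Nat.le_floor_iff hlx).1 (Nat.lt_succ_iff.1 (Finset.mem_range.1 hj))
          set z := x * exp (-j) with hz
          have hz1 : 1 ≤ z := by
            rw [hz, ← exp_log hxp, ← exp_add]; exact one_le_exp (by simpa using hj')
          calc _ ≤ ∑ m ∈ Finset.Ioc 0 ⌊x⌋₊ with ⌊log (x / (m:ℕ))⌋₊ = j,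
                (m.divisors.card : ℝ) ^ k * (exp (j + 1) / x * exp (-(1/2 * √(j:ℝ)))) := by
                refine Finset.sum_le_sum fun m hm => ?_
                rw [Finset.mem_filter, Finset.mem_Ioc] at hm
                have hm0 : (0:ℝ) < m := by exact_mod_cast hm.1.1
                have hmx : (m:ℝ) ≤ x := (Nat.le_floor_iff hxp.le).1 hm.1.2
                have hlog0 : 0 ≤ log (x / m) := log_nonneg (by rwa [le_div_iff₀ hm0, one_mul])
                have h1 : (j:ℝ) ≤ log (x / m) := by rw [← hm.2]; exact Nat.floor_le hlog0
                have h2 : log (x / m) < j + 1 := by rw [← hm.2]; exact Nat.lt_floor_add_one _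
                rw [log_lt_iff_lt_exp (by positivity), div_lt_iff₀ hm0] at h2
                rw [div_eq_mul_inv, mul_assoc]
                gcongr
                rw [inv_eq_one_div, div_le_div_iff₀ hm0 hxp]; linarith
            _ ≤ ∑ m ∈ Finset.Ioc 0 ⌊z⌋₊,
                (m.divisors.card : ℝ) ^ k * (exp (j + 1) / x * exp (-(1/2 * √(j:ℝ)))) := by
                refine Finset.sum_le_sum_of_subset_of_nonneg (fun m hm => ?_) (fun _ _ _ => by positivity)
                rw [Finset.mem_filter, Finset.mem_Ioc] at hm
                have hm0 : (0:ℝ) < m := by exact_mod_cast hm.1.1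
                have hmx : (m:ℝ) ≤ x := (Nat.le_floor_iff hxp.le).1 hm.1.2
                have hlog0 : 0 ≤ log (x / m) := log_nonneg (by rwa [le_div_iff₀ hm0, one_mul])
                have h1 : (j:ℝ) ≤ log (x / m) := by rw [← hm.2]; exact Nat.floor_le hlog0
                rw [Finset.mem_Ioc]
                refine ⟨hm.1.1, Nat.le_floor ?_⟩
                rw [le_log_iff_exp_le (by positivity), le_div_iff₀ hm0] at h1
                rw [hz, exp_neg, ← div_eq_mul_inv, le_div_iff₀ (exp_pos _)]; linarith
            _ ≤ z * (1 + log z) ^ k * (exp (j + 1) / x * exp (-(1/2 * √(j:ℝ)))) := by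
                rw [← Finset.sum_mul]
                exact mul_le_mul_of_nonneg_right (triv hk hz1) (by positivity)
            _ ≤ z * (1 + log x) ^ k * (exp (j + 1) / x * exp (-(1/2 * √(j:ℝ)))) := by
                have hzx : z ≤ x := by
                  rw [hz]; exact mul_le_of_le_one_right hxp.le (exp_le_one_iff.2 (by simp))
                have hl1 := log_nonneg hz1
                have hl2 := log_le_log (by linarith) hzx
                gcongr
            _ = _ := by
                have : exp (-(j:ℝ)) * exp (j + 1) = exp 1 := by rw [← exp_add]; congr 1; ring
                rw [hz, ← this]; field_simp
      _ ≤ _ := by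
          rw [← Finset.mul_sum]
          have := summ_sqrt.sum_le_tsum (Finset.range (⌊log x⌋₊ + 1)) (fun j _ => (exp_pos _).le)
          calc _ ≤ (exp 1 * (1 + log x) ^ k) * (∑' j : ℕ, exp (-(1/2 * √(j:ℝ)))) := by gcongr
            _ = _ := by ring
  · intro m hm
    rw [Finset.mem_Ioc] at hm
    rw [Finset.mem_range, Nat.lt_succ_iff]
    apply Nat.floor_mono
    have hm1 : (1:ℝ) ≤ m := by exact_mod_cast hm.1
    apply log_le_log (by positivity)
    exact div_le_self hxp.le hm1

lemma FF_abel_log (k : ℕ) (y : ℝ) {x : ℝ} :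
    ∑ n ∈ Finset.Icc 0 ⌊x⌋₊, log n * aa k y n = log x * FF k y x - ∫ t in Set.Ioc 1 x, FF k y t / t := by
  rw [sum_mul_eq_sub_integral_mul₀ (f := log) (aa k y) (by simp) x]
  · congr 1
    refine integral_congr_ae (Eventually.of_forall fun t => ?_)
    simp only [deriv_log]; rw [FF]; ring
  · intro t ht; exact differentiableAt_log (by linarith [ht.1])
  · refine ContinuousOn.integrableOn_Icc ?_
    intro t ht
    rw [deriv_log']
    exact (continuousAt_inv₀ (by linarith [ht.1])).continuousWithinAt

lemma FF_abel_inv (k : ℕ) (y : ℝ) {z : ℝ} :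
    ∑ n ∈ Finset.Icc 0 ⌊z⌋₊, (n:ℝ)⁻¹ * aa k y n = z⁻¹ * FF k y z + ∫ t in Set.Ioc 1 z, FF k y t / t ^ 2 := by
  rw [sum_mul_eq_sub_integral_mul₀ (f := fun t => t⁻¹) (aa k y) (by simp) z]
  · rw [sub_eq_add_neg, ← integral_neg]
    congr 1
    refine integral_congr_ae (Eventually.of_forall fun t => ?_)
    simp only [deriv_inv]; rw [FF]; ring
  · intro t ht; exact differentiableAt_inv (by linarith [ht.1])
  · refine ContinuousOn.integrableOn_Icc ?_
    rw [deriv_inv']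
    intro t ht
    have : t ≠ 0 := by linarith [ht.1]
    exact ContinuousAt.continuousWithinAt (by fun_prop (disch := positivity))

lemma FF_ident : ∃ Q : ℝ, 0 < Q ∧ ∀ k ≤ 1, ∀ y x : ℝ, 1 ≤ log y → 1 ≤ y → y ≤ x →
    |FF k y x * log x - ((∫ t in Set.Ioc 1 x, FF k y t / t) +
      (k + 1) * x * ∫ w in Set.Ioc 1 (x / y), FF k y w / w ^ 2)| ≤
      Q * exp (-(3/2 * √(log y))) * (x * log x ^ k) := by
  obtain ⟨C, hC, hpsi⟩ := psiy_bound
  obtain ⟨B, hB, hb⟩ := blockE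
  refine ⟨4 * C * B, by positivity, fun k hk y x hL hy hx => ?_⟩
  have hyp : 0 < y := by linarith
  have hxp : 0 < x := by linarith
  have h1 := FF_abel_log k y (x := x)
  rw [sum_aa_log hk] at h1
  have h2 := FF_abel_inv k y (z := x / y)
  have e0 : FF k y x * log x - ((∫ t in Set.Ioc 1 x, FF k y t / t) +
      (k + 1) * x * ∫ w in Set.Ioc 1 (x / y), FF k y w / w ^ 2) =
      (k + 1) * ((∑ m ∈ Finset.Ioc 0 ⌊x⌋₊, aa k y m * psiy y (x / m)) - x * ∫ w in Set.Ioc 1 (x / y), FF k y w / w ^ 2) := by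
    linear_combination -h1
  have hfl : ⌊x / y⌋₊ ≤ ⌊x⌋₊ := Nat.floor_mono (div_le_self hxp.le hy)
  have e1 : ∑ m ∈ Finset.Ioc 0 ⌊x⌋₊, aa k y m * psiy y (x / m) = ∑ m ∈ Finset.Ioc 0 ⌊x / y⌋₊, aa k y m * psiy y (x / m) := by
    symm
    refine Finset.sum_subset (Finset.Ioc_subset_Ioc_right hfl) fun m hm hm' => ?_
    rw [psiy_zero hyp.le, mul_zero]
    rw [Finset.mem_Ioc] at hm hm'
    have hm0 : (0:ℝ) < m := by exact_mod_cast hm.1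
    have : x / y < m := by
      rw [← Nat.floor_lt (by positivity)]; by_contra h; exact hm' ⟨hm.1, not_lt.1 h⟩
    rw [div_le_iff₀ hm0]; rw [div_lt_iff₀ hyp] at this; linarith
  have e2 : x * ∫ w in Set.Ioc 1 (x / y), FF k y w / w ^ 2 = ∑ m ∈ Finset.Ioc 0 ⌊x / y⌋₊, aa k y m * (x / m - y) := by
    rw [FF, Icc0_eq, Finset.Icc_eq_cons_Ioc (Nat.zero_le _), Finset.sum_cons, ArithmeticFunction.map_zero, mul_zero, zero_add] at h2
    have h3 : ∫ w in Set.Ioc 1 (x / y), FF k y w / w ^ 2 =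
      ∑ m ∈ Finset.Ioc 0 ⌊x / y⌋₊, (m:ℝ)⁻¹ * aa k y m - (x / y)⁻¹ * ∑ m ∈ Finset.Ioc 0 ⌊x / y⌋₊, aa k y m := by linarith
    rw [h3, Finset.mul_sum, ← Finset.sum_sub_distrib, Finset.mul_sum]
    refine Finset.sum_congr rfl fun m hm => ?_
    field_simp
  have e3 : |(∑ m ∈ Finset.Ioc 0 ⌊x⌋₊, aa k y m * psiy y (x / m)) - x * ∫ w in Set.Ioc 1 (x / y), FF k y w / w ^ 2| ≤
     C * exp (-(3/2 * √(log y))) * x * (B * (1 + log x) ^ k) := by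
    rw [e1, e2, ← Finset.sum_sub_distrib]
    refine (Finset.abs_sum_le_sum_abs _ _).trans ?_
    refine le_trans ?_ (mul_le_mul_of_nonneg_left (hb k hk x (by linarith)) (by positivity))
    rw [Finset.mul_sum]
    refine le_trans (Finset.sum_le_sum fun m hm => ?_) (Finset.sum_le_sum_of_subset_of_nonneg (Finset.Ioc_subset_Ioc_right hfl) fun m _ _ => by positivity)
    rw [Finset.mem_Ioc] at hm
    have hm0 : (0:ℝ) < m := by exact_mod_cast hm.1
    have hmz : y ≤ x / m := by
      have := (Nat.le_floor_iff (by positivity)).1 hm.2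
      rw [le_div_iff₀ hyp] at this; rw [le_div_iff₀ hm0]; linarith
    rw [← mul_sub, abs_mul, abs_of_nonneg (aa_nonneg k y m)]
    have h3 := hpsi y (x / m) hy hmz
    have h4 : RR (x / m) ≤ x / m * (exp (-(3/2 * √(log y))) * exp (-(1/2 * √(log (x / m))))) := by
      rw [RR, ← exp_add]
      have : √(log y) ≤ √(log (x / m)) := sqrt_le_sqrt (log_le_log hyp hmz)
      refine mul_le_mul_of_nonneg_left (exp_le_exp.2 (by linarith)) (by positivity)
    calc _ ≤ (m.divisors.card : ℝ) ^ k * (C * (x / m * (exp (-(3/2 * √(log y))) * exp (-(1/2 * √(log (x / m))))))) := by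
          refine mul_le_mul (aa_le k y m) (h3.trans (mul_le_mul_of_nonneg_left h4 hC.le)) (abs_nonneg _) (by positivity)
      _ = _ := by ring
  rw [e0, abs_mul, abs_of_nonneg (by positivity)]
  have hlx : 1 ≤ log x := hL.trans (log_le_log hyp hx)
  have hk2 : (k:ℝ) + 1 ≤ 2 := by have : (k:ℝ) ≤ 1 := by exact_mod_cast hk
                                 linarith
  have h5 : (1 + log x) ^ k ≤ 2 * log x ^ k := by
    interval_cases k
    · norm_num
    · simp only [pow_one]; linarith
  calc _ ≤ 2 * (C * exp (-(3/2 * √(log y))) * x * (B * (2 * log x ^ k))) := by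
        refine mul_le_mul hk2 (e3.trans ?_) (abs_nonneg _) (by norm_num)
        gcongr
    _ = _ := by ring
end PF

namespace PF
def IsXi (k : ℕ) (ξ : ℝ → ℝ) : Prop :=
  (∀ u : ℝ, u < 1 → ξ u = 0) ∧ ∀ u : ℝ, 1 ≤ u → u * ξ u = (k + 1) + (k + 1) * ∫ t in (1:ℝ)..(u - 1), ξ t

lemma ae_zero {f : ℝ → ℝ} {a b : ℝ} (hab : a ≤ b) (h : ∀ t, a < t → t < b → f t = 0) :
    f =ᵐ[volume.restrict (Set.uIoc a b)] (fun _ => (0:ℝ)) := by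
  rw [Set.uIoc_of_le hab, ← restrict_Ioo_eq_restrict_Ioc]
  exact (ae_restrict_iff' measurableSet_Ioo).2 (Eventually.of_forall fun t ht => h t ht.1 ht.2)

lemma ii_zero {f : ℝ → ℝ} {a b : ℝ} (hab : a ≤ b) (h : ∀ t, a < t → t < b → f t = 0) :
    IntervalIntegrable f volume a b ∧ ∫ t in a..b, f t = 0 := by
  have := ae_zero hab h
  constructor
  · exact (intervalIntegrable_const (c := (0:ℝ))).congr_ae this.symm
  · rw [intervalIntegral.integral_congr_ae_restrict this]; simp

variable {k : ℕ} {ξ : ℝ → ℝ}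

lemma xi_low (h : IsXi k ξ) {v : ℝ} (hv : v ≤ 1) : IntervalIntegrable ξ volume 1 v ∧ ∫ t in (1:ℝ)..v, ξ t = 0 := by
  have := ii_zero hv (f := ξ) (fun t _ ht => h.1 t ht)
  refine ⟨this.1.symm, ?_⟩
  rw [intervalIntegral.integral_symm, this.2, neg_zero]

lemma xi_12 (h : IsXi k ξ) {u : ℝ} (h1 : 1 ≤ u) (h2 : u ≤ 2) : ξ u = (k + 1) / u := by
  have := h.2 u h1
  rw [(xi_low h (by linarith)).2] at this
  rw [eq_div_iff (by linarith)]; linarith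

lemma xi_cont_aux (h : IsXi k ξ) (n : ℕ) : ContinuousOn ξ (Set.Icc 1 ((n:ℝ) + 2)) := by
  induction n with
  | zero =>
    have : ContinuousOn (fun u : ℝ => ((k:ℝ) + 1) / u) (Set.Icc 1 (((0:ℕ):ℝ) + 2)) := fun u hu => by
      have : u ≠ 0 := by linarith [hu.1]
      exact ContinuousAt.continuousWithinAt (by fun_prop (disch := positivity))
    refine this.congr fun u hu => xi_12 h hu.1 (by simpa using hu.2)
  | succ n ih =>
    have hn : (0:ℝ) ≤ n := by positivity
    have hii : IntervalIntegrable ξ volume 0 ((n:ℝ) + 2) :=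
      (xi_low h zero_le_one).1.symm.trans (ContinuousOn.intervalIntegrable_of_Icc (by linarith) ih)
    have hc := intervalIntegral.continuousOn_primitive_interval' hii (a := 1)
      (by rw [Set.uIcc_of_le (by linarith)]; constructor <;> linarith)
    rw [Set.uIcc_of_le (by linarith)] at hc
    have hc2 : ContinuousOn (fun u : ℝ => (((k:ℝ) + 1) + (k + 1) * ∫ t in (1:ℝ)..(u - 1), ξ t) / u)
        (Set.Icc 1 (((n + 1 : ℕ):ℝ) + 2)) := by
      refine ContinuousOn.div ?_ continuousOn_id fun u hu => by linarith [hu.1]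
      refine continuousOn_const.add (continuousOn_const.mul ?_)
      refine hc.comp (f := fun u : ℝ => u - 1) (by fun_prop) fun u hu => ?_
      have := hu.2
      push_cast at this
      exact ⟨by linarith [hu.1], by linarith⟩
    refine hc2.congr fun u hu => ?_
    rw [eq_div_iff (by linarith [hu.1])]
    linarith [h.2 u hu.1]

lemma xi_cont (h : IsXi k ξ) : ContinuousOn ξ (Set.Ici 1) := by
  intro u hu
  obtain ⟨n, hn⟩ := exists_nat_gt u
  have := xi_cont_aux h n u ⟨hu, by linarith⟩
  refine this.mono_of_mem_nhdsWithin ?_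
  rw [mem_nhdsWithin]
  exact ⟨Set.Iio ((n:ℝ) + 2), isOpen_Iio, by simp only [Set.mem_Iio]; linarith, fun t ht => ⟨ht.2, le_of_lt ht.1⟩⟩

lemma xi_ii1 (h : IsXi k ξ) (b : ℝ) : IntervalIntegrable ξ volume 1 b := by
  rcases le_total b 1 with hb | hb
  · exact (xi_low h hb).1
  · exact ContinuousOn.intervalIntegrable_of_Icc hb ((xi_cont h).mono fun t ht => ht.1)

lemma xi_ii (h : IsXi k ξ) (a b : ℝ) : IntervalIntegrable ξ volume a b :=
  (xi_ii1 h a).symm.trans (xi_ii1 h b)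

lemma xi_cmp (h : IsXi k ξ) (s α β : ℝ)
    (h1 : ∀ u : ℝ, 1 ≤ u → u ≤ 2 → s * (α + β * u) ≤ s * ((k + 1) / u))
    (h2 : ∀ u : ℝ, 2 ≤ u → s * (u * (α + β * u)) ≤ s * ((k + 1) + (k + 1) * (α * (u - 2) + β * (((u - 1) ^ 2 - 1) / 2)))) :
    ∀ u : ℝ, 1 ≤ u → s * (α + β * u) ≤ s * ξ u := by
  have key : ∀ n : ℕ, ∀ u : ℝ, 1 ≤ u → u ≤ (n:ℝ) + 2 → s * (α + β * u) ≤ s * ξ u := by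
    intro n
    induction n with
    | zero => intro u hu1 hu2
              have hu2' : u ≤ 2 := by simpa using hu2
              rw [xi_12 h hu1 hu2']; exact h1 u hu1 hu2'
    | succ n ih =>
      intro u hu1 hu2
      push_cast at hu2
      rcases le_total u 2 with hu | hu
      · rw [xi_12 h hu1 hu]; exact h1 u hu1 hu
      · have hint : s * ∫ t in (1:ℝ)..(u - 1), (α + β * t) ≤ s * ∫ t in (1:ℝ)..(u - 1), ξ t := by
          rw [← intervalIntegral.integral_const_mul, ← intervalIntegral.integral_const_mul]
          refine intervalIntegral.integral_mono_on (by linarith) ?_ ((xi_ii h _ _).const_mul s) fun t ht => ih t ht.1 (by linarith [ht.2])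
          exact Continuous.intervalIntegrable (by fun_prop) _ _
        have hcalc : ∫ t in (1:ℝ)..(u - 1), (α + β * t) = α * (u - 2) + β * (((u - 1) ^ 2 - 1) / 2) := by
          rw [intervalIntegral.integral_add intervalIntegrable_const (Continuous.intervalIntegrable (by fun_prop) _ _),
            intervalIntegral.integral_const_mul, integral_id, intervalIntegral.integral_const, smul_eq_mul]
          ring
        rw [hcalc] at hint
        have e := h.2 u hu1
        have e2 := h2 u hu
        have hk : (0:ℝ) ≤ k + 1 := by positivity
        have e3 := mul_le_mul_of_nonneg_left hint hk
        have e4 : u * (s * (α + β * u)) ≤ u * (s * ξ u) := by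
          calc u * (s * (α + β * u)) = s * (u * (α + β * u)) := by ring
            _ ≤ _ := e2
            _ ≤ s * (u * ξ u) := by rw [e]; linarith
            _ = _ := by ring
        exact le_of_mul_le_mul_left e4 (by linarith)
  intro u hu
  obtain ⟨n, hn⟩ := exists_nat_gt u
  exact key n u hu (by linarith)

lemma xi_bd (hk : k ≤ 1) (h : IsXi k ξ) {u : ℝ} (hu : 1 ≤ u) : u ^ k / 4 ≤ ξ u ∧ ξ u ≤ 2 * u ^ k := by
  interval_cases k
  · have l := xi_cmp h 1 (1/2) 0 (fun u h1 h2 => by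
      have : 0 < u := by linarith
      simp only [one_mul, zero_mul, add_zero, Nat.cast_zero, zero_add]
      rw [div_le_div_iff₀ (by norm_num) this]; linarith) (fun u h1 => by push_cast; linarith) u hu
    have r := xi_cmp h (-1) 1 0 (fun u h1 h2 => by
      have : 0 < u := by linarith
      simp only [zero_mul, add_zero, Nat.cast_zero, zero_add]
      have : 1 / u ≤ 1 := by rw [div_le_one this]; linarith
      linarith) (fun u h1 => by push_cast; linarith) u hu
    simp only [pow_zero]
    constructor <;> linarith
  · have l := xi_cmp h 1 (1/2) (1/4) (fun u h1 h2 => by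
      have : 0 < u := by linarith
      rw [one_mul, one_mul, le_div_iff₀ this]; push_cast; nlinarith) (fun u h1 => by push_cast; nlinarith) u hu
    have r := xi_cmp h (-1) (4/3) (2/3) (fun u h1 h2 => by
      have : 0 < u := by linarith
      have : ((1:ℕ) + 1 : ℝ) / u ≤ 4 / 3 + 2 / 3 * u := by rw [div_le_iff₀ this]; push_cast; nlinarith
      linarith) (fun u h1 => by push_cast; nlinarith) u hu
    simp only [pow_one]
    constructor <;> linarith

lemma xi_le (hk : k ≤ 1) (h : IsXi k ξ) {t u : ℝ} (hu : 1 ≤ u) (ht : t ≤ u) : 0 ≤ ξ t ∧ ξ t ≤ 2 * u ^ k := by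
  rcases lt_or_ge t 1 with h1 | h1
  · rw [h.1 t h1]; exact ⟨le_rfl, by positivity⟩
  · have := xi_bd hk h h1
    have h0 : (0:ℝ) ≤ t ^ k := by positivity
    have h3 : t ^ k ≤ u ^ k := by gcongr
    constructor <;> linarith

lemma xi_lip (hk : k ≤ 1) (h : IsXi k ξ) {u v : ℝ} (hv : 1 ≤ v) (hu : v ≤ u) :
    |ξ v - ξ u| ≤ 4 * u ^ k / u * (u - v) := by
  have hup : 0 < u := by linarith
  have e1 := h.2 u (by linarith)
  have e2 := h.2 v hv
  have e3 := intervalIntegral.integral_add_adjacent_intervals (xi_ii h 1 (v - 1)) (xi_ii h (v - 1) (u - 1))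
  have b := xi_le hk h (by linarith : 1 ≤ u) hu
  have i0 : 0 ≤ ∫ t in (v - 1)..(u - 1), ξ t :=
    intervalIntegral.integral_nonneg (by linarith) fun t ht => (xi_le hk h (by linarith : 1 ≤ u) (by linarith [ht.2])).1
  have i1 : ∫ t in (v - 1)..(u - 1), ξ t ≤ 2 * u ^ k * (u - v) := by
    have := intervalIntegral.integral_mono_on (by linarith : v - 1 ≤ u - 1) (xi_ii h (v - 1) (u - 1))
      (intervalIntegrable_const (c := 2 * u ^ k)) fun t ht => (xi_le hk h (by linarith : 1 ≤ u) (by linarith [ht.2])).2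
    rw [intervalIntegral.integral_const, smul_eq_mul] at this
    linarith
  have hk2 : (k:ℝ) + 1 ≤ 2 := by have : (k:ℝ) ≤ 1 := by exact_mod_cast hk
                                 linarith
  have hm : ((k:ℝ) + 1) * ∫ t in (v - 1)..(u - 1), ξ t ≤ 2 * (2 * u ^ k * (u - v)) := mul_le_mul hk2 i1 i0 (by norm_num)
  have hm0 : 0 ≤ ((k:ℝ) + 1) * ∫ t in (v - 1)..(u - 1), ξ t := by positivity
  have hb1 : (u - v) * ξ v ≤ (u - v) * (2 * u ^ k) := mul_le_mul_of_nonneg_left b.2 (by linarith)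
  have hb0 : 0 ≤ (u - v) * ξ v := mul_nonneg (by linarith) b.1
  have e : u * (ξ v - ξ u) = (u - v) * ξ v - ((k:ℝ) + 1) * ∫ t in (v - 1)..(u - 1), ξ t := by
    rw [← e3] at e1; linarith
  have hpos : 0 ≤ u ^ k * (u - v) := mul_nonneg (by positivity) (by linarith)
  rw [div_mul_eq_mul_div, le_div_iff₀ hup]
  calc |ξ v - ξ u| * u = |u * (ξ v - ξ u)| := by rw [abs_mul, abs_of_pos hup, mul_comm]
    _ ≤ _ := by rw [e, abs_le]; constructor <;> linarith
end PF

namespace PF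
noncomputable def GG (ξ : ℝ → ℝ) (y x : ℝ) : ℝ := 1 + (log y)⁻¹ * ∫ t in (1:ℝ)..x, ξ (log t / log y)

variable {k : ℕ} {ξ : ℝ → ℝ} {y : ℝ}

lemma xi_at (h : IsXi k ξ) {u : ℝ} (hu : u ≠ 1) : ContinuousAt ξ u := by
  rcases lt_or_gt_of_ne hu with h1 | h1
  · have : ξ =ᶠ[nhds u] fun _ => 0 := by
      filter_upwards [Iio_mem_nhds h1] with t ht using h.1 t ht
    exact continuousAt_const.congr this.symm
  · exact (xi_cont h).continuousAt (Ici_mem_nhds h1)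

lemma h_at (h : IsXi k ξ) (hy : 1 < y) {t : ℝ} (ht : 0 < t) (hty : t ≠ y) :
    ContinuousAt (fun t => ξ (log t / log y)) t := by
  have hL := log_pos hy
  refine ContinuousAt.comp (g := ξ) (xi_at h ?_) ((continuousAt_log ht.ne').div_const _)
  intro h1
  rw [div_eq_one_iff_eq hL.ne'] at h1
  exact hty (log_injOn_pos ht (by simp only [Set.mem_Ioi]; linarith) h1)

lemma h_low (h : IsXi k ξ) (hy : 1 < y) {t : ℝ} (ht : 0 < t) (hty : t < y) : ξ (log t / log y) = 0 :=
  h.1 _ (by rw [div_lt_one (log_pos hy)]; exact log_lt_log ht hty)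

lemma h_ii (h : IsXi k ξ) (hy : 1 < y) {x : ℝ} (hx : 1 ≤ x) :
    IntervalIntegrable (fun t => ξ (log t / log y)) volume 1 x := by
  have hL := log_pos hy
  have h1 : ∀ x, 1 ≤ x → x ≤ y → IntervalIntegrable (fun t => ξ (log t / log y)) volume 1 x := fun x hx hxy =>
    (ii_zero hx fun t ht1 ht2 => h_low h hy (by linarith) (by linarith)).1
  rcases le_total x y with hxy | hxy
  · exact h1 x hx hxy
  · refine (h1 y hy.le le_rfl).trans (ContinuousOn.intervalIntegrable_of_Icc hxy ?_)
    refine (xi_cont h).comp (f := fun t => log t / log y) ?_ ?_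
    · exact ContinuousOn.div_const (continuousOn_log.mono fun t ht => by
        have : 0 < t := by linarith [ht.1]
        exact this.ne') _
    · intro t ht
      simp only [Set.mem_Ici]
      rw [one_le_div hL]
      exact log_le_log (by linarith) ht.1

lemma GG_low (h : IsXi k ξ) (hy : 1 < y) {x : ℝ} (hx : 1 ≤ x) (hxy : x ≤ y) : GG ξ y x = 1 := by
  rw [GG, (ii_zero hx fun t ht1 ht2 => h_low h hy (by linarith) (by linarith)).2]; simp

lemma GG_cont (h : IsXi k ξ) (hy : 1 < y) (X : ℝ) : ContinuousOn (GG ξ y) (Set.Icc 1 X) := by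
  rcases le_or_gt 1 X with hX | hX
  · have := intervalIntegral.continuousOn_primitive_interval' (h_ii h hy hX) (a := 1) (by simp)
    rw [Set.uIcc_of_le hX] at this
    exact continuousOn_const.add (continuousOn_const.mul this)
  · rw [Set.Icc_eq_empty (by linarith)]; exact continuousOn_empty _

lemma GG_at (h : IsXi k ξ) (hy : 1 < y) : ContinuousOn (GG ξ y) (Set.Ioi 1) := by
  intro x hx
  have hx' : 1 < x := hx
  exact ((GG_cont h hy (x + 1)).continuousAt (Icc_mem_nhds hx' (by linarith))).continuousWithinAt

lemma GG_deriv (h : IsXi k ξ) (hy : 1 < y) {x : ℝ} (hx : 1 < x) (hxy : x ≠ y) :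
    HasDerivAt (GG ξ y) ((log y)⁻¹ * ξ (log x / log y)) x := by
  refine HasDerivAt.const_add 1 (HasDerivAt.const_mul _ ?_)
  refine intervalIntegral.integral_hasDerivAt_right (h_ii h hy hx.le) ?_ (h_at h hy (by linarith) hxy)
  refine ContinuousOn.stronglyMeasurableAtFilter (s := Set.Ioi 0 ∩ {y}ᶜ) (isOpen_Ioi.inter isOpen_compl_singleton)
    (fun t ht => (h_at h hy ht.1 ht.2).continuousWithinAt) x ⟨by simp only [Set.mem_Ioi]; linarith, hxy⟩

lemma Gw_cont (h : IsXi k ξ) (hy : 1 < y) (n : ℕ) (X : ℝ) : ContinuousOn (fun w => GG ξ y w / w ^ n) (Set.Icc 1 X) :=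
  (GG_cont h hy X).div (by fun_prop) fun t ht => pow_ne_zero _ (by linarith [ht.1])

lemma Gw_ii (h : IsXi k ξ) (hy : 1 < y) (n : ℕ) {X : ℝ} (hX : 1 ≤ X) :
    IntervalIntegrable (fun w => GG ξ y w / w ^ n) volume 1 X :=
  ContinuousOn.intervalIntegrable_of_Icc hX (Gw_cont h hy n X)

lemma Gw_prim_cont (h : IsXi k ξ) (hy : 1 < y) (n : ℕ) {X : ℝ} (hX : 1 ≤ X) :
    ContinuousOn (fun x => ∫ w in (1:ℝ)..x, GG ξ y w / w ^ n) (Set.Icc 1 X) := by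
  have := intervalIntegral.continuousOn_primitive_interval' (Gw_ii h hy n hX) (a := 1) (by simp)
  rwa [Set.uIcc_of_le hX] at this

lemma Gw_deriv (h : IsXi k ξ) (hy : 1 < y) (n : ℕ) {x : ℝ} (hx : 1 < x) :
    HasDerivAt (fun x => ∫ w in (1:ℝ)..x, GG ξ y w / w ^ n) (GG ξ y x / x ^ n) x := by
  have hc : ContinuousOn (fun w => GG ξ y w / w ^ n) (Set.Ioi 1) :=
    (GG_at h hy).div (by fun_prop) fun t ht => pow_ne_zero _ (by have : 1 < t := ht
                                                                 linarith)
  refine intervalIntegral.integral_hasDerivAt_right (Gw_ii h hy n hx.le)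
    (hc.stronglyMeasurableAtFilter isOpen_Ioi x hx) (hc.continuousAt (Ioi_mem_nhds hx))

lemma const_of (f : ℝ → ℝ) {a b c : ℝ} (hab : a ≤ b) (hc : ContinuousOn f (Set.Icc a b))
    (hd : ∀ x ∈ Set.Ioo a b, x ≠ c → HasDerivAt f 0 x) : f b = f a := by
  have := integral_eq_of_hasDerivAt_off_countable_of_le f (fun _ => 0) hab (Set.countable_singleton c) hc
    (fun x hx => hd x hx.1 hx.2) intervalIntegrable_const
  rw [intervalIntegral.integral_zero] at this
  linarith

lemma GG_parts (h : IsXi k ξ) (hy : 1 < y) {z : ℝ} (hz : 1 ≤ z) :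
    (∫ w in (1:ℝ)..z, GG ξ y w / w ^ 2) + GG ξ y z / z = 1 + ∫ t in (1:ℝ)..(log z / log y), ξ t := by
  have hL := log_pos hy
  have := const_of (fun z => (∫ w in (1:ℝ)..z, GG ξ y w / w ^ 2) + GG ξ y z / z - ∫ t in (1:ℝ)..(log z / log y), ξ t)
    (c := y) hz ?_ ?_
  · simp only [intervalIntegral.integral_same, log_one, zero_div, (xi_low h zero_le_one).2,
      GG_low h hy le_rfl hy.le] at this
    linarith
  · refine ((Gw_prim_cont h hy 2 hz).add ?_).sub ?_
    · simpa using Gw_cont h hy 1 z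
    · have hb : 0 ≤ log z / log y := div_nonneg (log_nonneg hz) hL.le
      have hc := intervalIntegral.continuousOn_primitive_interval' (b₁ := 0) (b₂ := 1 + log z / log y)
        (xi_ii h _ _) (a := 1) (by rw [Set.uIcc_of_le (by linarith)]; constructor <;> linarith)
      rw [Set.uIcc_of_le (by linarith)] at hc
      refine hc.comp (f := fun z => log z / log y) ?_ ?_
      · exact ContinuousOn.div_const (continuousOn_log.mono fun t ht => by
          have : 0 < t := by linarith [ht.1]
          exact this.ne') _
      · intro t ht
        have h1 := log_nonneg ht.1
        have h2 : log t ≤ log z := log_le_log (by linarith [ht.1]) ht.2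
        have h3 : log t / log y ≤ log z / log y := by gcongr
        exact ⟨by positivity, by linarith⟩
  · intro x hx hxy
    have hx1 : 1 < x := hx.1
    have hx0 : x ≠ 0 := by linarith
    have d1 := Gw_deriv h hy 2 hx1
    have d2 := (GG_deriv h hy hx1 hxy).div (hasDerivAt_id x) hx0
    have hne : log x / log y ≠ 1 := by
      intro h1
      rw [div_eq_one_iff_eq hL.ne'] at h1
      exact hxy (log_injOn_pos (by simp only [Set.mem_Ioi]; linarith) (by simp only [Set.mem_Ioi]; linarith) h1)
    have d3 : HasDerivAt (fun v => ∫ t in (1:ℝ)..v, ξ t) (ξ (log x / log y)) (log x / log y) := by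
      refine intervalIntegral.integral_hasDerivAt_right (xi_ii h _ _) ?_ (xi_at h hne)
      exact ContinuousOn.stronglyMeasurableAtFilter (s := {1}ᶜ) isOpen_compl_singleton
        (fun t ht => (xi_at h ht).continuousWithinAt) _ hne
    have d4 := HasDerivAt.comp x d3 ((hasDerivAt_log hx0).div_const (log y))
    convert! (d1.add d2).sub d4 using 1
    simp only [id]
    field_simp
    ring

lemma GG_ident (h : IsXi k ξ) (hy : 1 < y) {x : ℝ} (hx : y ≤ x) :
    GG ξ y x * log x = (∫ t in (1:ℝ)..x, GG ξ y t / t) +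
      (k + 1) * x * ∫ w in (1:ℝ)..(x / y), GG ξ y w / w ^ 2 := by
  have hL := log_pos hy
  have hy0 : y ≠ 0 := by linarith
  have := const_of (fun x => GG ξ y x * log x - (∫ t in (1:ℝ)..x, GG ξ y t / t ^ 1) -
      (k + 1) * x * ∫ w in (1:ℝ)..(x / y), GG ξ y w / w ^ 2) (c := y) hx ?_ ?_
  · have hi : ∫ t in (1:ℝ)..y, GG ξ y t / t = log y := by
      rw [intervalIntegral.integral_congr (g := fun t => t⁻¹), integral_inv_of_pos one_pos (by linarith), div_one]
      intro t ht
      rw [Set.uIcc_of_le hy.le] at ht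
      simp only
      rw [GG_low h hy ht.1 ht.2, one_div]
    simp only [pow_one, hi, GG_low h hy hy.le le_rfl, div_self hy0, intervalIntegral.integral_same] at this
    linarith
  · have hsub : Set.Icc y x ⊆ Set.Icc 1 x := Set.Icc_subset_Icc_left hy.le
    refine ((((GG_cont h hy x).mono hsub).mul (continuousOn_log.mono fun t ht => ?_)).sub
      ((Gw_prim_cont h hy 1 (by linarith)).mono hsub)).sub ((by fun_prop : ContinuousOn (fun x : ℝ => ((k:ℝ) + 1) * x) _).mul ?_)
    · have : 0 < t := by linarith [ht.1]
      exact this.ne'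
    · refine (Gw_prim_cont h hy 2 (X := x / y) (by rwa [one_le_div (by linarith)])).comp (f := fun x => x / y) (continuous_id.div_const y).continuousOn fun t ht => ?_
      exact ⟨by rw [one_le_div (by linarith)]; exact ht.1, div_le_div_of_nonneg_right ht.2 (by linarith)⟩
  · intro t ht hty
    have hty' : y < t := ht.1
    have ht1 : 1 < t := by linarith
    have ht0 : t ≠ 0 := by linarith
    have hz1 : 1 < t / y := by rwa [one_lt_div (by linarith)]
    have hp := GG_parts h hy hz1.le
    have hu1 : 1 ≤ log t / log y := by
      rw [one_le_div hL]; exact log_le_log (by linarith) hty'.le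
    have hx := h.2 _ hu1
    have hlz : log (t / y) / log y = log t / log y - 1 := by
      rw [log_div ht0 hy0]; field_simp
    rw [hlz] at hp
    have d1 := (GG_deriv h hy ht1 hty).mul (hasDerivAt_log ht0)
    have d2 := Gw_deriv h hy 1 ht1
    have d3 := HasDerivAt.comp t (Gw_deriv h hy 2 hz1) ((hasDerivAt_id t).div_const y)
    have d4 := ((hasDerivAt_id t).const_mul ((k:ℝ) + 1)).mul d3
    convert! (d1.sub d2).sub d4 using 1
    simp only [id, Function.comp]
    have e1 : (log y)⁻¹ * ξ (log t / log y) * log t = log t / log y * ξ (log t / log y) := by ring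
    have e2 : (k + 1) * t * (GG ξ y (t / y) / (t / y) ^ 2 * (1 / y)) = (k + 1) * (GG ξ y (t / y) / (t / y)) := by
      field_simp
    rw [e1, hx, e2, mul_one, show (∫ t in (1:ℝ)..(log t / log y - 1), ξ t) = 
      (∫ w in (1:ℝ)..(t / y), GG ξ y w / w ^ 2) + GG ξ y (t / y) / (t / y) - 1 by linarith]
    ring
end PF

namespace PF
variable {k : ℕ} {ξ : ℝ → ℝ} {y : ℝ}

lemma FF_mono (k : ℕ) (y : ℝ) : Monotone (FF k y) := fun _ _ hab =>
  Finset.sum_le_sum_of_subset_of_nonneg (Finset.Icc_subset_Icc_right (Nat.floor_mono hab)) fun n _ _ => aa_nonneg k y n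

lemma FF_low (k : ℕ) {w : ℝ} (hw : 1 ≤ w) (hwy : w ≤ y) : FF k y w = 1 := by
  unfold FF
  rw [Finset.sum_eq_single 1]
  · simp [aa_apply]
  · intro n hn hn1
    rw [aa_apply, if_neg]
    rintro ⟨h0, h1 | h1⟩
    · exact hn1 h1
    · have : (n:ℝ) ≤ w := (Nat.le_floor_iff (by linarith)).1 (Finset.mem_Icc.1 hn).2
      have h2 : (n.minFac : ℝ) ≤ n := by exact_mod_cast Nat.minFac_le (Nat.pos_of_ne_zero h0)
      linarith
  · intro h; exfalso; apply h
    simp [Nat.one_le_floor_iff, hw]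

lemma Fw_ii (k : ℕ) (y : ℝ) (n : ℕ) {X : ℝ} (hX : 1 ≤ X) :
    IntervalIntegrable (fun w => FF k y w / w ^ n) volume 1 X := by
  simp only [div_eq_mul_inv]
  refine (FF_mono k y).intervalIntegrable.mul_continuousOn ?_
  rw [Set.uIcc_of_le hX]
  exact ContinuousOn.inv₀ (by fun_prop) fun t ht => pow_ne_zero _ (by linarith [ht.1])

lemma E_rec (hk : k ≤ 1) (h : IsXi k ξ) (hy : 1 < y) {X D : ℝ} (hD0 : 0 ≤ D)
    (hD : ∀ t, y ≤ t → t ≤ X → |FF k y t - GG ξ y t| ≤ D * (t * log t ^ k)) {x : ℝ} (hx : y ≤ x) (hxX : x ≤ X) :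
    |((∫ t in Set.Ioc 1 x, FF k y t / t) + (k+1)*x*∫ w in Set.Ioc 1 (x/y), FF k y w / w^2)
      - ((∫ t in (1:ℝ)..x, GG ξ y t/t) + (k+1)*x*∫ w in (1:ℝ)..(x/y), GG ξ y w/w^2)|
      ≤ D * (x * log x ^ k) * (1 + log x - log y) := by
  have hx1 : 1 ≤ x := by linarith
  have hx0 : 0 < x := by linarith
  have hz1 : 1 ≤ x / y := by rwa [one_le_div (by linarith)]
  have hzx : x / y ≤ x := div_le_self hx0.le hy.le
  have hlx : 0 ≤ log x := log_nonneg hx1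
  rw [← intervalIntegral.integral_of_le hx1, ← intervalIntegral.integral_of_le hz1]
  have e1 : (∫ t in (1:ℝ)..x, FF k y t / t) - (∫ t in (1:ℝ)..x, GG ξ y t/t) = ∫ t in (1:ℝ)..x, (FF k y t - GG ξ y t)/t := by
    rw [← intervalIntegral.integral_sub (by simpa using Fw_ii k y 1 hx1) (by simpa using Gw_ii h hy 1 hx1)]
    simp only [sub_div]
  have e2 : (∫ t in (1:ℝ)..(x/y), FF k y t / t^2) - (∫ t in (1:ℝ)..(x/y), GG ξ y t/t^2) = ∫ t in (1:ℝ)..(x/y), (FF k y t - GG ξ y t)/t^2 := by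
    rw [← intervalIntegral.integral_sub (Fw_ii k y 2 hz1) (Gw_ii h hy 2 hz1)]
    simp only [sub_div]
  have hE : ∀ t, 1 ≤ t → t ≤ X → |FF k y t - GG ξ y t| ≤ D * (t * log t ^ k) := by
    intro t ht1 htX
    rcases le_total y t with h1 | h1
    · exact hD t h1 htX
    · rw [FF_low k ht1 h1, GG_low h hy ht1 h1, sub_self, abs_zero]
      have := log_nonneg ht1
      positivity
  have b1 : |∫ t in (1:ℝ)..x, (FF k y t - GG ξ y t)/t| ≤ D * log x ^ k * x := by
    have := intervalIntegral.norm_integral_le_of_norm_le_const (f := fun t => (FF k y t - GG ξ y t)/t) (a := 1) (b := x)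
      (C := D * log x ^ k) (by
        intro t ht
        rw [Set.uIoc_of_le hx1] at ht
        have ht1 := ht.1
        have ht0 : 0 < t := by linarith
        rw [norm_eq_abs, abs_div, abs_of_pos ht0, div_le_iff₀ ht0]
        refine (hE t ht1.le (ht.2.trans hxX)).trans ?_
        have : log t ^ k ≤ log x ^ k :=
          pow_le_pow_left₀ (log_nonneg ht1.le) (log_le_log ht0 ht.2) _
        calc D * (t * log t ^ k) ≤ D * (t * log x ^ k) := by gcongr
          _ = _ := by ring)
    rw [norm_eq_abs, abs_of_nonneg (by linarith : 0 ≤ x - 1)] at this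
    refine this.trans ?_
    have : 0 ≤ D * log x ^ k := by positivity
    nlinarith
  have b2 : |∫ t in (1:ℝ)..(x/y), (FF k y t - GG ξ y t)/t^2| ≤ D * (log (x/y) ^ (k+1) / (k+1)) := by
    have hFTC : ∫ w in (1:ℝ)..(x/y), D * (log w ^ k / w) = D * (log (x/y) ^ (k+1) / (k+1)) := by
      rw [intervalIntegral.integral_const_mul]
      congr 1
      rw [intervalIntegral.integral_eq_sub_of_hasDerivAt (f := fun w => log w ^ (k+1) / (k+1))]
      · simp
      · intro t ht
        rw [Set.uIcc_of_le hz1] at ht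
        have ht0 : t ≠ 0 := by linarith [ht.1]
        have := ((hasDerivAt_log ht0).pow (k+1)).div_const ((k:ℝ)+1)
        convert! this using 1
        have : (k:ℝ) + 1 ≠ 0 := by positivity
        push_cast
        try simp only [Nat.add_sub_cancel]
        field_simp
      · refine ContinuousOn.intervalIntegrable_of_Icc hz1 ?_
        have : ∀ t ∈ Set.Icc 1 (x/y), t ≠ 0 := fun t ht => by linarith [ht.1]
        exact ((continuousOn_log.mono this).pow k).div continuousOn_id this
    rw [← hFTC, ← norm_eq_abs]
    refine intervalIntegral.norm_integral_le_of_norm_le hz1 (ae_of_all _ fun t ht => ?_) ?_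
    · have ht0 : 0 < t := by linarith [ht.1]
      rw [norm_eq_abs, abs_div, abs_of_pos (by positivity : 0 < t^2), div_le_iff₀ (by positivity)]
      refine (hE t ht.1.le (ht.2.trans (hzx.trans hxX))).trans (le_of_eq ?_)
      field_simp
    · refine ContinuousOn.intervalIntegrable_of_Icc hz1 ?_
      have : ∀ t ∈ Set.Icc 1 (x/y), t ≠ 0 := fun t ht => by linarith [ht.1]
      exact continuousOn_const.mul (((continuousOn_log.mono this).pow k).div continuousOn_id this)
  have e3 : ((∫ t in (1:ℝ)..x, FF k y t / t) + (k+1)*x*∫ w in (1:ℝ)..(x/y), FF k y w / w^2)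
      - ((∫ t in (1:ℝ)..x, GG ξ y t/t) + (k+1)*x*∫ w in (1:ℝ)..(x/y), GG ξ y w/w^2)
      = (∫ t in (1:ℝ)..x, (FF k y t - GG ξ y t)/t) + (k+1)*x*∫ t in (1:ℝ)..(x/y), (FF k y t - GG ξ y t)/t^2 := by
    rw [← e1, ← e2]; ring
  rw [e3]
  refine (abs_add_le _ _).trans ?_
  rw [abs_mul, abs_of_nonneg (by positivity : 0 ≤ ((k:ℝ)+1)*x)]
  have hlz : log (x/y) = log x - log y := log_div hx0.ne' (by linarith)
  have hlz0 : 0 ≤ log (x/y) := log_nonneg hz1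
  have b3 : ((k:ℝ)+1)*x*|∫ t in (1:ℝ)..(x/y), (FF k y t - GG ξ y t)/t^2| ≤ D * x * (log x ^ k * (log x - log y)) := by
    calc _ ≤ ((k:ℝ)+1)*x*(D * (log (x/y) ^ (k+1) / (k+1))) := by gcongr
      _ = D * x * (log (x/y) ^ k * log (x/y)) := by rw [pow_succ]; field_simp
      _ ≤ D * x * (log x ^ k * log (x/y)) := by
        have : log (x/y) ≤ log x := log_le_log (by positivity) hzx
        gcongr
      _ = _ := by rw [hlz]
  calc _ ≤ D * log x ^ k * x + D * x * (log x ^ k * (log x - log y)) := add_le_add b1 b3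
    _ = _ := by ring

lemma E_bd : ∃ Q : ℝ, 0 < Q ∧ ∀ k ≤ 1, ∀ (ξ : ℝ → ℝ), IsXi k ξ → ∀ y x : ℝ, 1 < log y → 1 < y → y ≤ x →
    |FF k y x - GG ξ y x| ≤ Q * exp (-(3/2*√(log y))) / (log y - 1) * (x * log x ^ k) := by
  obtain ⟨Q, hQ, H⟩ := FF_ident
  refine ⟨Q, hQ, fun k hk ξ h y X hL hy hyX => ?_⟩
  set Q' := Q * exp (-(3/2*√(log y))) with hQ'
  set q : ℝ → ℝ := fun x => |FF k y x - GG ξ y x| / (x * log x ^ k) with hq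
  have hpos : ∀ t, y ≤ t → 0 < t * log t ^ k := fun t ht => by
    have := log_pos (hy.trans_le ht)
    have : 0 < t := by linarith
    positivity
  have hbdd : BddAbove (q '' Set.Icc y X) := by
    obtain ⟨B, hB⟩ := isCompact_Icc.exists_bound_of_continuousOn (GG_cont h hy X)
    refine ⟨(FF k y X + B) / (log y ^ k), ?_⟩
    rintro _ ⟨t, ht, rfl⟩
    have ht1 : 1 ≤ t := by linarith [ht.1]
    have h1 := hB t ⟨ht1, ht.2⟩
    rw [norm_eq_abs] at h1
    have h2 : |FF k y t - GG ξ y t| ≤ FF k y X + B := by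
      refine (abs_sub _ _).trans (add_le_add ?_ h1)
      rw [abs_of_nonneg (FF_nonneg _ _ _)]
      exact FF_mono k y ht.2
    have h3 : log y ^ k ≤ t * log t ^ k := by
      have : log y ^ k ≤ log t ^ k := pow_le_pow_left₀ (by linarith) (log_le_log (by linarith) ht.1) _
      have h0 : 0 ≤ log t ^ k := by have := log_nonneg ht1; positivity
      nlinarith
    exact div_le_div₀ ((abs_nonneg _).trans h2) h2 (by positivity) h3
  set D := sSup (q '' Set.Icc y X) with hDdef
  have hqD : ∀ t, y ≤ t → t ≤ X → q t ≤ D := fun t h1 h2 => le_csSup hbdd ⟨t, ⟨h1, h2⟩, rfl⟩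
  have hD0 : 0 ≤ D := by
    refine le_trans ?_ (hqD y le_rfl hyX)
    exact div_nonneg (abs_nonneg _) (hpos y le_rfl).le
  have hD : ∀ t, y ≤ t → t ≤ X → |FF k y t - GG ξ y t| ≤ D * (t * log t ^ k) := fun t h1 h2 => by
    have := hqD t h1 h2
    rwa [hq, div_le_iff₀ (hpos t h1)] at this
  have key : ∀ t, y ≤ t → t ≤ X → q t ≤ D - (D * (log y - 1) - Q') / log t := by
    intro t h1 h2
    have hr := E_rec hk h hy hD0 hD h1 h2
    have hf := H k hk y t hL.le hy.le h1
    have hg := GG_ident h hy h1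
    have hlt : 0 < log t := log_pos (hy.trans_le h1)
    rw [← hg] at hr
    have hs := abs_add_le _ _ |>.trans (add_le_add hf hr)
    have e : FF k y t * log t - ((∫ t in Set.Ioc 1 t, FF k y t / t) + (k+1)*t*∫ w in Set.Ioc 1 (t/y), FF k y w / w^2)
      + (((∫ t in Set.Ioc 1 t, FF k y t / t) + (k+1)*t*∫ w in Set.Ioc 1 (t/y), FF k y w / w^2) - GG ξ y t * log t)
      = (FF k y t - GG ξ y t) * log t := by ring
    rw [e, abs_mul, abs_of_pos hlt] at hs
    have hp := hpos t h1
    have : q t * log t ≤ D * (1 + log t - log y) + Q' := by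
      rw [hq]
      simp only
      rw [div_mul_eq_mul_div, div_le_iff₀ hp]
      linarith
    have e2 : D - (D * (log y - 1) - Q') / log t = (D * (1 + log t - log y) + Q') / log t := by
      field_simp; ring
    rw [e2, le_div_iff₀ hlt]; exact this
  have fin : D * (log y - 1) ≤ Q' := by
    by_contra hc
    push Not at hc
    have hlX : 0 < log X := log_pos (hy.trans_le hyX)
    have : D ≤ D - (D * (log y - 1) - Q') / log X := by
      refine csSup_le ⟨_, ⟨y, ⟨le_rfl, hyX⟩, rfl⟩⟩ ?_
      rintro _ ⟨t, ht, rfl⟩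
      refine (key t ht.1 ht.2).trans ?_
      have hlt : 0 < log t := log_pos (hy.trans_le ht.1)
      have : log t ≤ log X := log_le_log (by linarith [ht.1]) ht.2
      have := div_le_div_of_nonneg_left (by linarith : 0 ≤ D * (log y - 1) - Q') hlt this
      linarith
    have : 0 < (D * (log y - 1) - Q') / log X := div_pos (by linarith) hlX
    linarith
  refine (hD X hyX le_rfl).trans ?_
  have := hpos X hyX
  have : D ≤ Q' / (log y - 1) := by rwa [le_div_iff₀ (by linarith)]
  gcongr
end PF

namespace PF
variable {k : ℕ} {ξ : ℝ → ℝ} {y : ℝ}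

lemma GG_split (h : IsXi k ξ) (hy : 1 < y) {x : ℝ} (hx : y ≤ x) :
    IntervalIntegrable (fun t => ξ (log t / log y)) volume y x ∧
    GG ξ y x = 1 + (log y)⁻¹ * ∫ t in y..x, ξ (log t / log y) := by
  have h1 := h_ii h hy hy.le
  have h2 := h_ii h hy (hy.le.trans hx)
  have h3 := h1.symm.trans h2
  refine ⟨h3, ?_⟩
  have h4 := intervalIntegral.integral_add_adjacent_intervals h1 h3
  rw [GG, ← h4, (ii_zero hy.le fun t ht1 ht2 => h_low h hy (by linarith) (by linarith)).2, zero_add]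

lemma u_ge (hy : 1 < y) {x : ℝ} (hx : y ≤ x) : 1 ≤ log x / log y := by
  rw [one_le_div (log_pos hy)]
  exact log_le_log (by linarith) hx

lemma log_ii {x : ℝ} (hy : 0 < y) (hx : y ≤ x) :
    IntervalIntegrable (fun t => log x - log t) volume y x ∧ ∫ t in y..x, (log x - log t) ≤ x := by
  have hi : IntervalIntegrable (fun t => log x - log t) volume y x := by
    refine ContinuousOn.intervalIntegrable_of_Icc hx (continuousOn_const.sub (continuousOn_log.mono fun t ht => ?_))
    have : 0 < t := by linarith [ht.1]
    exact this.ne'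
  refine ⟨hi, ?_⟩
  rw [intervalIntegral.integral_eq_sub_of_hasDerivAt (f := fun t => t * (log x - log t) + t) ?_ hi]
  · have : log y ≤ log x := log_le_log hy hx
    have : 0 ≤ y * (log x - log y) := mul_nonneg hy.le (by linarith)
    simp; linarith
  · intro t ht
    rw [Set.uIcc_of_le hx] at ht
    have ht0 : t ≠ 0 := by linarith [ht.1]
    have := ((hasDerivAt_id t).mul ((hasDerivAt_log ht0).const_sub (log x))).add (hasDerivAt_id t)
    convert! this using 1
    simp
    field_simp
    ring

lemma GG_est (hk : k ≤ 1) (h : IsXi k ξ) (hy : 1 < y) {x : ℝ} (hx : y ≤ x) :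
    |GG ξ y x - x * ξ (log x / log y) / log y| ≤
      1 + y * ξ (log x / log y) / log y +
        4 * (log x / log y)^k * x / (log y * log x) := by
  have hL := log_pos hy
  have hlx : 0 < log x := log_pos (by linarith)
  obtain ⟨hi, hG⟩ := GG_split h hy hx
  set u := log x / log y with hu
  have hu1 : 1 ≤ u := u_ge hy hx
  obtain ⟨hl, hl2⟩ := log_ii (by linarith : 0 < y) hx
  have b : |∫ t in y..x, (ξ (log t / log y) - ξ u)| ≤ 4 * u^k / log x * x := by
    calc _ ≤ ∫ t in y..x, 4 * u^k / log x * (log x - log t) := by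
          rw [← norm_eq_abs]
          refine intervalIntegral.norm_integral_le_of_norm_le hx (ae_of_all _ fun t ht => ?_) (hl.const_mul _)
          have htu : log t / log y ≤ u := by
            rw [hu]; exact div_le_div_of_nonneg_right (log_le_log (by linarith [ht.1]) ht.2) hL.le
          refine (xi_lip hk h (u_ge hy ht.1.le) htu).trans (le_of_eq ?_)
          rw [hu]; field_simp
      _ ≤ _ := by
          rw [intervalIntegral.integral_const_mul]
          gcongr
  rw [intervalIntegral.integral_sub hi (by simp), intervalIntegral.integral_const, smul_eq_mul] at b
  have hξ : 0 ≤ ξ u := (xi_le hk h hu1 le_rfl).1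
  rw [hG]
  have e : 1 + (log y)⁻¹ * (∫ t in y..x, ξ (log t / log y)) - x * ξ u / log y =
     1 + ((log y)⁻¹ * ((∫ t in y..x, ξ (log t / log y)) - (x - y) * ξ u)) - y * ξ u / log y := by
    field_simp; ring
  rw [e]
  have b' : |(log y)⁻¹ * ((∫ t in y..x, ξ (log t / log y)) - (x - y) * ξ u)| ≤ 4 * u^k * x / (log y * log x) := by
    rw [abs_mul, abs_of_pos (inv_pos.2 hL)]
    calc _ ≤ (log y)⁻¹ * (4 * u^k / log x * x) := by gcongr
      _ = _ := by field_simp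
  have : 0 ≤ y * ξ u / log y := by positivity
  rw [abs_le] at b' ⊢
  constructor <;> linarith [b'.1, b'.2]

lemma log_sq {x : ℝ} (hx : 1 ≤ x) : log x ≤ 2 * √x ∧ log x ^ 2 ≤ 4 * x := by
  have h1 : log x ≤ 2 * √x := by
    have := log_le_self (sqrt_nonneg x)
    rw [log_sqrt (by linarith)] at this
    linarith
  refine ⟨h1, ?_⟩
  have h0 := log_nonneg hx
  have := sq_sqrt (by linarith : 0 ≤ x)
  nlinarith [sqrt_nonneg x]

lemma GG_est2 (hk : k ≤ 1) (h : IsXi k ξ) (hy : 1 < y) {x : ℝ} (hx : y^2 ≤ x) :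
    |GG ξ y x - x * ξ (log x / log y) / log y| ≤
      26 * (x * ξ (log x / log y) / log y) * (1 / log x) := by
  have hL := log_pos hy
  have hyx : y ≤ x := by nlinarith
  have hx1 : 1 < x := by linarith
  have hx0 : 0 < x := by linarith
  have hlx : 0 < log x := log_pos hx1
  refine (GG_est hk h hy hyx).trans ?_
  have hu1 : 1 ≤ log x / log y := u_ge hy hyx
  set u := log x / log y with hu
  have hb := (xi_bd hk h hu1).1
  have huk : 1 ≤ u^k := one_le_pow₀ hu1
  have hξ : 0 < ξ u := by linarith
  obtain ⟨l1, l2⟩ := log_sq hx1.le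
  have hLx : 2 * log y ≤ log x := by
    have := log_le_log (by positivity) hx
    rw [log_pow] at this; exact_mod_cast this
  have hysq : y ≤ √x := le_sqrt_of_sq_le hx
  have hsx : 0 < √x := sqrt_pos.2 hx0
  have t1 : 1 ≤ 8 * (x * ξ u / log y) * (1 / log x) := by
    have : 8 * (x * ξ u / log y) * (1 / log x) = (8 * x * ξ u) / (log y * log x) := by field_simp
    rw [this, le_div_iff₀ (by positivity)]
    have a1 : x * (1/4) ≤ x * ξ u := by gcongr; linarith
    have a2 : log x * (2 * log y) ≤ log x * log x := by gcongr
    nlinarith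
  have t2 : y * ξ u / log y ≤ 2 * (x * ξ u / log y) * (1 / log x) := by
    have : 2 * (x * ξ u / log y) * (1 / log x) = (2 * x / log x) * ξ u / log y := by field_simp
    rw [this]
    have : y ≤ 2 * x / log x := by
      rw [le_div_iff₀ hlx]
      calc y * log x ≤ √x * (2 * √x) := by gcongr
        _ = 2 * x := by have := mul_self_sqrt hx0.le; linarith
    gcongr
  have t3 : 4 * u^k * x / (log y * log x) ≤ 16 * (x * ξ u / log y) * (1 / log x) := by
    have : 16 * (x * ξ u / log y) * (1 / log x) = (16 * ξ u) * x / (log y * log x) := by field_simp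
    rw [this]
    have : 4 * u^k ≤ 16 * ξ u := by linarith
    gcongr ?_ * x / _
  linarith

lemma exp_aux {L : ℝ} (hL : 2 ≤ L) {k : ℕ} (hk : k ≤ 1) :
    exp (-(3/2*√L)) / (L - 1) * L ^ (k+1) ≤ 16 * exp (-√L) := by
  have hs := sq_sqrt (by linarith : 0 ≤ L)
  have hs0 := sqrt_nonneg L
  set s := √L
  have h1 : L / (L-1) ≤ 2 := by rw [div_le_iff₀ (by linarith)]; linarith
  have h2 : L ^ k ≤ L := by
    calc L^k ≤ L^1 := pow_le_pow_right₀ (by linarith) hk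
      _ = L := pow_one _
  have h3 : L ≤ 8 * exp (s/2) := by
    have := quadratic_le_exp_of_nonneg (by linarith : 0 ≤ s/2)
    nlinarith
  have e : exp (-(3/2*s)) = exp (-s) * exp (-(s/2)) := by rw [← exp_add]; ring_nf
  have e2 : exp (-(s/2)) * exp (s/2) = 1 := by rw [← exp_add]; simp
  have hL1 : L - 1 ≠ 0 := by linarith
  calc exp (-(3/2*s)) / (L - 1) * L ^ (k+1) = exp (-s) * exp (-(s/2)) * (L/(L-1)) * L^k := by
        rw [e, pow_succ]; field_simp
    _ ≤ exp (-s) * exp (-(s/2)) * 2 * (8 * exp (s/2)) := by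
        have := h2.trans h3
        gcongr
    _ = 16 * exp (-s) * (exp (-(s/2)) * exp (s/2)) := by ring
    _ = _ := by rw [e2, mul_one]

lemma FF_main : ∃ C : ℝ, 0 < C ∧ ∀ k ≤ 1, ∀ (ξ : ℝ → ℝ), IsXi k ξ → ∀ y x : ℝ, 2 ≤ log y → 1 < y → y^2 ≤ x →
    |FF k y x - x * ξ (log x / log y) / log y| ≤
      C * (x * ξ (log x / log y) / log y) * (1 / log x + exp (-√(log y))) := by
  obtain ⟨Q, hQ, H⟩ := E_bd
  refine ⟨26 + 64 * Q, by positivity, fun k hk ξ h y x hL hy hx => ?_⟩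
  have hyx : y ≤ x := by nlinarith
  have hx0 : 0 < x := by linarith
  have hlx : 0 < log x := log_pos (by linarith)
  have h1 := H k hk ξ h y x (by linarith) hy hyx
  have h2 := GG_est2 hk h hy hx
  have hu1 : 1 ≤ log x / log y := u_ge hy hyx
  have hlu : log x = log x / log y * log y := by field_simp
  have hb := (xi_bd hk h hu1).1
  set u := log x / log y with hu
  have huk : 1 ≤ u^k := one_le_pow₀ hu1
  have hξ : 0 < ξ u := by linarith
  set M := x * ξ u / log y with hM
  have hM0 : 0 < M := by positivity
  have h3 : Q * exp (-(3/2*√(log y))) / (log y - 1) * (x * log x ^ k) ≤ 64 * Q * M * exp (-√(log y)) := by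
    have a1 : x * log x ^ k ≤ 4 * M * log y ^ (k+1) := by
      calc x * log x ^ k = x * (u^k) * log y ^ k := by rw [hlu, mul_pow]; ring
        _ ≤ x * (4 * ξ u) * log y ^ k := by gcongr; linarith
        _ = _ := by rw [hM, pow_succ]; field_simp
    have hL1 : 0 < log y - 1 := by linarith
    calc _ ≤ Q * exp (-(3/2*√(log y))) / (log y - 1) * (4 * M * log y ^ (k+1)) := by gcongr
      _ = 4 * Q * M * (exp (-(3/2*√(log y))) / (log y - 1) * log y ^ (k+1)) := by ring
      _ ≤ 4 * Q * M * (16 * exp (-√(log y))) := mul_le_mul_of_nonneg_left (exp_aux hL hk) (by positivity)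
      _ = _ := by ring
  have h4 := abs_add_le (FF k y x - GG ξ y x) (GG ξ y x - M)
  rw [sub_add_sub_cancel] at h4
  have p1 : 0 ≤ Q * M * (1 / log x) := by positivity
  have p2 : 0 ≤ M * exp (-√(log y)) := by positivity
  linarith
end PF

namespace PF
lemma S_eq (x y : ℝ) : S x y = FF 1 y x := by
  unfold S FF
  rw [Icc0_eq, Finset.sum_filter, Icc1_eq]
  refine Finset.sum_congr rfl fun n hn => ?_
  have : n ≠ 0 := by have := (Finset.mem_Ioc.1 hn).1; omega
  rw [aa_apply]; simp [this]

lemma Phi_eq (x y : ℝ) : Phi x y = FF 0 y x := by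
  unfold Phi FF
  rw [Icc0_eq, Finset.card_filter, Icc1_eq]
  push_cast
  refine Finset.sum_congr rfl fun n hn => ?_
  have : n ≠ 0 := by have := (Finset.mem_Ioc.1 hn).1; omega
  rw [aa_apply]; simp [this]

lemma FF_short {x y : ℝ} (hy : 1 < y) (hx : 1 ≤ x) (hxy : x < y^2) : FF 1 y x = 2 * FF 0 y x - 1 := by
  unfold FF
  have h1 : (1:ℕ) ∈ Finset.Icc 0 ⌊x⌋₊ := by simp [Nat.one_le_floor_iff, hx]
  rw [← Finset.add_sum_erase _ _ h1, ← Finset.add_sum_erase (a := 1) (s := Finset.Icc 0 ⌊x⌋₊) (f := fun n => aa 0 y n) h1, mul_add, Finset.mul_sum]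
  have e1 : aa 1 y 1 = 1 := by simp [aa_apply]
  have e0 : aa 0 y 1 = 1 := by simp [aa_apply]
  rw [e1, e0]
  have : ∑ n ∈ (Finset.Icc 0 ⌊x⌋₊).erase 1, aa 1 y n = ∑ n ∈ (Finset.Icc 0 ⌊x⌋₊).erase 1, 2 * aa 0 y n := by
    refine Finset.sum_congr rfl fun n hn => ?_
    obtain ⟨hn1, hn2⟩ := Finset.mem_erase.1 hn
    rw [aa_apply, aa_apply]
    split_ifs with hc
    · obtain ⟨h0, h2⟩ := hc
      have h2 : y < n.minFac := h2.resolve_left hn1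
      have hnx : (n:ℝ) ≤ x := (Nat.le_floor_iff (by linarith)).1 (Finset.mem_Icc.1 hn2).2
      have hp : n.Prime := by
        by_contra hnp
        have := Nat.minFac_sq_le_self (Nat.pos_of_ne_zero h0) hnp
        have h3 : ((n.minFac:ℝ))^2 ≤ n := by exact_mod_cast this
        nlinarith
      rw [Nat.Prime.divisors hp, Finset.card_pair hp.one_lt.ne]
      norm_num
    · simp
  rw [this]; ring

lemma Phi_lower : ∃ L0 : ℝ, 2 ≤ L0 ∧ ∀ (ω : ℝ → ℝ), IsXi 0 ω → ∀ y x : ℝ, L0 ≤ log y → 1 < y → 2 * y ≤ x →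
    x / (16 * log y) ≤ FF 0 y x := by
  obtain ⟨Q, hQ, H⟩ := E_bd
  have ht : Tendsto (fun L : ℝ => 2 * Q * exp (-(3/2*√L))) atTop (nhds 0) := by
    have : Tendsto (fun L : ℝ => (3/2*√L)) atTop atTop :=
      Tendsto.const_mul_atTop (by norm_num) tendsto_sqrt_atTop
    simpa using (tendsto_exp_neg_atTop_nhds_zero.comp this).const_mul (2 * Q)
  obtain ⟨L0, hL0⟩ := (ht.eventually (gt_mem_nhds (by norm_num : (0:ℝ) < 1/16))).exists_forall_of_atTop
  refine ⟨max 2 L0, le_max_left _ _, fun ω h y x hL hy hx => ?_⟩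
  have hL2 : 2 ≤ log y := (le_max_left _ _).trans hL
  have hQ' := hL0 _ ((le_max_right _ _).trans hL)
  have hyx : y ≤ x := by linarith
  have hx0 : 0 < x := by linarith
  have h1 := H 0 (by norm_num) ω h y x (by linarith) hy hyx
  obtain ⟨hi, hG⟩ := GG_split h hy hyx
  have h2 : (x - y) * (1/4) ≤ ∫ t in y..x, ω (log t / log y) := by
    have := intervalIntegral.integral_mono_on (f := fun _ => (1/4:ℝ)) hyx (by simp) hi fun t ht => by
      simpa using (xi_bd (by norm_num) h (u_ge hy ht.1)).1
    simpa using this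
  have h3 : x / (8 * log y) ≤ GG ω y x := by
    rw [hG]
    have : (log y)⁻¹ * (x/8) ≤ (log y)⁻¹ * ∫ t in y..x, ω (log t / log y) := by
      gcongr; linarith
    have e : (log y)⁻¹ * (x/8) = x / (8 * log y) := by field_simp
    linarith
  have h4 : Q * exp (-(3/2*√(log y))) / (log y - 1) * (x * log x ^ 0) ≤ x / (16 * log y) := by
    have a : 1 / (log y - 1) ≤ 2 / log y := by
      rw [div_le_div_iff₀ (by linarith) (by linarith)]; linarith
    calc _ = (Q * exp (-(3/2*√(log y)))) * (1 / (log y - 1)) * x := by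
          rw [pow_zero]; ring
      _ ≤ (Q * exp (-(3/2*√(log y)))) * (2 / log y) * x := by gcongr
      _ = (2 * Q * exp (-(3/2*√(log y)))) * (x / log y) := by ring
      _ ≤ 1/16 * (x / log y) := by gcongr
      _ = _ := by field_simp
  have h5 : x / (8 * log y) = x / (16 * log y) + x / (16 * log y) := by field_simp; norm_num
  have := (abs_le.1 h1).1
  linarith

lemma ratio_aux {A B a b C e : ℝ} (ha : 0 < a) (hb : 0 < b) (he : 0 ≤ C * e) (he2 : C * e ≤ 1/2)
    (hA : |A - a| ≤ C * a * e) (hB : |B - b| ≤ C * b * e) : |A / B - a / b| ≤ 4 * C * (a / b) * e := by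
  have hB0 : b / 2 ≤ B := by
    have := (abs_le.1 hB).1
    have : C * b * e ≤ b / 2 := by nlinarith
    linarith
  have hBp : 0 < B := by linarith
  have e1 : A / B - a / b = ((A - a) * b - a * (B - b)) / (B * b) := by field_simp; ring
  rw [e1, abs_div, abs_of_pos (by positivity : 0 < B * b), div_le_iff₀ (by positivity)]
  have h1 : |(A - a) * b - a * (B - b)| ≤ 2 * (C * e) * (a * b) := by
    refine (abs_sub _ _).trans ?_
    rw [abs_mul, abs_mul, abs_of_pos hb, abs_of_pos ha]
    have := mul_le_mul_of_nonneg_right hA hb.le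
    have := mul_le_mul_of_nonneg_left hB ha.le
    linarith
  refine h1.trans ?_
  have e2 : 4 * C * (a / b) * e * (B * b) = 4 * (C * e) * a * B := by field_simp
  rw [e2]
  have : 0 ≤ (C * e) * a := by positivity
  nlinarith

lemma FF_small {y Y x : ℝ} (hyY : y ≤ Y) (hx : 1 ≤ x) : x / (2 * (⌈Y⌉₊.factorial : ℝ)) ≤ FF 0 y x := by
  set M := ⌈Y⌉₊.factorial with hM
  have hM0 : 0 < M := Nat.factorial_pos _
  rw [← Phi_eq]
  unfold Phi
  have hf : 1 ≤ ⌊x⌋₊ := by simp [Nat.one_le_floor_iff, hx]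
  have hsub : (Finset.range ((⌊x⌋₊ - 1) / M + 1)).image (fun j => 1 + j * M) ⊆
      (Finset.Icc 1 ⌊x⌋₊).filter (fun n => n = 1 ∨ y < (n.minFac : ℝ)) := by
    intro n hn
    obtain ⟨j, hj, rfl⟩ := Finset.mem_image.1 hn
    have hj' : j ≤ (⌊x⌋₊ - 1) / M := Nat.lt_succ_iff.1 (Finset.mem_range.1 hj)
    have hj2 : j * M ≤ ⌊x⌋₊ - 1 := (Nat.le_div_iff_mul_le hM0).1 hj'
    refine Finset.mem_filter.2 ⟨Finset.mem_Icc.2 ⟨by omega, by omega⟩, ?_⟩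
    by_cases h1 : 1 + j * M = 1
    · exact Or.inl h1
    · right
      by_contra hc
      push Not at hc
      have hp := Nat.minFac_prime h1
      have h2 : (1 + j * M).minFac ≤ ⌈Y⌉₊ := by
        have : ((1 + j * M).minFac : ℝ) ≤ ⌈Y⌉₊ := hc.trans (hyY.trans (Nat.le_ceil _))
        exact_mod_cast this
      have h3 : (1 + j * M).minFac ∣ M := hp.dvd_factorial.2 h2
      have h4 := Nat.minFac_dvd (1 + j * M)
      have h5 : (1 + j * M).minFac ∣ 1 := (Nat.dvd_add_left (h3.mul_left j)).1 h4
      exact hp.one_lt.ne' (Nat.dvd_one.1 h5)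
  have hcard := Finset.card_le_card hsub
  rw [Finset.card_image_of_injective _ (fun a b hab => by
    have : a * M = b * M := by simpa using hab
    exact Nat.eq_of_mul_eq_mul_right hM0 this), Finset.card_range] at hcard
  have h6 : ⌊x⌋₊ ≤ ((⌊x⌋₊ - 1) / M + 1) * M := by
    have := Nat.lt_mul_div_succ (⌊x⌋₊ - 1) hM0
    rw [mul_comm]; omega
  have h7 : ⌊x⌋₊ ≤ ((Finset.Icc 1 ⌊x⌋₊).filter (fun n => n = 1 ∨ y < (n.minFac : ℝ))).card * M :=
    h6.trans (Nat.mul_le_mul_right _ hcard)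
  have h8 : (⌊x⌋₊:ℝ) ≤ (((Finset.Icc 1 ⌊x⌋₊).filter (fun n => n = 1 ∨ y < (n.minFac : ℝ))).card : ℝ) * M := by
    exact_mod_cast h7
  have h9 := Nat.lt_floor_add_one x
  have h10 : (1:ℝ) ≤ ⌊x⌋₊ := by exact_mod_cast hf
  have hMr : (0:ℝ) < M := by exact_mod_cast hM0
  rw [div_le_iff₀ (by positivity)]
  linarith

lemma part1 {ξ ω : ℝ → ℝ} (hξ : IsXi 1 ξ) (hω : IsXi 0 ω) :
    ∃ C : ℝ, 0 < C ∧ ∀ x y : ℝ, 2 ≤ y → 2 * y ≤ x →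
      |FF 1 y x / FF 0 y x - ξ (log x / log y) / ω (log x / log y)| ≤
        C * (ξ (log x / log y) / ω (log x / log y)) *
          (1 / log x + exp (-sqrt (log y))) := by
  obtain ⟨C1, hC1, H⟩ := FF_main
  obtain ⟨L1, hL1, HP⟩ := Phi_lower
  have ht : Tendsto (fun L : ℝ => C1 * (1 / L + exp (-√L))) atTop (nhds 0) := by
    have t1 : Tendsto (fun L : ℝ => 1 / L) atTop (nhds 0) := by simpa using tendsto_inv_atTop_zero (𝕜 := ℝ)
    simpa using (t1.add (tendsto_exp_neg_atTop_nhds_zero.comp tendsto_sqrt_atTop)).const_mul C1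
  obtain ⟨L2, hL2⟩ := (ht.eventually (gt_mem_nhds (by norm_num : (0:ℝ) < 1/2))).exists_forall_of_atTop
  set L0 := max L1 L2 with hL0
  set M : ℝ := (⌈exp L0⌉₊.factorial : ℝ) with hM
  have hM1 : 1 ≤ M := by rw [hM]; exact_mod_cast Nat.succ_le_of_lt (Nat.factorial_pos _)
  have hL02 : 2 ≤ L0 := hL1.trans (le_max_left _ _)
  set C3 := (32 * M * L0 + 1) * exp (√L0) with hC3
  have hC30 : 0 < C3 := by positivity
  refine ⟨4 * C1 + 32 + C3, by positivity, fun x y hy hx => ?_⟩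
  have hy1 : 1 < y := by linarith
  have hyx : y ≤ x := by linarith
  have hx4 : 4 ≤ x := by linarith
  have hx0 : 0 < x := by linarith
  have hL := log_pos hy1
  have hlx1 : 1 ≤ log x := by
    rw [le_log_iff_exp_le hx0]
    linarith [exp_one_lt_d9]
  have hlx : 0 < log x := by linarith
  have hu1 : 1 ≤ log x / log y := u_ge hy1 hyx
  have bξ := xi_bd le_rfl hξ hu1
  have bω := xi_bd (by norm_num) hω hu1
  obtain ⟨ls1, ls2⟩ := log_sq (by linarith : 1 ≤ x)
  have hLx : log y ≤ log x := log_le_log (by linarith) hyx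
  set u := log x / log y with hu
  rw [pow_one] at bξ
  rw [pow_zero] at bω
  have hξ0 : 0 < ξ u := by linarith [bξ.1]
  have hω0 : 0 < ω u := by linarith [bω.1]
  set ε := 1 / log x + exp (-√(log y)) with hε
  have hε1 : 1 / log x ≤ ε := by rw [hε]; linarith [exp_pos (-√(log y))]
  have hε2 : exp (-√(log y)) ≤ ε := by
    have : 0 < 1 / log x := by positivity
    linarith
  have hε0 : 0 < ε := by positivity
  set R := ξ u / ω u with hR
  have hR0 : 0 < R := by positivity
  have w1 : 0 ≤ C1 * R * ε := by positivity
  have w2 : 0 ≤ R * ε := by positivity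
  have w3 : 0 ≤ C3 * R * ε := by positivity
  rcases le_or_gt L0 (log y) with hbig | hsmall
  · rcases le_or_gt (y^2) x with hxy | hxy
    · have h1 := H 1 le_rfl ξ hξ y x (hL02.trans hbig) hy1 hxy
      have h0 := H 0 (by norm_num) ω hω y x (hL02.trans hbig) hy1 hxy
      have he : C1 * ε ≤ 1/2 := by
        refine le_trans ?_ (hL2 _ ((le_max_right _ _).trans hbig)).le
        rw [hε]; gcongr
      have h2 := ratio_aux (by positivity) (by positivity) (by positivity) he h1 h0
      have e : x * ξ u / log y / (x * ω u / log y) = R := by rw [hR]; field_simp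
      rw [← hu, e] at h2
      linarith
    · have hu2 : u ≤ 2 := by
        rw [hu, div_le_iff₀ hL]
        have := log_le_log hx0 hxy.le
        rw [log_pow] at this; exact_mod_cast this
      have r2 : R = 2 := by
        rw [hR, xi_12 hξ hu1 hu2, xi_12 hω hu1 hu2]
        have : u ≠ 0 := by linarith
        push_cast; field_simp; norm_num
      have hP := HP ω hω y x ((le_max_left _ _).trans hbig) hy1 hx
      have hP' : x / (16 * log x) ≤ FF 0 y x := le_trans (by gcongr) hP
      have hP0 : 0 < FF 0 y x := lt_of_lt_of_le (by positivity) hP'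
      rw [FF_short hy1 (by linarith) hxy, r2]
      have e : (2 * FF 0 y x - 1) / FF 0 y x - 2 = -(1 / FF 0 y x) := by field_simp; ring
      rw [e, abs_neg, abs_of_pos (by positivity)]
      have : 1 / FF 0 y x ≤ 64 * (1 / log x) := by
        calc 1 / FF 0 y x ≤ 1 / (x / (16 * log x)) := one_div_le_one_div_of_le (by positivity) hP'
          _ = (16 * log x) / x := by rw [one_div_div]
          _ ≤ 64 * (1 / log x) := by
            rw [mul_one_div, div_le_div_iff₀ hx0 hlx]; rw [pow_two] at ls2; linarith
      rw [r2] at w1 w3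
      linarith
  · have hyY : y ≤ exp L0 := by
      rw [← exp_log (by linarith : 0 < y)]; exact exp_le_exp.2 hsmall.le
    have hP := FF_small hyY (by linarith : 1 ≤ x)
    have hP0 : 0 < FF 0 y x := lt_of_lt_of_le (by positivity) hP
    have hS := FF_triv le_rfl y (by linarith : 1 ≤ x)
    rw [pow_one] at hS
    have hSP : FF 1 y x / FF 0 y x ≤ 4 * M * log x := by
      rw [div_le_iff₀ hP0]
      calc FF 1 y x ≤ x * (2 * log x) := hS.trans (by gcongr; linarith)
        _ = 4 * M * log x * (x / (2 * M)) := by field_simp; norm_num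
        _ ≤ _ := by gcongr
    have hRl : log x ≤ 8 * L0 * R := by
      have a1 : u / 8 ≤ R := by
        rw [hR, le_div_iff₀ hω0]
        have := mul_le_mul_of_nonneg_left bω.2 (by linarith : 0 ≤ u / 8)
        linarith [bξ.1]
      have a2 : log x = u * log y := by rw [hu]; field_simp
      rw [a2]
      calc u * log y ≤ (8 * R) * L0 := by gcongr; linarith
        _ = _ := by ring
    have hS0 : 0 ≤ FF 1 y x / FF 0 y x := div_nonneg (FF_nonneg _ _ _) hP0.le
    have h1 : |FF 1 y x / FF 0 y x - R| ≤ (32 * M * L0 + 1) * R := by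
      have : 4 * M * log x ≤ 4 * M * (8 * L0 * R) := by gcongr
      have p : 0 ≤ M * L0 * R := by positivity
      rw [abs_le]; constructor <;> linarith
    have h2 : (32 * M * L0 + 1) * R ≤ C3 * R * ε := by
      have : 1 ≤ exp (√L0) * ε := by
        calc 1 = exp (√L0) * exp (-√L0) := by rw [← exp_add]; simp
          _ ≤ exp (√L0) * exp (-√(log y)) := by gcongr
          _ ≤ _ := by gcongr
      calc (32 * M * L0 + 1) * R = (32 * M * L0 + 1) * R * 1 := by ring
        _ ≤ (32 * M * L0 + 1) * R * (exp (√L0) * ε) := by gcongr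
        _ = _ := by rw [hC3]; ring
    linarith
end PF

theorem cor1_mean_value (ξ ω : ℝ → ℝ)
    (hξ0 : ∀ u : ℝ, u < 1 → ξ u = 0)
    (hξ : ∀ u : ℝ, 1 ≤ u → u * ξ u = 2 + 2 * ∫ t in (1:ℝ)..(u - 1), ξ t)
    (hω0 : ∀ u : ℝ, u < 1 → ω u = 0)
    (hω : ∀ u : ℝ, 1 ≤ u → u * ω u = 1 + ∫ t in (1:ℝ)..(u - 1), ω t) :
    (∃ C : ℝ, ∀ x y : ℝ, 2 ≤ y → 2 * y ≤ x →
      |S x y / Phi x y - ξ (Real.log x / Real.log y) / ω (Real.log x / Real.log y)| ≤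
        C * (ξ (Real.log x / Real.log y) / ω (Real.log x / Real.log y)) *
          (1 / Real.log x + Real.exp (-Real.sqrt (Real.log y)))) ∧
    (∀ u : ℝ, 2 ≤ u →
      Tendsto (fun x : ℝ => S x (x ^ (1 / u)) / Phi x (x ^ (1 / u))) atTop
        (nhds (ξ u / ω u))) := by
  have h1 : PF.IsXi 1 ξ := ⟨hξ0, fun u hu => by rw [hξ u hu]; norm_num⟩
  have h0 : PF.IsXi 0 ω := ⟨hω0, fun u hu => by rw [hω u hu]; norm_num⟩
  obtain ⟨C, hC, H⟩ := PF.part1 h1 h0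
  refine ⟨⟨C, fun x y hy hx => ?_⟩, fun u hu => ?_⟩
  · rw [PF.S_eq, PF.Phi_eq]; exact H x y hy hx
  · simp only [PF.S_eq, PF.Phi_eq]
    have hu0 : 0 < u := by linarith
    rw [tendsto_iff_norm_sub_tendsto_zero]
    have ty : Tendsto (fun x : ℝ => x ^ (1/u)) atTop atTop := tendsto_rpow_atTop (by positivity)
    have tl : Tendsto (fun x : ℝ => Real.log (x ^ (1/u))) atTop atTop := Real.tendsto_log_atTop.comp ty
    have te : Tendsto (fun x : ℝ => C * (ξ u / ω u) * (1 / Real.log x + Real.exp (-√(Real.log (x ^ (1/u)))))) atTop (nhds 0) := by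
      have t1 : Tendsto (fun x : ℝ => 1 / Real.log x) atTop (nhds 0) := by
        simp only [one_div]; exact Real.tendsto_log_atTop.inv_tendsto_atTop
      have t2 : Tendsto (fun x : ℝ => Real.exp (-√(Real.log (x ^ (1/u))))) atTop (nhds 0) :=
        Real.tendsto_exp_neg_atTop_nhds_zero.comp (Real.tendsto_sqrt_atTop.comp tl)
      simpa using (t1.add t2).const_mul (C * (ξ u / ω u))
    refine squeeze_zero' (Eventually.of_forall fun x => norm_nonneg _) ?_ te
    filter_upwards [ty.eventually_ge_atTop 2, eventually_gt_atTop 1] with x hx2 hx1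
    have hx0 : 0 < x := by linarith
    have hlx := Real.log_pos hx1
    have hsq : (x ^ (1/u)) ^ 2 ≤ x := by
      rw [← Real.rpow_natCast, ← Real.rpow_mul hx0.le]
      calc x ^ (1 / u * (2:ℕ)) ≤ x ^ (1:ℝ) := by
            refine Real.rpow_le_rpow_of_exponent_le hx1.le ?_
            rw [one_div_mul_eq_div, div_le_one hu0]; exact_mod_cast hu
        _ = x := Real.rpow_one x
    have := H x (x ^ (1/u)) hx2 (by nlinarith)
    have e : Real.log x / Real.log (x ^ (1/u)) = u := by
      rw [Real.log_rpow hx0]; field_simp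
    rw [e] at this
    rw [Real.norm_eq_abs]; exact this
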